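/- Assume the weight sequence b satisfies conditions (M1), (M2) and (M3). For every real t, let m_n(t) be the largest integer m such that a(n)·m + ρ·log a(n) − (ρ−1)·log|log a(n)| − (ρ−1)·log ρ − log A ≤ t. Then lim_{n→∞} P(X_n ≤ m_n(t)) = e^{−e^{−t}}; that is, the normalized largest part a(n)X_n + ρ·log a(n) − (ρ−1)·log|log a(n)| − (ρ−1)·log ρ − log A of a uniformly random b-weighted partition of n converges in distribution, as n → ∞, to the Gumbel law with distribution function e^{−e^{−t}}. -/

import Mathlib

open Filter Topology Asymptotics MeasureTheory Real

noncomputable section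

/-- `F_b(x) = -∑_{k≥1} b_k log(1 - x^k)` (so that `f_b = exp F_b`). -/
def Fb (b : ℕ → ℝ) (x : ℝ) : ℝ := -∑' k : ℕ, b (k + 1) * Real.log (1 - x ^ (k + 1))

/-- Complex version of `log f_b` (principal branch). -/
def FbC (b : ℕ → ℝ) (x : ℂ) : ℂ := -∑' k : ℕ, (b (k + 1) : ℂ) * Complex.log (1 - x ^ (k + 1))

/-- `f_b(x) = ∏_{k≥1} (1 - x^k)^{-b_k}`. -/
def fb (b : ℕ → ℝ) (x : ℝ) : ℝ := Real.exp (Fb b x)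

/-- Complex version of `f_b`. -/
def fbC (b : ℕ → ℝ) (x : ℂ) : ℂ := Complex.exp (FbC b x)

/-- `F_{m,b}(x) = -∑_{k=1}^m b_k log(1 - x^k)`. -/
def Fmb (b : ℕ → ℝ) (m : ℕ) (x : ℝ) : ℝ := -∑ k ∈ Finset.Icc 1 m, b k * Real.log (1 - x ^ k)

/-- `f_{m,b}(x) = ∏_{k=1}^m (1 - x^k)^{-b_k}`. -/
def fmb (b : ℕ → ℝ) (m : ℕ) (x : ℝ) : ℝ := Real.exp (Fmb b m x)

/-- `𝒜_b(r) = r F_b'(r)`. -/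
def Abf (b : ℕ → ℝ) (r : ℝ) : ℝ := r * deriv (Fb b) r

/-- `ℬ_b(r) = r² F_b''(r) + r F_b'(r)`. -/
def Bbf (b : ℕ → ℝ) (r : ℝ) : ℝ :=
  r ^ 2 * iteratedDeriv 2 (Fb b) r + r * deriv (Fb b) r

/-- Meinardus condition (M1): the Dirichlet series `D(s) = ∑_{k≥1} b_k k^{-s}` converges for
`Re s > ρ` and `Dc` is its analytic continuation to `{Re s ≥ -C₀}`, analytic there except for a
simple pole at `s = ρ` with residue `A > 0`. -/
def M1 (b : ℕ → ℝ) (ρ C₀ A : ℝ) (Dc : ℂ → ℂ) : Prop :=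
  0 < ρ ∧ 0 < C₀ ∧ C₀ < 1 ∧ 0 < A ∧
  (∀ s : ℂ, ρ < s.re →
    HasSum (fun k : ℕ => (b (k + 1) : ℂ) * ((k + 1 : ℕ) : ℂ) ^ (-s)) (Dc s)) ∧
  (∀ s : ℂ, -C₀ ≤ s.re → s ≠ (ρ : ℂ) → DifferentiableAt ℂ Dc s) ∧
  (∃ φ : ℂ → ℂ, (∀ s : ℂ, -C₀ ≤ s.re → DifferentiableAt ℂ φ s) ∧
    ∀ s : ℂ, -C₀ ≤ s.re → s ≠ (ρ : ℂ) → Dc s = (A : ℂ) / (s - (ρ : ℂ)) + φ s)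

/-- Meinardus condition (M2): the continuation `Dc` is of finite order `C₁` in `{Re s ≥ -C₀}`,
i.e. `Dc s = O(|Im s|^{C₁})` as `|Im s| → ∞`, uniformly in `Re s ≥ -C₀`. -/
def M2 (C₀ C₁ : ℝ) (Dc : ℂ → ℂ) : Prop :=
  0 < C₁ ∧ ∃ K y₀ : ℝ, ∀ s : ℂ, -C₀ ≤ s.re → y₀ ≤ |s.im| → ‖Dc s‖ ≤ K * |s.im| ^ C₁

/-- Meinardus condition (M3): `∑_{k≥1} b_k e^{-kα} sin²(πku) ≥ C₂ α^{-ε}` for all small `α > 0`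
and all `u` with `α/(2π) < |u| ≤ 1/2`. -/
def M3 (b : ℕ → ℝ) : Prop :=
  ∃ ε C₂ : ℝ, 0 < ε ∧ 0 < C₂ ∧ ∃ α₀ : ℝ, 0 < α₀ ∧ ∀ α : ℝ, 0 < α → α ≤ α₀ →
    ∀ u : ℝ, α / (2 * π) < |u| → |u| ≤ 1 / 2 →
      C₂ * α ^ (-ε) ≤
        ∑' k : ℕ, b (k + 1) * Real.exp (-((k : ℝ) + 1) * α) * Real.sin (π * ((k : ℝ) + 1) * u) ^ 2

/-- `h = A Γ(ρ+1) ζ(ρ+1)`. -/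
def hMein (ρ A : ℝ) : ℝ := A * Real.Gamma (ρ + 1) * (riemannZeta ((ρ : ℂ) + 1)).re

/-- The normalizing constant `a(n) = (A Γ(ρ+1) ζ(ρ+1) / n)^{1/(ρ+1)}`. -/
def aM (ρ A : ℝ) (n : ℕ) : ℝ := (hMein ρ A / n) ^ ((1 : ℝ) / (ρ + 1))

section PartA


/-- Mellin transform of the Riesz kernel. -/
def KF (J : ℕ) (s : ℂ) : ℂ := (J.factorial : ℂ) / ∏ j ∈ Finset.range (J + 1), (s + (j : ℂ))

/-- Riesz kernel. -/
def RK (J : ℕ) (t : ℝ) : ℝ := (max (1 - t) 0) ^ J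

lemma RK_cont (J : ℕ) : Continuous (RK J) := by unfold RK; fun_prop

lemma mellin_RK (J : ℕ) (hJ : 1 ≤ J) (s : ℂ) (hs : 0 < s.re) :
    MellinConvergent (fun t => ((RK J t : ℝ) : ℂ)) s ∧
    mellin (fun t => ((RK J t : ℝ) : ℂ)) s = KF J s := by
  have hz : ∀ t ∈ Set.Ioi (0:ℝ) \ Set.Ioc 0 1, (t : ℂ) ^ (s - 1) • ((RK J t : ℝ) : ℂ) = 0 := by
    intro t ht
    simp only [Set.mem_sdiff, Set.mem_Ioi, Set.mem_Ioc, not_and, not_le] at ht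
    have : RK J t = 0 := by
      unfold RK
      rw [max_eq_right (by linarith [ht.2 ht.1])]
      exact zero_pow (by omega)
    simp [this]
  have he : ∀ t ∈ Set.Ioc (0:ℝ) 1, (t : ℂ) ^ (s - 1) * (1 - (t:ℂ)) ^ (((J : ℂ) + 1) - 1)
      = (t : ℂ) ^ (s - 1) • ((RK J t : ℝ) : ℂ) := by
    intro t ht
    have : RK J t = (1 - t) ^ J := by
      unfold RK
      rw [max_eq_left (by linarith [ht.2])]
    rw [this, add_sub_cancel_right, Complex.cpow_natCast]
    push_cast
    rfl
  have hsub : Set.Ioc (0:ℝ) 1 ⊆ Set.Ioi 0 := fun x hx => hx.1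
  constructor
  · have h := Complex.betaIntegral_convergent (u := s) (v := (J:ℂ) + 1) hs
      (by simp; positivity)
    rw [intervalIntegrable_iff_integrableOn_Ioc_of_le zero_le_one] at h
    have h2 := h.congr_fun he measurableSet_Ioc
    unfold MellinConvergent
    exact IntegrableOn.of_forall_sdiff_eq_zero h2 measurableSet_Ioi hz
  · change ∫ t in Set.Ioi (0:ℝ), (t : ℂ) ^ (s - 1) • ((RK J t : ℝ) : ℂ) = _
    rw [setIntegral_eq_of_subset_of_forall_sdiff_eq_zero measurableSet_Ioi hsub hz,
      ← setIntegral_congr_fun measurableSet_Ioc he,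
      ← intervalIntegral.integral_of_le zero_le_one]
    exact Complex.betaIntegral_eval_nat_add_one_right hs J

lemma KF_bound (J : ℕ) (s : ℂ) (hs : s.im ≠ 0) :
    ‖KF J s‖ ≤ J.factorial / |s.im| ^ (J + 1) := by
  unfold KF
  rw [norm_div, norm_prod]
  have h0 : 0 < |s.im| := abs_pos.mpr hs
  have : |s.im| ^ (J + 1) ≤ ∏ j ∈ Finset.range (J + 1), ‖s + (j:ℂ)‖ := by
    have := Finset.prod_le_prod (s := Finset.range (J+1)) (f := fun _ => |s.im|)
      (g := fun j : ℕ => ‖s + (j:ℂ)‖) (fun _ _ => h0.le) (by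
        intro j _
        have := Complex.abs_im_le_norm (s + (j:ℂ))
        simpa using this)
    simpa using this
  have hn : ‖(J.factorial : ℂ)‖ = J.factorial := by simp
  rw [hn]
  gcongr

lemma KF_diff (J : ℕ) (s : ℂ) (hs : 0 < s.re) : DifferentiableAt ℂ (KF J) s := by
  unfold KF
  apply DifferentiableAt.div (by fun_prop)
  · apply DifferentiableAt.fun_finsetProd
    intro i _
    fun_prop
  · rw [Finset.prod_ne_zero_iff]
    intro j _ h
    have := congrArg Complex.re h
    simp at this
    have : (0:ℝ) ≤ j := by positivity
    linarith

/-- Decay bound on a closed strip. -/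
lemma strip_bound (Φ : ℂ → ℂ) (p q C y₀ : ℝ)
    (hc : ContinuousOn Φ {s | p ≤ s.re ∧ s.re ≤ q})
    (hb : ∀ s : ℂ, p ≤ s.re → s.re ≤ q → y₀ ≤ |s.im| → ‖Φ s‖ ≤ C / s.im ^ 2) :
    ∃ K, ∀ s : ℂ, p ≤ s.re → s.re ≤ q → ‖Φ s‖ ≤ K * (1 + s.im ^ 2)⁻¹ := by
  set Y := max y₀ 1
  have hcomp : IsCompact (Set.Icc p q ×ℂ Set.Icc (-Y) Y) := isCompact_Icc.reProdIm isCompact_Icc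
  obtain ⟨K1, hK1⟩ := hcomp.exists_bound_of_continuousOn (f := Φ) (hc.mono (by
    intro s hs
    rw [Complex.mem_reProdIm] at hs
    exact hs.1))
  refine ⟨max (2 * |C|) (|K1| * (1 + Y ^ 2)), fun s h1 h2 => ?_⟩
  have hpos : 0 < 1 + s.im ^ 2 := by positivity
  rw [← div_eq_mul_inv, le_div_iff₀ hpos]
  rcases le_total Y |s.im| with h | h
  · have := hb s h1 h2 (le_trans (le_max_left _ _) h)
    have h1' : 1 ≤ |s.im| := le_trans (le_max_right _ _) h
    have h2' : 1 ≤ s.im ^ 2 := by rw [← sq_abs]; nlinarith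
    refine le_trans ?_ (le_max_left _ _)
    calc ‖Φ s‖ * (1 + s.im^2) ≤ (|C| / s.im ^ 2) * (2 * s.im ^ 2) := by
          gcongr
          · exact this.trans (by gcongr; exact le_abs_self C)
          · linarith
      _ = 2 * |C| := by
          have : s.im ^ 2 ≠ 0 := by linarith
          generalize s.im ^ 2 = z at *
          field_simp
  · refine le_trans ?_ (le_max_right _ _)
    have := hK1 s (by
      rw [Complex.mem_reProdIm]
      exact ⟨⟨h1, h2⟩, abs_le.mp h⟩)
    have h3 : s.im ^ 2 ≤ Y ^ 2 := by rw [← sq_abs]; gcongr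
    gcongr
    exact this.trans (le_abs_self _)

lemma line_integrable (Φ : ℂ → ℂ) (p q K r : ℝ) (h1 : p ≤ r) (h2 : r ≤ q)
    (hc : ContinuousOn Φ {s | p ≤ s.re ∧ s.re ≤ q})
    (hb : ∀ s : ℂ, p ≤ s.re → s.re ≤ q → ‖Φ s‖ ≤ K * (1 + s.im ^ 2)⁻¹) :
    Integrable (fun y : ℝ => Φ (r + y * Complex.I)) := by
  refine Integrable.mono' (integrable_inv_one_add_sq.const_mul K) ?_ ?_
  · apply Continuous.aestronglyMeasurable
    apply hc.comp_continuous (by fun_prop)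
    intro y
    simp [h1, h2]
  · refine Eventually.of_forall fun y => ?_
    have := hb (r + y * Complex.I) (by simpa using h1) (by simpa using h2)
    simpa using this

/-- Contour shift. -/
lemma contour_shift (H : ℂ → ℂ) (p q K : ℝ) (hpq : p ≤ q)
    (hd : ∀ s : ℂ, p ≤ s.re → s.re ≤ q → DifferentiableAt ℂ H s)
    (hb : ∀ s : ℂ, p ≤ s.re → s.re ≤ q → ‖H s‖ ≤ K * (1 + s.im ^ 2)⁻¹) :
    ∫ y : ℝ, H (q + y * Complex.I) = ∫ y : ℝ, H (p + y * Complex.I) := by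
  have hc : ContinuousOn H {s | p ≤ s.re ∧ s.re ≤ q} := fun s hs =>
    (hd s hs.1 hs.2).continuousAt.continuousWithinAt
  have iq := line_integrable H p q K q hpq le_rfl hc hb
  have ip := line_integrable H p q K p le_rfl hpq hc hb
  have hn : Tendsto (fun n : ℕ => -(n:ℝ)) atTop atBot :=
    tendsto_neg_atTop_atBot.comp tendsto_natCast_atTop_atTop
  have tq := intervalIntegral_tendsto_integral iq hn tendsto_natCast_atTop_atTop
  have tp := intervalIntegral_tendsto_integral ip hn tendsto_natCast_atTop_atTop
  have hdec : Tendsto (fun n : ℕ => K * (1 + (n:ℝ) ^ 2)⁻¹ * |q - p|) atTop (𝓝 0) := by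
    have h : Tendsto (fun n : ℕ => (1 + (n:ℝ) ^ 2)⁻¹) atTop (𝓝 0) := by
      apply tendsto_inv_atTop_zero.comp
      apply tendsto_atTop_add_const_left
      exact (tendsto_pow_atTop (by norm_num)).comp tendsto_natCast_atTop_atTop
    simpa using (h.const_mul K).mul_const |q - p|
  have hor : ∀ e : ℝ, e ^ 2 = 1 → Tendsto (fun n : ℕ =>
      ∫ x in p..q, H (x + ((e * n : ℝ) : ℂ) * Complex.I)) atTop (𝓝 0) := by
    intro e he
    rw [tendsto_zero_iff_norm_tendsto_zero]
    refine squeeze_zero (fun _ => norm_nonneg _) (fun n => ?_) hdec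
    apply intervalIntegral.norm_integral_le_of_norm_le_const
    intro x hx
    rw [Set.uIoc_of_le hpq] at hx
    have := hb (x + ((e * n : ℝ) : ℂ) * Complex.I) (by simpa using hx.1.le) (by simpa using hx.2)
    simpa [mul_pow, he] using this
  have h1 := hor (-1) (by norm_num)
  have h2 := hor 1 (by norm_num)
  have key : ∀ n : ℕ, Complex.I • ((∫ y in (-(n:ℝ))..n, H (q + y * Complex.I)) -
      (∫ y in (-(n:ℝ))..n, H (p + y * Complex.I))) =
      (∫ x in p..q, H (x + ((1 * n : ℝ) : ℂ) * Complex.I)) -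
      (∫ x in p..q, H (x + ((-1 * n : ℝ) : ℂ) * Complex.I)) := by
    intro n
    have := Complex.integral_boundary_rect_eq_zero_of_differentiableOn H (p + ((-n : ℝ):ℂ) * Complex.I)
      (q + ((n:ℝ):ℂ) * Complex.I) (by
        intro s hs
        rw [Complex.mem_reProdIm] at hs
        have h3 := hs.1
        simp only [Complex.add_re, Complex.ofReal_re, Complex.mul_re, Complex.ofReal_im,
          Complex.I_re, Complex.I_im, mul_zero, zero_mul, sub_zero, add_zero,
          Set.uIcc_of_le hpq] at h3
        exact (hd s h3.1 h3.2).differentiableWithinAt)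
    simp at this
    simp only [smul_eq_mul, mul_sub, one_mul, neg_mul, Complex.ofReal_neg, Complex.ofReal_natCast]
    linear_combination this
  have hl := ((tq.sub tp).const_smul Complex.I)
  simp_rw [key] at hl
  have := tendsto_nhds_unique hl (h2.sub h1)
  simp at this
  exact sub_eq_zero.mp this

end PartA

section PartB


lemma KF_line_integrable (J : ℕ) (hJ : 1 ≤ J) (r : ℝ) (hr : 0 < r) :
    Integrable (fun y : ℝ => KF J (r + y * Complex.I)) := by
  have hc : ContinuousOn (KF J) {s : ℂ | r ≤ s.re ∧ s.re ≤ r} := fun s hs =>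
    (KF_diff J s (lt_of_lt_of_le hr hs.1)).continuousAt.continuousWithinAt
  obtain ⟨K, hK⟩ := strip_bound (KF J) r r J.factorial 1 hc (by
    intro s _ _ h
    have h0 : s.im ≠ 0 := by intro h'; rw [h'] at h; norm_num at h
    refine (KF_bound J s h0).trans ?_
    rw [← sq_abs]
    gcongr
    omega)
  exact line_integrable (KF J) r r K r le_rfl le_rfl hc hK

lemma KF_inv (J : ℕ) (hJ : 1 ≤ J) (r : ℝ) (hr : 0 < r) (t : ℝ) (ht : 0 < t) :
    ∫ y : ℝ, (t : ℂ) ^ (-((r:ℂ) + y * Complex.I)) * KF J (r + y * Complex.I) =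
      2 * π * (RK J t : ℝ) := by
  have hm := fun y : ℝ => mellin_RK J hJ (r + y * Complex.I) (by simpa using hr)
  have h0 := mellin_RK J hJ r (by simpa using hr)
  have hv : Complex.VerticalIntegrable (mellin (fun t => ((RK J t : ℝ) : ℂ))) r := by
    unfold Complex.VerticalIntegrable
    simp_rw [fun y => (hm y).2]
    exact KF_line_integrable J hJ r hr
  have := mellinInv_mellin_eq r (fun t => ((RK J t : ℝ) : ℂ)) ht h0.1 hv
    (Complex.continuous_ofReal.comp (RK_cont J)).continuousAt
  unfold mellinInv at this
  simp_rw [fun y => (hm y).2] at this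
  simp only [smul_eq_mul, Complex.real_smul] at this
  rw [← this]
  push_cast
  generalize (∫ y : ℝ, (t : ℂ) ^ (-((r:ℂ) + y * Complex.I)) * KF J (r + y * Complex.I)) = X
  have hp : (π:ℂ) ≠ 0 := by exact_mod_cast Real.pi_ne_zero
  field_simp

lemma div_cpow_aux (k : ℕ) (x : ℝ) (hx : 0 < x) (s : ℂ) :
    ((((k:ℝ) + 1) / x : ℝ) : ℂ) ^ (-s) = ((k + 1 : ℕ) : ℂ) ^ (-s) * (x:ℂ) ^ s := by
  rw [div_eq_mul_inv, Complex.ofReal_mul, Complex.mul_cpow_ofReal_nonneg (by positivity) (by positivity)]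
  congr 1
  · push_cast; rfl
  · rw [Complex.cpow_neg, Complex.ofReal_inv, Complex.inv_cpow, inv_inv]
    rw [Complex.arg_ofReal_of_nonneg hx.le]
    exact Real.pi_pos.ne

lemma norm_cpow_aux (x : ℝ) (hx : 0 < x) (r y : ℝ) :
    ‖(x:ℂ) ^ ((r:ℂ) + y * Complex.I)‖ = x ^ r := by
  rw [Complex.norm_cpow_eq_rpow_re_of_pos hx]; simp

lemma norm_cpow_aux' (x : ℝ) (hx : 0 < x) (r y : ℝ) :
    ‖(x:ℂ) ^ (-((r:ℂ) + y * Complex.I))‖ = x ^ (-r) := by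
  rw [Complex.norm_cpow_eq_rpow_re_of_pos hx]; simp

lemma summable_dirichlet (b : ℕ → ℝ) (ρ C₀ A : ℝ) (Dc : ℂ → ℂ)
    (h1 : M1 b ρ C₀ A Dc) (r : ℝ) (hr : ρ < r) :
    Summable (fun k : ℕ => b (k + 1) * ((k:ℝ) + 1) ^ (-r)) := by
  obtain ⟨-, -, -, -, hs, -⟩ := h1
  have := (hs r (by simpa using hr)).summable
  have h := Complex.reCLM.summable this
  refine h.congr fun k => ?_
  have : (((k + 1 : ℕ) : ℂ) ^ (-(r:ℂ))) = ((((k:ℝ)+1) ^ (-r) : ℝ) : ℂ) := by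
    rw [Complex.ofReal_cpow (by positivity)]; push_cast; rfl
  rw [this]
  simp

/-- The sum as a vertical integral. -/
lemma riesz_integral (b : ℕ → ℝ) (hb : ∀ k, 0 ≤ b k) (ρ C₀ A : ℝ) (Dc : ℂ → ℂ)
    (h1 : M1 b ρ C₀ A Dc) (J : ℕ) (hJ : 1 ≤ J) (r : ℝ) (hr : ρ < r) (x : ℝ) (hx : 0 < x) :
    ∫ y : ℝ, (x:ℂ) ^ ((r:ℂ) + y * Complex.I) * (Dc (r + y * Complex.I) * KF J (r + y * Complex.I)) =
      2 * π * ((∑' k : ℕ, b (k+1) * RK J (((k:ℝ) + 1) / x) : ℝ) : ℂ) := by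
  have hr0 : 0 < r := h1.1.trans hr
  have hKi := KF_line_integrable J hJ r hr0
  have hsum := summable_dirichlet b ρ C₀ A Dc h1 r hr
  let F : ℕ → ℝ → ℂ := fun k y => (b (k+1) : ℂ) *
    ((((((k:ℝ) + 1) / x : ℝ) : ℂ) ^ (-((r:ℂ) + y * Complex.I))) * KF J (r + y * Complex.I))
  have hnorm : ∀ k y, ‖F k y‖ = (b (k+1) * ((k:ℝ)+1) ^ (-r)) * x ^ r * ‖KF J (r + y * Complex.I)‖ := by
    intro k y
    have hk : (0:ℝ) < ((k:ℝ)+1)/x := by positivity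
    simp only [F]
    rw [norm_mul, norm_mul, norm_cpow_aux' _ hk, Complex.norm_real, Real.norm_of_nonneg (hb _),
      Real.div_rpow (by positivity) hx.le, Real.rpow_neg hx.le]
    field_simp
  have hIntg : ∀ k, Integrable (F k) := by
    intro k
    have hm : AEStronglyMeasurable (F k) volume := by
      refine AEStronglyMeasurable.mul aestronglyMeasurable_const
        (AEStronglyMeasurable.mul ?_ hKi.aestronglyMeasurable)
      apply Continuous.aestronglyMeasurable
      have hk : ((((k:ℝ)+1)/x : ℝ) : ℂ) ≠ 0 := by
        rw [Complex.ofReal_ne_zero]; positivity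
      exact Continuous.const_cpow (by fun_prop) (Or.inl hk)
    refine (Integrable.mono' (hKi.norm.const_mul ((b (k+1) * ((k:ℝ)+1) ^ (-r)) * x ^ r)) hm ?_)
    exact Eventually.of_forall fun y => (hnorm k y).le
  have hs2 : Summable fun k => ∫ y, ‖F k y‖ := by
    simp_rw [hnorm, integral_const_mul]
    exact (hsum.mul_right _).mul_right _
  have H := hasSum_integral_of_summable_integral_norm hIntg hs2
  have e1 : ∀ k, ∫ y, F k y = 2 * π * ((b (k+1) * RK J (((k:ℝ) + 1) / x) : ℝ) : ℂ) := by
    intro k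
    simp only [F]
    rw [integral_const_mul, KF_inv J hJ r hr0 _ (by positivity)]
    push_cast; ring
  have e2 : ∀ y : ℝ, ∑' k, F k y = (x:ℂ) ^ ((r:ℂ) + y * Complex.I) *
      (Dc (r + y * Complex.I) * KF J (r + y * Complex.I)) := by
    intro y
    have hD := (h1.2.2.2.2.1 (r + y * Complex.I) (by simpa using hr))
    rw [← hD.tsum_eq, ← tsum_mul_right, ← tsum_mul_left]
    congr 1
    ext k
    simp only [F]
    rw [div_cpow_aux k x hx]
    ring
  simp_rw [e1, e2] at H
  rw [← H.tsum_eq, tsum_mul_left, Complex.ofReal_tsum]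

/-- Asymptotics of the Riesz mean. -/
lemma riesz_asymp (b : ℕ → ℝ) (hb : ∀ k, 0 ≤ b k) (ρ C₀ A C₁ : ℝ) (Dc : ℂ → ℂ)
    (h1 : M1 b ρ C₀ A Dc) (h2 : M2 C₀ C₁ Dc) :
    ∃ J : ℕ, 1 ≤ J ∧ ∃ r : ℝ, 0 < r ∧ r < ρ ∧ ∃ K : ℝ, ∀ x : ℝ, 1 ≤ x →
      |(∑' k : ℕ, b (k+1) * RK J (((k:ℝ) + 1) / x)) -
        A * (J.factorial / ∏ j ∈ Finset.range (J+1), (ρ + j)) * (x ^ ρ * RK J (1 / x))| ≤ K * x ^ r := by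
  have h1' := h1
  obtain ⟨hρ, hC0, hC0', hA, hs, hd, φ, hφ, hDφ⟩ := h1'
  obtain ⟨hC1, K₂, y₀, hK₂⟩ := h2
  set J : ℕ := ⌈C₁⌉₊ + 1 with hJdef
  have hJ : 1 ≤ J := by omega
  have hJC : C₁ + 2 ≤ (J + 1 : ℕ) := by
    rw [hJdef]; push_cast
    have := Nat.le_ceil C₁
    linarith
  set p : ℝ := max (ρ / 2) (ρ - 1 / 2)
  have hp0 : 0 < p := lt_of_lt_of_le (by positivity) (le_max_left _ _)
  have hp1 : ρ - 1 < p := lt_of_lt_of_le (by linarith) (le_max_right _ _)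
  have hpρ : p < ρ := max_lt (by linarith) (by linarith)
  set q : ℝ := ρ + 1
  let g : ℂ → ℂ := fun s => (J.factorial : ℂ) / ∏ j ∈ Finset.range J, (s - ρ + ((j + 1 : ℕ) : ℂ))
  let ψ : ℂ → ℂ := fun s => KF J s - KF J ρ * g s
  let Φ : ℂ → ℂ := fun s => φ s * KF J s + A * dslope ψ ρ s
  let U : Set ℂ := {s | max 0 (ρ - 1) < s.re}
  have hU : IsOpen U := isOpen_lt continuous_const Complex.continuous_re
  have hUρ : U ∈ 𝓝 (ρ : ℂ) := hU.mem_nhds (by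
    change max 0 (ρ - 1) < (ρ:ℂ).re
    simp [hρ])
  have hgρ : g ρ = 1 := by
    simp only [g, sub_self, zero_add]
    rw [← Nat.cast_prod, Finset.prod_range_add_one_eq_factorial]
    exact div_self (by exact_mod_cast J.factorial_ne_zero)
  have hgd : ∀ s ∈ U, DifferentiableAt ℂ g s := by
    intro s hs
    apply DifferentiableAt.div (by fun_prop)
    · apply DifferentiableAt.fun_finsetProd
      intro i _
      fun_prop
    · rw [Finset.prod_ne_zero_iff]
      intro j _ h
      have := congrArg Complex.re h
      have hs' : ρ - 1 < s.re := lt_of_le_of_lt (le_max_right _ _) hs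
      simp at this
      have : (0:ℝ) ≤ j := by positivity
      linarith
  have hKd : ∀ s ∈ U, DifferentiableAt ℂ (KF J) s := fun s hs =>
    KF_diff J s (lt_of_le_of_lt (le_max_left _ _) hs)
  have hψd : DifferentiableOn ℂ ψ U := fun s hs =>
    ((hKd s hs).sub ((hgd s hs).const_mul _)).differentiableWithinAt
  have hdsl : DifferentiableOn ℂ (dslope ψ ρ) U := (Complex.differentiableOn_dslope hUρ).mpr hψd
  have hΦd : ∀ s ∈ U, DifferentiableAt ℂ Φ s := by
    intro s hs
    have hs0 : 0 < s.re := lt_of_le_of_lt (le_max_left _ _) hs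
    exact ((hφ s (by linarith)).mul (hKd s hs)).add
      ((hdsl.differentiableAt (hU.mem_nhds hs)).const_mul _)
  have hpU : ∀ s : ℂ, p ≤ s.re → s ∈ U := fun s h => lt_of_lt_of_le (max_lt hp0 hp1) h
  have hΦe : ∀ s : ℂ, 0 < s.re → s ≠ ρ →
      Φ s = Dc s * KF J s - A * KF J ρ * KF J (s - ρ) := by
    intro s hs hne
    have hne' : s - ρ ≠ 0 := sub_ne_zero.mpr hne
    have hψρ : ψ ρ = 0 := by simp [ψ, hgρ]
    have hKg : KF J (s - ρ) = g s / (s - ρ) := by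
      simp only [KF, g]
      rw [Finset.prod_range_succ']
      simp only [Nat.cast_zero, add_zero]
      rw [div_div]
    simp only [Φ]
    rw [dslope_of_ne _ hne, slope_def_field, hψρ, hDφ s (by linarith) hne, hKg]
    simp only [ψ]
    field_simp
    ring
  have hfar : ∀ s : ℂ, p ≤ s.re → s.re ≤ q → max y₀ 1 ≤ |s.im| →
      ‖Φ s‖ ≤ ((|K₂| + A * ‖KF J ρ‖) * J.factorial) / s.im ^ 2 := by
    intro s hsp _ hy
    have hy1 : 1 ≤ |s.im| := (le_max_right _ _).trans hy
    have hpos : 0 < |s.im| := by linarith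
    have him : s.im ≠ 0 := abs_pos.mp hpos
    have hne : s ≠ ρ := by
      intro h; rw [h] at him; simp at him
    rw [hΦe s (by linarith) hne]
    have b1 := KF_bound J s him
    have b2 := KF_bound J (s - ρ) (by simpa using him)
    simp only [Complex.sub_im, Complex.ofReal_im, sub_zero] at b2
    have b3 := hK₂ s (by linarith) ((le_max_left _ _).trans hy)
    have e1 : 1 ≤ |s.im| ^ C₁ := Real.one_le_rpow hy1 hC1.le
    have e2 : |s.im| ^ C₁ / |s.im| ^ (J + 1) ≤ 1 / s.im ^ 2 := by
      rw [← sq_abs, div_le_div_iff₀ (by positivity) (by positivity), one_mul,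
        ← Real.rpow_natCast, ← Real.rpow_natCast, ← Real.rpow_add hpos]
      apply Real.rpow_le_rpow_of_exponent_le hy1
      push_cast at hJC ⊢
      linarith
    calc ‖Dc s * KF J s - A * KF J ρ * KF J (s - ρ)‖
        ≤ ‖Dc s‖ * ‖KF J s‖ + A * ‖KF J ρ‖ * ‖KF J (s - ρ)‖ := by
          refine (norm_sub_le _ _).trans ?_
          rw [norm_mul, norm_mul, norm_mul, Complex.norm_real, Real.norm_of_nonneg hA.le]
      _ ≤ (|K₂| * |s.im| ^ C₁) * (J.factorial / |s.im| ^ (J+1)) +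
          A * ‖KF J ρ‖ * (|s.im| ^ C₁ * (J.factorial / |s.im| ^ (J+1))) := by
          gcongr
          · exact b3.trans (by gcongr; exact le_abs_self _)
          · refine b2.trans ?_
            exact le_mul_of_one_le_left (by positivity) e1
      _ = ((|K₂| + A * ‖KF J ρ‖) * J.factorial) * (|s.im| ^ C₁ / |s.im| ^ (J + 1)) := by ring
      _ ≤ ((|K₂| + A * ‖KF J ρ‖) * J.factorial) * (1 / s.im ^ 2) := by gcongr
      _ = _ := by ring
  have hcΦ : ContinuousOn Φ {s | p ≤ s.re ∧ s.re ≤ q} := fun s hs =>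
    (hΦd s (hpU s hs.1)).continuousAt.continuousWithinAt
  obtain ⟨K, hK⟩ := strip_bound Φ p q _ _ hcΦ hfar
  have hpq : p ≤ q := by simp only [q]; linarith
  have ip := line_integrable Φ p q K p le_rfl hpq hcΦ hK
  refine ⟨J, hJ, p, hp0, hpρ, ∫ y : ℝ, ‖Φ (p + y * Complex.I)‖, fun x hx => ?_⟩
  have hx0 : 0 < x := by linarith
  have hxne : (x:ℂ) ≠ 0 := by exact_mod_cast hx0.ne'
  have hshift := contour_shift (fun s => (x:ℂ) ^ s * Φ s) p q (x ^ q * K) hpq (by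
      intro s hsp hsq
      apply DifferentiableAt.mul _ (hΦd s (hpU s hsp))
      exact (DifferentiableAt.const_cpow differentiableAt_id (Or.inl hxne))) (by
      intro s hsp hsq
      rw [norm_mul, Complex.norm_cpow_eq_rpow_re_of_pos hx0, mul_assoc]
      gcongr
      exact hK s hsp hsq)
  have I1 := riesz_integral b hb ρ C₀ A Dc h1 J hJ q (by simp [q]) x hx0
  have I2 := KF_inv J hJ 1 one_pos (1 / x) (by positivity)
  have hneq : ∀ y : ℝ, (q:ℂ) + y * Complex.I ≠ ρ := by
    intro y h
    have := congrArg Complex.re h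
    simp [q] at this
  have hq0 : 0 < q := by simp only [q]; linarith
  have hpt : ∀ y : ℝ, (x:ℂ) ^ ((q:ℂ) + y * Complex.I) * Φ (q + y * Complex.I) =
      (x:ℂ) ^ ((q:ℂ) + y * Complex.I) * (Dc (q + y * Complex.I) * KF J (q + y * Complex.I)) -
      (A * KF J ρ * (x:ℂ) ^ (ρ:ℂ)) * (((1 / x : ℝ) : ℂ) ^ (-(((1:ℝ):ℂ) + y * Complex.I)) *
        KF J (((1:ℝ):ℂ) + y * Complex.I)) := by
    intro y
    rw [hΦe _ (by simpa using hq0) (hneq y)]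
    have e1 : (q:ℂ) + y * Complex.I - ρ = ((1:ℝ):ℂ) + y * Complex.I := by
      simp only [q]; push_cast; ring
    have e2 : ((1 / x : ℝ) : ℂ) ^ (-(((1:ℝ):ℂ) + y * Complex.I)) =
        (x:ℂ) ^ (((1:ℝ):ℂ) + y * Complex.I) := by
      have := div_cpow_aux 0 x hx0 (((1:ℝ):ℂ) + y * Complex.I)
      simpa using this
    have e3 : (x:ℂ) ^ ((q:ℂ) + y * Complex.I) = (x:ℂ) ^ (ρ:ℂ) * (x:ℂ) ^ (((1:ℝ):ℂ) + y * Complex.I) := by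
      rw [← Complex.cpow_add _ _ hxne, ← e1]; congr 1; ring
    rw [e1, e2, e3]
    ring
  have hcx : ∀ r : ℝ, Continuous (fun y : ℝ => (x:ℂ) ^ ((r:ℂ) + y * Complex.I)) := fun r =>
    Continuous.const_cpow (by fun_prop) (Or.inl hxne)
  have hIntg2 : Integrable (fun y : ℝ => ((1 / x : ℝ) : ℂ) ^ (-(((1:ℝ):ℂ) + y * Complex.I)) *
        KF J (((1:ℝ):ℂ) + y * Complex.I)) := by
    have hk := KF_line_integrable J hJ 1 one_pos
    refine hk.bdd_mul (c := (1/x) ^ (-1:ℝ)) ?_ ?_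
    · apply Continuous.aestronglyMeasurable
      have : ((1 / x : ℝ) : ℂ) ≠ 0 := by rw [Complex.ofReal_ne_zero]; positivity
      exact Continuous.const_cpow (by fun_prop) (Or.inl this)
    · exact Eventually.of_forall fun y => (norm_cpow_aux' (1/x) (by positivity) 1 y).le
  have hIntg3 : Integrable (fun y : ℝ => (x:ℂ) ^ ((q:ℂ) + y * Complex.I) * Φ (q + y * Complex.I)) := by
    refine (line_integrable Φ p q K q hpq le_rfl hcΦ hK).bdd_mul (c := x ^ q)
      (hcx q).aestronglyMeasurable ?_
    exact Eventually.of_forall fun y => (norm_cpow_aux x hx0 q y).le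
  have hmain : ∫ y : ℝ, (x:ℂ) ^ ((q:ℂ) + y * Complex.I) * Φ (q + y * Complex.I) =
      2 * π * (((∑' k : ℕ, b (k+1) * RK J (((k:ℝ) + 1) / x)) -
        A * (J.factorial / ∏ j ∈ Finset.range (J+1), (ρ + j)) * (x ^ ρ * RK J (1 / x)) : ℝ) : ℂ) := by
    have hi1 : Integrable (fun y : ℝ => (x:ℂ) ^ ((q:ℂ) + y * Complex.I) *
        (Dc (q + y * Complex.I) * KF J (q + y * Complex.I))) := by
      have := hIntg3.add (hIntg2.const_mul (A * KF J ρ * (x:ℂ) ^ (ρ:ℂ)))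
      refine this.congr (Eventually.of_forall fun y => ?_)
      simp only [Pi.add_apply, hpt]
      ring
    simp_rw [hpt]
    rw [integral_sub hi1 (hIntg2.const_mul _), integral_const_mul, I1, I2, KF]
    rw [Complex.ofReal_sub, mul_sub]
    congr 1
    push_cast
    rw [Complex.ofReal_cpow hx0.le]
    ring
  have hfin : ‖∫ y : ℝ, (x:ℂ) ^ ((p:ℂ) + y * Complex.I) * Φ (p + y * Complex.I)‖ ≤
      x ^ p * ∫ y : ℝ, ‖Φ (p + y * Complex.I)‖ := by
    refine (norm_integral_le_integral_norm _).trans ?_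
    simp_rw [norm_mul, norm_cpow_aux x hx0]
    rw [integral_const_mul]
  rw [← hshift, hmain, norm_mul, norm_mul, Complex.norm_real, Complex.norm_real, Real.norm_of_nonneg Real.pi_pos.le,
    Real.norm_eq_abs] at hfin
  set X := |(∑' k : ℕ, b (k+1) * RK J (((k:ℝ) + 1) / x)) -
        A * (J.factorial / ∏ j ∈ Finset.range (J+1), (ρ + j)) * (x ^ ρ * RK J (1 / x))|
  have hX : 0 ≤ X := abs_nonneg _
  have h2n : ‖(2:ℂ)‖ = 2 := by simp
  rw [h2n] at hfin
  have := Real.pi_gt_three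
  nlinarith

end PartB

section PartC


/-- Riesz sums. -/
def RS (b : ℕ → ℝ) (j : ℕ) (x : ℝ) : ℝ :=
  ∑ k ∈ Finset.range ⌊x⌋₊, b (k+1) * (x - ((k:ℝ)+1)) ^ j

/-- Counting function of shifted weights. -/
def NS (w : ℕ → ℝ) (x : ℝ) : ℝ := ∑ k ∈ Finset.range ⌊x⌋₊, w k

lemma mem_fl {x : ℝ} (hx : 0 ≤ x) (k : ℕ) : k < ⌊x⌋₊ ↔ (k:ℝ) + 1 ≤ x := by
  rw [← Nat.succ_le_iff, Nat.le_floor_iff hx]; push_cast; rfl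

lemma RS_max (b : ℕ → ℝ) (j : ℕ) (x : ℝ) (hx : 0 ≤ x) (M : ℕ) (hM : ⌊x⌋₊ ≤ M) :
    RS b (j+1) x = ∑ k ∈ Finset.range M, b (k+1) * (max (x - ((k:ℝ)+1)) 0) ^ (j+1) := by
  unfold RS
  rw [← Finset.sum_subset (Finset.range_mono hM)]
  · apply Finset.sum_congr rfl
    intro k hk
    rw [Finset.mem_range, mem_fl hx] at hk
    rw [max_eq_left (by linarith)]
  · intro k _ hk
    rw [Finset.mem_range, mem_fl hx] at hk
    rw [max_eq_right (by linarith)]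
    simp

lemma pow_up (j : ℕ) (a h : ℝ) (ha : 0 ≤ a) (hh : 0 ≤ h) :
    ((j:ℝ)+1) * h * a ^ j ≤ (a + h) ^ (j+1) - a ^ (j+1) := by
  induction j with
  | zero => simp
  | succ j ih =>
    have h1 : (a+h) * (a ^ (j+1) + ((j:ℝ)+1) * h * a ^ j) ≤ (a+h) * (a+h)^(j+1) := by
      gcongr; linarith
    have h2 : 0 ≤ h * (((j:ℝ)+1) * h * a ^ j) := by positivity
    push_cast
    rw [pow_succ (a+h) (j+1), pow_succ a (j+1)]
    rw [pow_succ a j] at *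
    nlinarith

lemma pow_down (j : ℕ) (a h : ℝ) (ha : 0 ≤ a) (hh : 0 ≤ h) :
    a ^ (j+1) - (max (a - h) 0) ^ (j+1) ≤ ((j:ℝ)+1) * h * a ^ j := by
  induction j with
  | zero =>
    have := le_max_left (a-h) 0
    simp; linarith
  | succ j ih =>
    set c := max (a-h) 0
    have hc0 : 0 ≤ c := le_max_right _ _
    have hc1 : a - h ≤ c := le_max_left _ _
    have hca : c ≤ a := max_le (by linarith) ha
    have h1 : a * a ^ (j+1) ≤ a * (c ^ (j+1) + ((j:ℝ)+1) * h * a ^ j) := by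
      gcongr; linarith
    have h2 : c ^ (j+1) ≤ a ^ (j+1) := by gcongr
    have h3 : a * c ^ (j+1) ≤ c * c ^ (j+1) + h * a ^ (j+1) := by
      have : (a - c) * c ^ (j+1) ≤ h * a ^ (j+1) := by
        apply mul_le_mul _ h2 (by positivity) hh
        linarith
      linarith
    push_cast
    rw [pow_succ' a (j+1), pow_succ' c (j+1)]
    have h4 : a * (((j:ℝ)+1) * h * a ^ j) = ((j:ℝ)+1) * h * a ^ (j+1) := by ring
    nlinarith

lemma RS_up (b : ℕ → ℝ) (hb : ∀ k, 0 ≤ b k) (j : ℕ) (x h : ℝ) (hx : 0 ≤ x) (hh : 0 ≤ h) :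
    ((j:ℝ)+1) * h * RS b j x ≤ RS b (j+1) (x+h) - RS b (j+1) x := by
  have hfl : ⌊x⌋₊ ≤ ⌊x+h⌋₊ := Nat.floor_mono (by linarith)
  have : ∑ k ∈ Finset.range ⌊x⌋₊, b (k+1) * (x + h - ((k:ℝ)+1)) ^ (j+1) ≤ RS b (j+1) (x+h) := by
    unfold RS
    apply Finset.sum_le_sum_of_subset_of_nonneg (Finset.range_mono hfl)
    intro k hk _
    rw [Finset.mem_range, mem_fl (by linarith)] at hk
    have : 0 ≤ x + h - ((k:ℝ)+1) := by linarith
    have := hb (k+1)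
    positivity
  refine le_trans ?_ (sub_le_sub_right this _)
  unfold RS
  rw [← Finset.sum_sub_distrib, Finset.mul_sum]
  apply Finset.sum_le_sum
  intro k hk
  rw [Finset.mem_range, mem_fl hx] at hk
  have h1 := pow_up j (x - ((k:ℝ)+1)) h (by linarith) hh
  have h2 : x - ((k:ℝ)+1) + h = x + h - ((k:ℝ)+1) := by ring
  rw [h2] at h1
  have := mul_le_mul_of_nonneg_left h1 (hb (k+1))
  linarith

lemma RS_down (b : ℕ → ℝ) (hb : ∀ k, 0 ≤ b k) (j : ℕ) (x h : ℝ) (hx : h ≤ x) (hh : 0 ≤ h) :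
    RS b (j+1) x - RS b (j+1) (x-h) ≤ ((j:ℝ)+1) * h * RS b j x := by
  have hfl : ⌊x-h⌋₊ ≤ ⌊x⌋₊ := Nat.floor_mono (by linarith)
  rw [RS_max b j (x-h) (by linarith) _ hfl]
  unfold RS
  rw [← Finset.sum_sub_distrib, Finset.mul_sum]
  apply Finset.sum_le_sum
  intro k hk
  rw [Finset.mem_range, mem_fl (by linarith)] at hk
  have h1 := pow_down j (x - ((k:ℝ)+1)) h (by linarith) hh
  have h2 : x - ((k:ℝ)+1) - h = x - h - ((k:ℝ)+1) := by ring
  rw [h2] at h1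
  have := mul_le_mul_of_nonneg_left h1 (hb (k+1))
  linarith

lemma rpow_taylor (p u : ℝ) (hp : 1 ≤ p) (hu : |u| ≤ 1 / (2 * p)) :
    0 ≤ (1+u)^p - 1 - p * u ∧ (1+u)^p - 1 - p * u ≤ 2 * p^2 * u^2 := by
  have hp0 : 0 < p := by linarith
  have hpu : p * |u| ≤ 1/2 := by
    calc p * |u| ≤ p * (1 / (2*p)) := by gcongr
      _ = 1/2 := by field_simp
  have hu2 : |u| ≤ 1/2 := by nlinarith [abs_nonneg u]
  obtain ⟨hl, hr⟩ := abs_le.mp hu2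
  have hpu' : -(1/2) ≤ p * u ∧ p * u ≤ 1/2 := by
    rw [← abs_le, abs_mul, abs_of_pos hp0]; exact hpu
  have h1 := one_add_mul_self_le_rpow_one_add (s := u) (by linarith) hp
  have hpos : 0 < 1 + u := by linarith
  have hs : -1 ≤ -(u/(1+u)) := by
    rw [neg_le_neg_iff, div_le_one hpos]; linarith
  have h2 := one_add_mul_self_le_rpow_one_add hs hp
  have he : (1 + u)^p * (1 + -(u/(1+u)))^p = 1 := by
    rw [← Real.mul_rpow hpos.le (by linarith)]
    have : (1+u) * (1 + -(u/(1+u))) = 1 := by field_simp; ring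
    rw [this, Real.one_rpow]
  set E := (1+u)^p - 1 - p * u with hE
  have hY : (1+u)^p = 1 + p*u + E := by rw [hE]; ring
  have hE0 : 0 ≤ E := by rw [hE]; linarith
  refine ⟨hE0, ?_⟩
  have hYp : 0 < (1+u)^p := Real.rpow_pos_of_pos hpos _
  have h3 : (1+u)^p * (1 + p * -(u/(1+u))) ≤ 1 := by
    calc _ ≤ (1+u)^p * (1 + -(u/(1+u)))^p := mul_le_mul_of_nonneg_left h2 hYp.le
      _ = 1 := he
  have h4 : (1+u)^p * (1 + u - p * u) ≤ 1 + u := by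
    have : (1+u)^p * (1 + u - p * u) = (1+u)^p * (1 + p * -(u/(1+u))) * (1+u) := by
      field_simp; ring
    rw [this]; nlinarith
  rw [hY] at h4
  have h5 : 1/2 ≤ 1 + u - p * u := by
    rcases le_total 0 u with h | h
    · linarith [hpu'.2]
    · nlinarith
  have h6 : E * (1 + u - p * u) ≤ p * (p-1) * u^2 := by linarith
  have h7 : E * (1/2) ≤ E * (1 + u - p * u) := by gcongr
  nlinarith [mul_nonneg hp0.le (sq_nonneg u)]

lemma descend (f g : ℝ → ℝ) (C c p δ K : ℝ) (hC : 0 < C) (hc : 0 ≤ c) (hp : 1 ≤ p)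
    (hδ : 0 < δ) (hδp : δ ≤ p) (hK : 0 ≤ K)
    (hup : ∀ x h, 0 ≤ x → 0 ≤ h → C * h * g x ≤ f (x+h) - f x)
    (hdn : ∀ x h, h ≤ x → 0 ≤ h → f x - f (x-h) ≤ C * h * g x)
    (hf : ∀ x, 0 < x → |f x - c * x ^ p| ≤ K * x ^ (p - δ)) :
    ∃ K', 0 ≤ K' ∧ ∀ x, 1 ≤ x → |g x - c * p / C * x ^ (p-1)| ≤ K' * x ^ (p - 1 - δ/2) := by
  refine ⟨(c * p + 6 * p * K) / C, by positivity, fun x hx => ?_⟩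
  have hx0 : 0 < x := by linarith
  have hp0 : 0 < p := by linarith
  set v := x ^ (-(δ/2)) with hv
  have hv0 : 0 < v := Real.rpow_pos_of_pos hx0 _
  have hv1 : v ≤ 1 := Real.rpow_le_one_of_one_le_of_nonpos hx (by linarith)
  set u := v / (2*p) with hu
  have hu0 : 0 < u := by positivity
  have hub : u ≤ 1/(2*p) := by rw [hu]; gcongr
  have hpu : p * u ≤ 1/2 := by rw [hu]; field_simp; linarith
  have hu2 : u ≤ 1/2 := by nlinarith
  obtain ⟨t1, t2⟩ := rpow_taylor p u hp (by rwa [abs_of_pos hu0])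
  obtain ⟨t3, t4⟩ := rpow_taylor p (-u) hp (by rwa [abs_neg, abs_of_pos hu0])
  have e1 := hup x (x*u) hx0.le (by positivity)
  have e2 := hdn x (x*u) (by nlinarith) (by positivity)
  have a0 := abs_le.mp (hf x hx0)
  have a1 := abs_le.mp (hf (x + x*u) (by positivity))
  have a2 := abs_le.mp (hf (x - x*u) (by nlinarith))
  have m1 : x + x*u = x * (1+u) := by ring
  have m2 : x - x*u = x * (1+ -u) := by ring
  rw [m1, Real.mul_rpow hx0.le (by linarith), Real.mul_rpow hx0.le (by linarith)] at a1
  rw [m2, Real.mul_rpow hx0.le (by linarith), Real.mul_rpow hx0.le (by linarith)] at a2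
  rw [m1] at e1
  rw [m2] at e2
  have g1 : (1+u)^(p-δ) ≤ 2 := by
    refine le_trans (Real.rpow_le_rpow_of_exponent_le (by linarith) (by linarith : p - δ ≤ p)) ?_
    have : (p*u)^2 ≤ (1/2)^2 := by gcongr
    linarith
  have g2 : (1 + -u)^(p-δ) ≤ 1 := Real.rpow_le_one (by linarith) (by linarith) (by linarith)
  set X := x ^ (p-1) with hX
  have hX0 : 0 < X := Real.rpow_pos_of_pos hx0 _
  have xp : x ^ p = x * X := by
    rw [hX, ← Real.rpow_one_add' hx0.le (by linarith)]; congr 1; ring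
  have xpd : x ^ (p-δ) = x * X * v * v := by
    rw [← xp, hv, ← Real.rpow_add hx0, ← Real.rpow_add hx0]; congr 1; ring
  have xf : x ^ (p - 1 - δ/2) = X * v := by
    rw [hX, hv, ← Real.rpow_add hx0]; congr 1
  rw [xp, xpd] at a0 a1 a2
  rw [xf]
  have hvu : v = 2 * p * u := by rw [hu]; field_simp
  set Y := x * X * v * v with hY
  have hY0 : 0 < Y := by positivity
  have k1 : K * (Y * (1+u)^(p-δ)) ≤ K * (Y * 2) := by gcongr
  have k2 : K * (Y * (1+ -u)^(p-δ)) ≤ K * (Y * 1) := by gcongr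
  have hcx : 0 ≤ c * (x * X) := by positivity
  have j1 : c * (x*X*(1+u)^p) ≤ c*(x*X) * (1 + p*u + 2*p^2*u^2) := by
    have : (1+u)^p ≤ 1 + p*u + 2*p^2*u^2 := by linarith
    calc c * (x*X*(1+u)^p) = c*(x*X)*(1+u)^p := by ring
      _ ≤ _ := by gcongr
  have j2 : c * (x*X*(1+ -u)^p) ≤ c*(x*X) * (1 - p*u + 2*p^2*u^2) := by
    have : (1+ -u)^p ≤ 1 - p*u + 2*p^2*u^2 := by nlinarith
    calc c * (x*X*(1+ -u)^p) = c*(x*X)*(1+ -u)^p := by ring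
      _ ≤ _ := by gcongr
  have U : C * (x*u) * g x ≤ c*(x*X)*(p*u + 2*p^2*u^2) + 3 * K * Y := by linarith [a0.1, a1.2]
  have Lo : c*(x*X)*(p*u - 2*p^2*u^2) - 3 * K * Y ≤ C * (x*u) * g x := by
    linarith [mul_nonneg hK hY0.le, a0.1, a2.2]
  have hY' : Y = (x * u) * (2 * p * (X * v)) := by rw [hY]; nth_rw 1 [hvu]; ring
  rw [hY'] at U Lo
  have hxu : 0 < x * u := by positivity
  have U' : C * g x ≤ c * X * (p + p * v) + 3 * K * (2 * p * (X*v)) := by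
    rw [hvu] at U ⊢
    refine le_of_mul_le_mul_left ?_ hxu
    linarith
  have Lo' : c * X * (p - p * v) - 3 * K * (2 * p * (X*v)) ≤ C * g x := by
    rw [hvu] at Lo ⊢
    refine le_of_mul_le_mul_left ?_ hxu
    linarith
  have hfin : g x - c * p / C * X = (C * g x - c * p * X) / C := by field_simp
  rw [hfin, abs_div, abs_of_pos hC, div_mul_eq_mul_div]
  apply div_le_div_of_nonneg_right _ hC.le
  rw [abs_le]
  constructor <;> linarith

end PartC

section PartD


lemma RS_small (b : ℕ → ℝ) (j : ℕ) (x : ℝ) (hx : x < 1) : RS b j x = 0 := by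
  unfold RS
  rw [Nat.floor_eq_zero.mpr hx]; simp

/-- constant of the Riesz mean -/
def cR (A ρ : ℝ) (j : ℕ) : ℝ := A * (j.factorial / ∏ i ∈ Finset.range (j+1), (ρ + i))

lemma cR_pos (A ρ : ℝ) (hA : 0 < A) (hρ : 0 < ρ) (j : ℕ) : 0 < cR A ρ j := by
  unfold cR
  have : 0 < ∏ i ∈ Finset.range (j+1), (ρ + (i:ℝ)) := Finset.prod_pos fun i _ => by positivity
  positivity

lemma cR_step (A ρ : ℝ) (hρ : 0 < ρ) (j : ℕ) :
    cR A ρ (j+1) * (ρ + (j+1:ℕ)) / ((j:ℝ)+1) = cR A ρ j := by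
  unfold cR
  rw [Finset.prod_range_succ _ (j+1), Nat.factorial_succ]
  have : 0 < ∏ i ∈ Finset.range (j+1), (ρ + (i:ℝ)) := Finset.prod_pos fun i _ => by positivity
  push_cast
  have h2 : ρ + ((j:ℝ)+1) ≠ 0 := by positivity
  field_simp

lemma ext_small (f : ℝ → ℝ) (c p δ K : ℝ) (hc : 0 ≤ c) (hδ : 0 < δ) (hK : 0 ≤ K)
    (h0 : ∀ x, 0 < x → x < 1 → f x = 0)
    (hf : ∀ x, 1 ≤ x → |f x - c * x ^ p| ≤ K * x ^ (p - δ)) (δ' : ℝ) (hδ' : 0 < δ') (hle : δ' ≤ δ) :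
    ∀ x, 0 < x → |f x - c * x ^ p| ≤ (K + c) * x ^ (p - δ') := by
  intro x hx
  have hxp : 0 < x ^ (p - δ') := Real.rpow_pos_of_pos hx _
  rcases lt_or_ge x 1 with h | h
  · rw [h0 x hx h, zero_sub, abs_neg, abs_of_nonneg (by positivity)]
    have : x ^ p ≤ x ^ (p - δ') := Real.rpow_le_rpow_of_exponent_ge hx h.le (by linarith)
    nlinarith
  · refine (hf x h).trans ?_
    have : x ^ (p - δ) ≤ x ^ (p - δ') := Real.rpow_le_rpow_of_exponent_le h (by linarith)
    have h1 : K * x ^ (p-δ) ≤ K * x ^ (p-δ') := by gcongr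
    nlinarith

lemma RS_eq_tsum (b : ℕ → ℝ) (J : ℕ) (hJ : 1 ≤ J) (x : ℝ) (hx : 0 < x) :
    RS b J x = x ^ J * ∑' k : ℕ, b (k+1) * RK J (((k:ℝ) + 1) / x) := by
  obtain ⟨j, rfl⟩ : ∃ j, J = j + 1 := ⟨J - 1, by omega⟩
  have hz : ∀ k : ℕ, RK (j+1) (((k:ℝ) + 1) / x) * x ^ (j+1) = (max (x - ((k:ℝ)+1)) 0) ^ (j+1) := by
    intro k
    unfold RK
    rw [← mul_pow, max_mul_of_nonneg _ _ hx.le]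
    congr 2
    · field_simp
    · ring
  rw [tsum_eq_sum (s := Finset.range ⌊x⌋₊)]
  · rw [RS_max b j x hx.le _ le_rfl, Finset.mul_sum]
    apply Finset.sum_congr rfl
    intro k _
    rw [← hz k]; ring
  · intro k hk
    rw [Finset.mem_range, mem_fl hx.le] at hk
    unfold RK
    rw [max_eq_right]
    · simp
    · rw [sub_nonpos, one_le_div hx]; linarith

/-- Power-saving asymptotics for the Riesz sums of order `0` and `1`. -/
lemma NS_asymp (b : ℕ → ℝ) (hb : ∀ k, 0 ≤ b k) (ρ C₀ A C₁ : ℝ) (Dc : ℂ → ℂ)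
    (h1 : M1 b ρ C₀ A Dc) (h2 : M2 C₀ C₁ Dc) :
    ∃ δ K : ℝ, 0 < δ ∧ δ < ρ ∧ 0 ≤ K ∧
      (∀ x, 0 < x → |NS (fun k => b (k+1)) x - A / ρ * x ^ ρ| ≤ K * x ^ (ρ - δ)) ∧
      (∀ x, 0 < x → |NS (fun k => b (k+1) * ((k:ℝ)+1)) x - A / (ρ+1) * x ^ (ρ+1)|
        ≤ K * x ^ (ρ + 1 - δ)) := by
  have hρ := h1.1
  have hA := h1.2.2.2.1
  let P : ℕ → Prop := fun j => ∃ δ K : ℝ, 0 < δ ∧ δ < ρ ∧ 0 ≤ K ∧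
    ∀ x, 0 < x → |RS b j x - cR A ρ j * x ^ (ρ + j)| ≤ K * x ^ (ρ + j - δ)
  have hsm : ∀ j : ℕ, ∀ x : ℝ, 0 < x → x < 1 → RS b j x = 0 := fun j x _ h => RS_small b j x h
  have step : ∀ j, P (j+1) → P j := by
    rintro j ⟨δ, K, hδ, hδρ, hK, h⟩
    obtain ⟨K', hK', hg⟩ := descend (RS b (j+1)) (RS b j) ((j:ℝ)+1) (cR A ρ (j+1)) (ρ + (j+1:ℕ)) δ K
      (by positivity) (cR_pos A ρ hA hρ _).le
      (by push_cast; have : (0:ℝ) ≤ j := by positivity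
          linarith) hδ
      (by push_cast; have : (0:ℝ) ≤ j := by positivity
          linarith) hK
      (fun x h hx hh => RS_up b hb j x h hx hh) (fun x h hx hh => RS_down b hb j x h hx hh) h
    rw [cR_step A ρ hρ] at hg
    refine ⟨δ/2, K' + cR A ρ j, by positivity, by linarith, ?_, ?_⟩
    · have := (cR_pos A ρ hA hρ j).le
      positivity
    · have e : ρ + ((j+1:ℕ):ℝ) - 1 = ρ + j := by push_cast; ring
      rw [e] at hg
      exact ext_small _ _ _ (δ/2) K' (cR_pos A ρ hA hρ j).le (by positivity) hK' (hsm j) hg _ (by positivity) le_rfl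
  obtain ⟨J, hJ, r, hr0, hrρ, K, hK⟩ := riesz_asymp b hb ρ C₀ A C₁ Dc h1 h2
  have PJ : P J := by
    set δ := min (ρ - r) (min (ρ/2) 1) with hδ
    have hδ0 : 0 < δ := by
      rw [hδ]; apply lt_min (by linarith) (lt_min (by linarith) one_pos)
    have hδ1 : δ ≤ ρ - r := min_le_left _ _
    have hδ2 : δ ≤ ρ/2 := (min_le_right _ _).trans (min_le_left _ _)
    have hδ3 : δ ≤ 1 := (min_le_right _ _).trans (min_le_right _ _)
    have hc := cR_pos A ρ hA hρ J
    refine ⟨δ, (|K| + cR A ρ J * J) + cR A ρ J, hδ0, by linarith, by positivity, ?_⟩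
    refine ext_small _ _ _ δ _ hc.le hδ0 (by positivity) (hsm J) ?_ δ hδ0 le_rfl
    intro x hx
    have hx0 : 0 < x := by linarith
    have e := hK x hx
    rw [RS_eq_tsum b J hJ x hx0]
    set S := ∑' k : ℕ, b (k+1) * RK J (((k:ℝ) + 1) / x)
    change |S - cR A ρ J * (x ^ ρ * RK J (1/x))| ≤ K * x ^ r at e
    have hxJ : x ^ (ρ + J) = x ^ J * x ^ ρ := by
      rw [Real.rpow_add hx0, Real.rpow_natCast]; ring
    have hxJ' : x ^ (ρ + J - δ) = x ^ J * x ^ (ρ - δ) := by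
      rw [← Real.rpow_natCast, ← Real.rpow_add hx0]; congr 1; ring
    rw [hxJ, hxJ']
    have hx1 : 1 / x ≤ 1 := by rw [div_le_one hx0]; exact hx
    have hRK : RK J (1/x) ≤ 1 ∧ 1 - J * (1/x) ≤ RK J (1/x) := by
      unfold RK
      rw [max_eq_left (by linarith)]
      constructor
      · exact pow_le_one₀ (by linarith) (by linarith [show 0 < 1/x by positivity])
      · have := one_add_mul_le_pow (a := -(1/x)) (by linarith) J
        calc 1 - J * (1/x) = 1 + J * (-(1/x)) := by ring
          _ ≤ _ := this
          _ = _ := by ring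
    have hd : |cR A ρ J * (x ^ ρ * RK J (1/x)) - cR A ρ J * x ^ ρ| ≤ cR A ρ J * J * x ^ (ρ - δ) := by
      have : cR A ρ J * (x ^ ρ * RK J (1/x)) - cR A ρ J * x ^ ρ = - (cR A ρ J * (x^ρ * (1 - RK J (1/x)))) := by ring
      rw [this, abs_neg, abs_of_nonneg (by
        have : 0 ≤ 1 - RK J (1/x) := by linarith [hRK.1]
        positivity), mul_assoc]
      apply mul_le_mul_of_nonneg_left _ hc.le
      calc x^ρ * (1 - RK J (1/x)) ≤ x^ρ * (J * (1/x)) := by gcongr; linarith [hRK.2]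
        _ = J * x^(ρ - 1) := by rw [Real.rpow_sub_one hx0.ne']; ring
        _ ≤ J * x^(ρ - δ) := by gcongr
    have hr' : K * x ^ r ≤ |K| * x ^ (ρ - δ) := by
      have : x ^ r ≤ x ^ (ρ - δ) := Real.rpow_le_rpow_of_exponent_le hx (by linarith)
      have h0 : 0 < x ^ r := Real.rpow_pos_of_pos hx0 _
      calc K * x^r ≤ |K| * x^r := by gcongr; exact le_abs_self K
        _ ≤ _ := by gcongr
    have hxJ0 : 0 < x ^ J := by positivity
    have : x ^ J * S - cR A ρ J * (x ^ J * x ^ ρ) = x ^ J * ((S - cR A ρ J * (x ^ ρ * RK J (1/x))) +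
        (cR A ρ J * (x ^ ρ * RK J (1/x)) - cR A ρ J * x ^ ρ)) := by ring
    rw [this, abs_mul, abs_of_pos hxJ0]
    calc _ ≤ x ^ J * (|K| * x ^ (ρ-δ) + cR A ρ J * J * x ^ (ρ - δ)) := by
          gcongr
          exact (abs_add_le _ _).trans (add_le_add (e.trans hr') hd)
      _ = _ := by ring
  have P1 : P 1 := by
    have : ∀ n, 1 ≤ n → P n → P 1 := by
      intro n hn
      induction n, hn using Nat.le_induction with
      | base => exact id
      | succ n hn ih => exact fun h => ih (step n h)
    exact this J hJ PJ
  obtain ⟨δ0, K0, hδ0, hδ0ρ, hK0, H0⟩ := step 0 P1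
  obtain ⟨δ1, K1, hδ1, hδ1ρ, hK1, H1⟩ := P1
  have c0 : cR A ρ 0 = A / ρ := by simp [cR, div_eq_mul_inv]
  have c1 : cR A ρ 1 = A / (ρ * (ρ+1)) := by
    simp [cR, Finset.prod_range_succ, div_eq_mul_inv]
  set δ := min δ0 δ1
  have hδ : 0 < δ := lt_min hδ0 hδ1
  have G0 := ext_small _ _ _ δ0 K0 (cR_pos A ρ hA hρ 0).le hδ0 hK0 (hsm 0) (fun x hx => H0 x (by linarith)) δ hδ (min_le_left _ _)
  have G1 := ext_small _ _ _ δ1 K1 (cR_pos A ρ hA hρ 1).le hδ1 hK1 (hsm 1) (fun x hx => H1 x (by linarith)) δ hδ (min_le_right _ _)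
  have q0 := (cR_pos A ρ hA hρ 0)
  have q1 := (cR_pos A ρ hA hρ 1)
  have hN0 : ∀ x, NS (fun k => b (k+1)) x = RS b 0 x := by intro x; simp [NS, RS]
  have hN1 : ∀ x, NS (fun k => b (k+1) * ((k:ℝ)+1)) x = x * RS b 0 x - RS b 1 x := by
    intro x
    simp only [NS, RS]
    rw [Finset.mul_sum, ← Finset.sum_sub_distrib]
    apply Finset.sum_congr rfl
    intro k _
    ring
  refine ⟨δ, (K0 + cR A ρ 0) + (K1 + cR A ρ 1), hδ, (min_le_left _ _).trans_lt hδ0ρ, by positivity, ?_, ?_⟩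
  · intro x hx
    have := G0 x hx
    rw [hN0, ← c0]
    simp only [Nat.cast_zero, add_zero] at this
    refine this.trans ?_
    have : 0 < x ^ (ρ - δ) := Real.rpow_pos_of_pos hx _
    exact mul_le_mul_of_nonneg_right (by linarith) this.le
  · intro x hx
    have e0 := G0 x hx
    have e1 := G1 x hx
    simp only [Nat.cast_zero, add_zero, Nat.cast_one] at e0 e1
    have hx1 : x ^ (ρ+1) = x * x ^ ρ := by rw [Real.rpow_add_one hx.ne']; ring
    have hx2 : x ^ (ρ+1-δ) = x * x ^ (ρ-δ) := by
      rw [show ρ + 1 - δ = (ρ - δ) + 1 by ring, Real.rpow_add_one hx.ne']; ring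
    rw [hN1]
    have : x * RS b 0 x - RS b 1 x - A / (ρ+1) * x ^ (ρ+1) =
      x * (RS b 0 x - cR A ρ 0 * x ^ ρ) - (RS b 1 x - cR A ρ 1 * x ^ (ρ+1)) := by
      rw [c0, c1, hx1]; field_simp; ring
    rw [this]
    refine (abs_sub _ _).trans ?_
    rw [abs_mul, abs_of_pos hx]
    calc _ ≤ x * ((K0 + cR A ρ 0) * x ^ (ρ - δ)) + (K1 + cR A ρ 1) * x ^ (ρ+1-δ) := by gcongr
      _ = _ := by rw [hx2]; ring

end PartD

section PartE


lemma exp_tail_integral (β c : ℝ) (hβ : 0 < β) :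
    IntegrableOn (fun x => β * Real.exp (-(β * x))) (Set.Ici c) ∧
    ∫ x in Set.Ici c, β * Real.exp (-(β * x)) = Real.exp (-(β * c)) := by
  have h1 : IntegrableOn (fun x => Real.exp ((-β) * x)) (Set.Ioi c) :=
    integrableOn_exp_mul_Ioi (by linarith) c
  have h2 := integral_exp_mul_Ioi (a := -β) (by linarith) c
  constructor
  · rw [integrableOn_Ici_iff_integrableOn_Ioi]
    refine (h1.const_mul β).congr (Eventually.of_forall fun x => ?_)
    simp
  · rw [integral_Ici_eq_integral_Ioi, integral_const_mul]
    simp only [neg_mul] at h2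
    rw [h2]; field_simp

/-- Abel summation for exponential sums. -/
lemma abel_exp (w : ℕ → ℝ) (hw : ∀ k, 0 ≤ w k) (β : ℝ) (hβ : 0 < β)
    (hs : Summable (fun k : ℕ => w k * Real.exp (-(β * ((k:ℝ)+1))))) :
    ∑' k : ℕ, w k * Real.exp (-(β * ((k:ℝ)+1))) =
      ∫ x in Set.Ioi (0:ℝ), NS w x * (β * Real.exp (-(β * x))) := by
  let F : ℕ → ℝ → ℝ := fun k => (Set.Ici ((k:ℝ)+1)).indicator (fun x => w k * (β * Real.exp (-(β * x))))
  have hsub : ∀ k : ℕ, Set.Ici ((k:ℝ)+1) ⊆ Set.Ioi 0 := fun k x hx => by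
    have : (k:ℝ)+1 ≤ x := hx
    have h0 : (0:ℝ) ≤ k := by positivity
    exact lt_of_lt_of_le (by linarith) this
  have hFint : ∀ k, Integrable (F k) (volume.restrict (Set.Ioi 0)) := by
    intro k
    rw [integrable_indicator_iff measurableSet_Ici]
    have := ((exp_tail_integral β ((k:ℝ)+1) hβ).1).const_mul (w k)
    unfold IntegrableOn at *
    rw [Measure.restrict_restrict measurableSet_Ici, Set.inter_eq_left.mpr (hsub k)]
    exact this
  have hFval : ∀ k, ∫ x in Set.Ioi (0:ℝ), F k x = w k * Real.exp (-(β * ((k:ℝ)+1))) := by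
    intro k
    simp only [F]
    rw [integral_indicator measurableSet_Ici, Measure.restrict_restrict measurableSet_Ici,
      Set.inter_eq_left.mpr (hsub k), integral_const_mul, (exp_tail_integral β _ hβ).2]
  have hFnn : ∀ k x, 0 ≤ F k x := by
    intro k x
    apply Set.indicator_nonneg
    intro y _
    have := hw k
    positivity
  have H := hasSum_integral_of_summable_integral_norm hFint (by
    simp_rw [Real.norm_of_nonneg (hFnn _ _), hFval]
    exact hs)
  simp_rw [hFval] at H
  rw [H.tsum_eq]
  apply setIntegral_congr_fun measurableSet_Ioi
  intro x hx
  have hx0 : (0:ℝ) < x := hx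
  simp only
  rw [tsum_eq_sum (s := Finset.range ⌊x⌋₊)]
  · unfold NS
    rw [Finset.sum_mul]
    apply Finset.sum_congr rfl
    intro k hk
    rw [Finset.mem_range, mem_fl hx0.le] at hk
    simp only [F]
    rw [Set.indicator_of_mem (show x ∈ Set.Ici ((k:ℝ)+1) from hk)]
  · intro k hk
    rw [Finset.mem_range, mem_fl hx0.le] at hk
    simp only [F]
    rw [Set.indicator_of_notMem (show x ∉ Set.Ici ((k:ℝ)+1) from hk)]

lemma gamma_int (a r : ℝ) (ha : -1 < a) (hr : 0 < r) :
    IntegrableOn (fun x => x ^ a * (r * Real.exp (-(r * x)))) (Set.Ioi 0) ∧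
    ∫ x in Set.Ioi (0:ℝ), x ^ a * (r * Real.exp (-(r * x))) = Real.Gamma (a+1) * r ^ (-a) := by
  have h := Real.integral_rpow_mul_exp_neg_mul_Ioi (a := a+1) (r := r) (by linarith) hr
  have hi : IntegrableOn (fun x : ℝ => x ^ a * Real.exp (-r * x)) (Set.Ioi 0) := by
    have := integrableOn_rpow_mul_exp_neg_mul_rpow (s := a) (p := 1) (b := r) ha one_pos hr
    simpa using this
  constructor
  · refine (hi.const_mul r).congr (Eventually.of_forall fun x => ?_)
    simp only [neg_mul]; ring
  · have e : ∀ x : ℝ, x ^ a * (r * Real.exp (-(r * x))) = r * (x ^ (a + 1 - 1) * Real.exp (-(r * x))) := by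
      intro x; rw [add_sub_cancel_right]; ring
    simp_rw [e]
    rw [integral_const_mul, h, one_div, Real.inv_rpow hr.le, Real.rpow_neg hr.le, Real.rpow_add hr, Real.rpow_one]
    have : r ^ a ≠ 0 := (Real.rpow_pos_of_pos hr _).ne'
    field_simp

lemma NS_measurable (w : ℕ → ℝ) : Measurable (NS w) := by
  have : NS w = (fun n : ℕ => ∑ k ∈ Finset.range n, w k) ∘ (fun x : ℝ => ⌊x⌋₊) := rfl
  rw [this]
  exact (measurable_from_nat).comp Nat.measurable_floor

/-- Abelian theorem with power saving. -/
lemma abel_asymp (w : ℕ → ℝ) (hw : ∀ k, 0 ≤ w k) (c p δ K : ℝ) (hp : 0 < p - δ) (hδ : 0 < δ)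
    (hN : ∀ x, 0 < x → |NS w x - c * x ^ p| ≤ K * x ^ (p - δ))
    (β : ℝ) (hβ : 0 < β)
    (hs : Summable (fun k : ℕ => w k * Real.exp (-(β * ((k:ℝ)+1))))) :
    |∑' k : ℕ, w k * Real.exp (-(β * ((k:ℝ)+1))) - c * Real.Gamma (p+1) * β ^ (-p)| ≤
      K * Real.Gamma (p - δ + 1) * β ^ (-(p - δ)) := by
  obtain ⟨i1, v1⟩ := gamma_int p β (by linarith) hβ
  obtain ⟨i2, v2⟩ := gamma_int (p-δ) β (by linarith) hβ
  rw [abel_exp w hw β hβ hs]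
  have hdom : ∀ x ∈ Set.Ioi (0:ℝ), ‖(NS w x - c * x ^ p) * (β * Real.exp (-(β * x)))‖ ≤
      K * (x ^ (p-δ) * (β * Real.exp (-(β * x)))) := by
    intro x hx
    rw [norm_mul, Real.norm_eq_abs, Real.norm_of_nonneg (by positivity), ← mul_assoc K]
    exact mul_le_mul_of_nonneg_right (hN x hx) (by positivity)
  have i3 : IntegrableOn (fun x => (NS w x - c * x ^ p) * (β * Real.exp (-(β * x)))) (Set.Ioi 0) := by
    refine Integrable.mono' (i2.const_mul K) ?_ ?_
    · apply Measurable.aestronglyMeasurable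
      have := NS_measurable w
      fun_prop
    · exact (ae_restrict_iff' measurableSet_Ioi).mpr (Eventually.of_forall hdom)
  have e : ∫ x in Set.Ioi (0:ℝ), NS w x * (β * Real.exp (-(β * x))) =
      (∫ x in Set.Ioi (0:ℝ), (NS w x - c * x ^ p) * (β * Real.exp (-(β * x)))) +
      c * Real.Gamma (p+1) * β ^ (-p) := by
    rw [mul_assoc, ← v1, ← integral_const_mul, ← integral_add i3 (i1.const_mul c)]
    congr 1
    ext x
    ring
  rw [e, add_sub_cancel_right, mul_assoc, ← v2, ← integral_const_mul]
  rw [← Real.norm_eq_abs]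
  exact norm_integral_le_of_norm_le (i2.const_mul K)
    ((ae_restrict_iff' measurableSet_Ioi).mpr (Eventually.of_forall hdom))

end PartE

section PartF


lemma exp_taylor3 (y : ℝ) :
    ‖Complex.exp (Complex.I * y) - 1 - Complex.I * y + y^2/2‖ ≤ 4 * |y|^3 := by
  rcases le_or_gt |y| 1 with h | h
  · have hn : ‖Complex.I * (y:ℂ)‖ = |y| := by simp
    have := Complex.exp_bound (x := Complex.I * y) (by rw [hn]; exact h) (n := 3) (by norm_num)
    rw [hn] at this
    have e : ∑ m ∈ Finset.range 3, (Complex.I * (y:ℂ)) ^ m / (m.factorial : ℂ) =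
        1 + Complex.I * y - y^2/2 := by
      simp [Finset.sum_range_succ, mul_pow, Nat.factorial]
      ring
    rw [e] at this
    have e2 : Complex.exp (Complex.I * y) - 1 - Complex.I * y + y^2/2 =
      Complex.exp (Complex.I * y) - (1 + Complex.I * y - y^2/2) := by ring
    rw [e2]
    refine this.trans ?_
    have : 0 ≤ |y|^3 := by positivity
    simp [Nat.factorial]
    nlinarith
  · have h1 : ‖Complex.exp (Complex.I * y)‖ = 1 := by
      rw [mul_comm]; exact Complex.norm_exp_ofReal_mul_I y
    have h2 : ‖Complex.I * (y:ℂ)‖ = |y| := by simp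
    have h3 : ‖(y:ℂ)^2/2‖ = |y|^2/2 := by simp
    have := norm_add_le (Complex.exp (Complex.I * y) - 1 - Complex.I * y) ((y:ℂ)^2/2)
    have h4 := norm_sub_le (Complex.exp (Complex.I * y) - 1) (Complex.I * y)
    have h5 := norm_sub_le (Complex.exp (Complex.I * y)) 1
    rw [norm_one] at h5
    have h6 : |y| ≤ |y|^3 := by nlinarith [mul_self_nonneg (|y|-1)]
    have h7 : |y|^2 ≤ |y|^3 := by nlinarith [mul_self_nonneg (|y|-1)]
    rw [h1] at h5; rw [h2] at h4; rw [h3] at this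
    nlinarith

variable {ι : Type*}

/-- The exponent of the tilted characteristic function. -/
def PhiC (W : ι → ℝ) (l : ι → ℕ) (θ : ℝ) : ℂ :=
  ∑' i, (W i : ℂ) * (Complex.exp (Complex.I * ((l i * θ : ℝ) : ℂ)) - 1)

lemma PhiC_term_bound (w : ℝ) (hw : 0 ≤ w) (l : ℕ) (θ : ℝ) :
    ‖(w : ℂ) * (Complex.exp (Complex.I * ((l * θ : ℝ) : ℂ)) - 1)‖ ≤ 2 * w := by
  rw [norm_mul, Complex.norm_real, Real.norm_of_nonneg hw]
  have h1 : ‖Complex.exp (Complex.I * ((l * θ : ℝ) : ℂ))‖ = 1 := by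
    rw [mul_comm]; exact Complex.norm_exp_ofReal_mul_I _
  have h5 := norm_sub_le (Complex.exp (Complex.I * ((l * θ : ℝ) : ℂ))) 1
  rw [h1, norm_one] at h5
  nlinarith

lemma PhiC_summable (W : ι → ℝ) (hW : ∀ i, 0 ≤ W i) (hs : Summable W) (l : ι → ℕ) (θ : ℝ) :
    Summable (fun i => (W i : ℂ) * (Complex.exp (Complex.I * ((l i * θ : ℝ) : ℂ)) - 1)) :=
  Summable.of_norm_bounded (hs.mul_left 2) (fun i => PhiC_term_bound _ (hW i) _ _)

lemma PhiC_continuous (W : ι → ℝ) (hW : ∀ i, 0 ≤ W i) (hs : Summable W) (l : ι → ℕ) :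
    Continuous (PhiC W l) := by
  unfold PhiC
  refine continuous_tsum (fun i => by fun_prop) (hs.mul_left 2)
    (fun i θ => PhiC_term_bound _ (hW i) _ _)

lemma PhiC_re (W : ι → ℝ) (hW : ∀ i, 0 ≤ W i) (hs : Summable W) (l : ι → ℕ) (θ : ℝ) :
    (PhiC W l θ).re = - ∑' i, W i * (1 - Real.cos (l i * θ)) := by
  unfold PhiC
  rw [Complex.re_tsum (PhiC_summable W hW hs l θ), ← tsum_neg]
  congr 1; ext i
  rw [Complex.re_ofReal_mul, Complex.sub_re, mul_comm Complex.I, Complex.exp_ofReal_mul_I_re]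
  simp; ring

/-- The full integrand. -/
def HC (W : ι → ℝ) (l : ι → ℕ) (N : ℕ) (θ : ℝ) : ℂ :=
  Complex.exp (PhiC W l θ) * Complex.exp (-(Complex.I * ((N * θ : ℝ) : ℂ)))

lemma HC_norm (W : ι → ℝ) (hW : ∀ i, 0 ≤ W i) (hs : Summable W) (l : ι → ℕ) (N : ℕ) (θ : ℝ) :
    ‖HC W l N θ‖ = Real.exp (- ∑' i, W i * (1 - Real.cos (l i * θ))) := by
  unfold HC
  rw [norm_mul, Complex.norm_exp, PhiC_re W hW hs]
  have : ‖Complex.exp (-(Complex.I * ((N * θ : ℝ) : ℂ)))‖ = 1 := by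
    rw [show -(Complex.I * ((N * θ : ℝ) : ℂ)) = ((-(N*θ) : ℝ) : ℂ) * Complex.I by push_cast; ring]
    exact Complex.norm_exp_ofReal_mul_I _
  rw [this, mul_one]

lemma HC_continuous (W : ι → ℝ) (hW : ∀ i, 0 ≤ W i) (hs : Summable W) (l : ι → ℕ) (N : ℕ) :
    Continuous (HC W l N) := by
  unfold HC
  have := PhiC_continuous W hW hs l
  fun_prop

/-- Coefficient functional. -/
def qC (W : ι → ℝ) (l : ι → ℕ) (N : ℕ) : ℂ :=
  (1 / (2 * π) : ℝ) * ∫ θ in (-π)..π, HC W l N θ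

lemma HC_expand (W : ι → ℝ) (hW : ∀ i, 0 ≤ W i) (l : ι → ℕ) (N : ℕ)
    (s0 : Summable W) (s1 : Summable fun i => W i * (l i:ℝ)) (s2 : Summable fun i => W i * (l i:ℝ)^2)
    (s3 : Summable fun i => W i * (l i:ℝ)^3) (θ : ℝ) :
    ‖(PhiC W l θ - Complex.I * ((N * θ : ℝ):ℂ)) -
      ((-( (∑' i, W i * (l i:ℝ)^2) * θ^2/2) : ℝ) + Complex.I * (((∑' i, W i * (l i:ℝ)) - N) * θ : ℝ))‖ ≤
      4 * |θ|^3 * ∑' i, W i * (l i:ℝ)^3 := by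
  let R : ι → ℂ := fun i => (W i : ℂ) * (Complex.exp (Complex.I * ((l i * θ : ℝ):ℂ)) - 1 - Complex.I * ((l i * θ : ℝ):ℂ)
    + ((l i * θ : ℝ):ℂ)^2/2)
  have hR : ∀ i, ‖R i‖ ≤ 4 * |θ|^3 * (W i * (l i:ℝ)^3) := by
    intro i
    simp only [R]
    rw [norm_mul, Complex.norm_real, Real.norm_of_nonneg (hW i)]
    have := mul_le_mul_of_nonneg_left (exp_taylor3 (l i * θ)) (hW i)
    rw [abs_mul, Nat.abs_cast, mul_pow] at this
    linarith
  have hRs := Summable.of_norm_bounded (s3.mul_left (4 * |θ|^3)) hR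
  have hb := norm_tsum_le_tsum_norm hRs.norm
  have hb2 := hRs.norm.tsum_le_tsum hR (s3.mul_left (4 * |θ|^3))
  rw [tsum_mul_left] at hb2
  have eq : (PhiC W l θ - Complex.I * ((N * θ : ℝ):ℂ)) -
      ((-( (∑' i, W i * (l i:ℝ)^2) * θ^2/2) : ℝ) + Complex.I * (((∑' i, W i * (l i:ℝ)) - N) * θ : ℝ)) = ∑' i, R i := by
    have c1 : HasSum (fun i => ((W i * (l i:ℝ) : ℝ) : ℂ)) ((∑' i, W i * (l i:ℝ) : ℝ) : ℂ) :=
      Complex.hasSum_ofReal.mpr s1.hasSum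
    have c2 : HasSum (fun i => ((W i * (l i:ℝ)^2 : ℝ) : ℂ)) ((∑' i, W i * (l i:ℝ)^2 : ℝ) : ℂ) :=
      Complex.hasSum_ofReal.mpr s2.hasSum
    have c0 := (PhiC_summable W hW s0 l θ).hasSum
    have c := (c0.sub (c1.mul_left (Complex.I * θ))).add (c2.mul_left ((θ:ℂ)^2/2))
    have e : (fun i => (W i : ℂ) * (Complex.exp (Complex.I * ((l i * θ : ℝ) : ℂ)) - 1) -
        Complex.I * θ * ((W i * (l i:ℝ) : ℝ) : ℂ) + (θ:ℂ)^2/2 * ((W i * (l i:ℝ)^2 : ℝ) : ℂ)) = R := by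
      ext i; simp only [R]; push_cast; ring
    rw [e] at c
    rw [c.tsum_eq]
    unfold PhiC
    push_cast
    ring
  rw [eq]
  linarith

/-- Abstract local limit theorem. -/
theorem llt (W : ℕ → ι → ℝ) (l : ι → ℕ) (σ α G : ℕ → ℝ) (c : ℝ) (hc : 0 < c)
    (hσ : Tendsto σ atTop atTop) (hασ : Tendsto (fun n => α n * σ n) atTop atTop)
    (hW : ∀ᶠ n in atTop, ∀ i, 0 ≤ W n i)
    (s0 : ∀ᶠ n in atTop, Summable (W n)) (s1 : ∀ᶠ n in atTop, Summable fun i => W n i * (l i:ℝ))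
    (s2 : ∀ᶠ n in atTop, Summable fun i => W n i * (l i:ℝ)^2)
    (s3 : ∀ᶠ n in atTop, Summable fun i => W n i * (l i:ℝ)^3)
    (ha : Tendsto (fun n : ℕ => ((∑' i, W n i * (l i:ℝ)) - n) / σ n) atTop (𝓝 0))
    (hb : Tendsto (fun n : ℕ => (∑' i, W n i * (l i:ℝ)^2) / σ n ^ 2) atTop (𝓝 1))
    (hc3 : Tendsto (fun n : ℕ => (∑' i, W n i * (l i:ℝ)^3) / σ n ^ 3) atTop (𝓝 0))
    (hα : ∀ᶠ n in atTop, 0 < α n ∧ α n ≤ π)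
    (hd : ∀ᶠ n in atTop, ∀ θ, |θ| ≤ α n → c * σ n ^ 2 * θ ^ 2 ≤ ∑' i, W n i * (1 - Real.cos (l i * θ)))
    (he : ∀ᶠ n in atTop, ∀ θ, α n < |θ| → |θ| ≤ π → G n ≤ ∑' i, W n i * (1 - Real.cos (l i * θ)))
    (hG : Tendsto (fun n => σ n * Real.exp (- G n)) atTop (𝓝 0)) :
    Tendsto (fun n : ℕ => (σ n : ℂ) * qC (W n) l n) atTop (𝓝 ((1 / Real.sqrt (2 * π) : ℝ) : ℂ)) := by
  have hσ0 : ∀ᶠ n in atTop, 0 < σ n := hσ.eventually_gt_atTop 0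
  let g : ℕ → ℝ → ℂ := fun n => (Set.Ioc (-(α n * σ n)) (α n * σ n)).indicator (fun u => HC (W n) l n (u / σ n))
  have hmid : Tendsto (fun n => ∫ u, g n u) atTop (𝓝 (∫ u : ℝ, ((Real.exp (-(1/2) * u^2) : ℝ) : ℂ))) := by
    apply tendsto_integral_filter_of_dominated_convergence (fun u => Real.exp (-c * u^2))
    · filter_upwards [hW, s0] with n hn hn0
      apply AEStronglyMeasurable.indicator _ measurableSet_Ioc
      have := HC_continuous (W n) hn hn0 l n
      exact (this.comp (continuous_id.div_const _)).aestronglyMeasurable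
    · filter_upwards [hW, s0, hd, hσ0] with n hn hn0 hdn hσn
      refine Eventually.of_forall fun u => ?_
      simp only [g]
      by_cases hu : u ∈ Set.Ioc (-(α n * σ n)) (α n * σ n)
      · rw [Set.indicator_of_mem hu, HC_norm _ hn hn0]
        apply Real.exp_le_exp.mpr
        have hle : |u / σ n| ≤ α n := by
          rw [abs_div, abs_of_pos hσn, div_le_iff₀ hσn, abs_le]
          exact ⟨hu.1.le, hu.2⟩
        have := hdn _ hle
        have e : c * σ n ^ 2 * (u / σ n)^2 = c * u^2 := by field_simp
        rw [e] at this
        linarith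
      · rw [Set.indicator_of_notMem hu, norm_zero]; positivity
    · exact integrable_exp_neg_mul_sq hc
    · refine Eventually.of_forall fun u => ?_
      have hin : ∀ᶠ n in atTop, u ∈ Set.Ioc (-(α n * σ n)) (α n * σ n) := by
        filter_upwards [hασ.eventually_gt_atTop |u|] with n hn
        rw [abs_lt] at hn
        exact ⟨hn.1, hn.2.le⟩
      have hlim : Tendsto (fun n : ℕ => PhiC (W n) l (u / σ n) - Complex.I * ((n * (u / σ n) : ℝ):ℂ)) atTop
          (𝓝 ((-(1/2) * u^2 : ℝ) : ℂ)) := by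
        have t1 : Tendsto (fun n : ℕ => (((-( (∑' i, W n i * (l i:ℝ)^2) * (u/σ n)^2/2) : ℝ) : ℂ) +
            Complex.I * (((∑' i, W n i * (l i:ℝ)) - n) * (u/σ n) : ℝ))) atTop (𝓝 (((-(1/2) * u^2 : ℝ) : ℂ) + Complex.I * ((0:ℝ):ℂ))) := by
          apply Tendsto.add
          · refine (Complex.continuous_ofReal.tendsto _).comp ?_
            have := hb.mul_const (-(1/2) * u^2)
            rw [one_mul] at this
            refine this.congr fun n => ?_
            rw [div_pow]; ring
          · refine Tendsto.const_mul _ ((Complex.continuous_ofReal.tendsto _).comp ?_)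
            have := ha.mul_const u
            rw [zero_mul] at this
            refine this.congr fun n => ?_
            ring
        simp only [Complex.ofReal_zero, mul_zero, add_zero] at t1
        have t2 : Tendsto (fun n : ℕ => (PhiC (W n) l (u / σ n) - Complex.I * ((n * (u / σ n) : ℝ):ℂ)) -
          (((-( (∑' i, W n i * (l i:ℝ)^2) * (u/σ n)^2/2) : ℝ) : ℂ) +
            Complex.I * (((∑' i, W n i * (l i:ℝ)) - n) * (u/σ n) : ℝ))) atTop (𝓝 0) := by
          have t3 := (hc3.const_mul (4 * |u|^3))
          rw [mul_zero] at t3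
          refine squeeze_zero_norm' ?_ t3
          filter_upwards [hW, s0, s1, s2, s3, hσ0] with n h0 h1 h2 h3 h4 h5
          have := HC_expand (W n) h0 l n h1 h2 h3 h4 (u / σ n)
          refine this.trans (le_of_eq ?_)
          rw [abs_div, abs_of_pos h5]
          field_simp
        have := t2.add t1
        rw [zero_add] at this
        exact this.congr fun n => by ring
      have hl2 := (Complex.continuous_exp.tendsto _).comp hlim
      rw [← Complex.ofReal_exp] at hl2
      refine hl2.congr' ?_
      filter_upwards [hin] with n hn
      simp only [g, Function.comp]
      rw [Set.indicator_of_mem hn]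
      unfold HC
      rw [← Complex.exp_add, sub_eq_add_neg]
  have hgauss : (∫ u : ℝ, ((Real.exp (-(1/2) * u^2) : ℝ) : ℂ)) = ((Real.sqrt (2*π) : ℝ) : ℂ) := by
    rw [integral_complex_ofReal, integral_gaussian]
    congr 2
    rw [div_div_eq_mul_div]; ring
  rw [hgauss] at hmid
  have htail : Tendsto (fun n : ℕ => (σ n : ℂ) * (∫ θ in (-π)..π, HC (W n) l n θ) - ∫ u, g n u) atTop (𝓝 0) := by
    have t3 := hG.const_mul (2*π)
    rw [mul_zero] at t3
    refine squeeze_zero_norm' ?_ t3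
    filter_upwards [hW, s0, hσ0, hα, he] with n h0 h1 h5 h6 h7
    have hcont := HC_continuous (W n) h0 h1 l n
    have hi : ∀ a b, IntervalIntegrable (HC (W n) l n) volume a b := fun a b => hcont.intervalIntegrable a b
    have e1 : ∫ u, g n u = (σ n : ℂ) * ∫ θ in (-α n)..(α n), HC (W n) l n θ := by
      simp only [g]
      rw [integral_indicator measurableSet_Ioc, ← intervalIntegral.integral_of_le (by nlinarith)]
      rw [intervalIntegral.integral_comp_div _ h5.ne']
      rw [← Complex.real_smul]
      congr 2
      · field_simp
      · field_simp
    have e2 : ∫ θ in (-π)..π, HC (W n) l n θ = (∫ θ in (-π)..(-α n), HC (W n) l n θ) +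
        (∫ θ in (-α n)..(α n), HC (W n) l n θ) + (∫ θ in (α n)..π, HC (W n) l n θ) := by
      rw [intervalIntegral.integral_add_adjacent_intervals (hi _ _) (hi _ _),
        intervalIntegral.integral_add_adjacent_intervals (hi _ _) (hi _ _)]
    have b1 : ‖∫ θ in (-π)..(-α n), HC (W n) l n θ‖ ≤ Real.exp (-G n) * π := by
      have hh : ‖∫ θ in (-π)..(-α n), HC (W n) l n θ‖ ≤ Real.exp (-G n) * |(-α n) - (-π)| := by
        rw [intervalIntegral.integral_of_le (by linarith), integral_Ioc_eq_integral_Ioo, ← integral_Ioc_eq_integral_Ioo]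
        rw [← intervalIntegral.integral_of_le (by linarith)]
        apply intervalIntegral.norm_integral_le_of_norm_le_const_ae
        have hne : ∀ᵐ x : ℝ, x ≠ -α n := by
          simp [ae_iff, measure_singleton]
        filter_upwards [hne] with x hx hx2
        rw [Set.uIoc_of_le (by linarith)] at hx2
        rw [HC_norm _ h0 h1]
        apply Real.exp_le_exp.mpr
        have hlt : x < -α n := lt_of_le_of_ne hx2.2 hx
        have : |x| = -x := abs_of_neg (by linarith)
        have := h7 x (by rw [this]; linarith) (by rw [this]; linarith [hx2.1])
        linarith
      refine hh.trans ?_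
      gcongr
      rw [abs_le]; constructor <;> linarith
    have b2 : ‖∫ θ in (α n)..π, HC (W n) l n θ‖ ≤ Real.exp (-G n) * π := by
      have hh : ‖∫ θ in (α n)..π, HC (W n) l n θ‖ ≤ Real.exp (-G n) * |π - α n| := by
        apply intervalIntegral.norm_integral_le_of_norm_le_const
        intro x hx2
        rw [Set.uIoc_of_le (by linarith)] at hx2
        rw [HC_norm _ h0 h1]
        apply Real.exp_le_exp.mpr
        have : |x| = x := abs_of_pos (by linarith [hx2.1])
        have := h7 x (by rw [this]; linarith [hx2.1]) (by rw [this]; linarith [hx2.2])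
        linarith
      refine hh.trans ?_
      gcongr
      rw [abs_le]; constructor <;> linarith
    rw [e1, e2, ← mul_sub]
    rw [norm_mul, Complex.norm_real, Real.norm_of_nonneg h5.le]
    have : ‖(∫ θ in (-π)..(-α n), HC (W n) l n θ) +
        (∫ θ in (-α n)..(α n), HC (W n) l n θ) + (∫ θ in (α n)..π, HC (W n) l n θ) - (∫ θ in (-α n)..(α n), HC (W n) l n θ)‖
        ≤ Real.exp (-G n) * π + Real.exp (-G n) * π := by
      refine le_trans (le_of_eq ?_) ((norm_add_le _ _).trans (add_le_add b1 b2))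
      congr 1; ring
    have := mul_le_mul_of_nonneg_left this h5.le
    linarith
  have := (htail.add hmid).const_mul (((1 / (2 * π) : ℝ)) : ℂ)
  rw [zero_add, ← Complex.ofReal_mul] at this
  have e : 1 / (2 * π) * Real.sqrt (2*π) = 1 / Real.sqrt (2*π) := by
    have h : 0 < Real.sqrt (2*π) := Real.sqrt_pos.mpr (by positivity)
    have h2 : Real.sqrt (2*π) * Real.sqrt (2*π) = 2*π := Real.mul_self_sqrt (by positivity)
    rw [div_mul_eq_mul_div, one_mul, div_eq_div_iff (by positivity) h.ne']
    linarith
  rw [e] at this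
  refine this.congr fun n => ?_
  unfold qC
  ring

end PartF

section PartG


/-- lengths -/
def lK (i : ℕ × ℕ) : ℕ := (i.1 + 1) * (i.2 + 1)

/-- tilted weights -/
def WK (b : ℕ → ℝ) (α : ℝ) (i : ℕ × ℕ) : ℝ :=
  b (i.1 + 1) / ((i.2:ℝ) + 1) * Real.exp (-(α * (lK i : ℝ)))

lemma WK_nonneg (b : ℕ → ℝ) (hb : ∀ k, 0 ≤ b k) (α : ℝ) (i : ℕ × ℕ) : 0 ≤ WK b α i := by
  unfold WK
  have := hb (i.1+1)
  positivity

lemma hasSum_inner (r : ℝ) (hr0 : 0 ≤ r) (hr : r < 1) (k : ℕ) (c : ℝ) :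
    HasSum (fun j : ℕ => c / ((j:ℝ)+1) * r ^ (lK (k,j))) (c * (-Real.log (1 - r^(k+1)))) := by
  have h1 : |r^(k+1)| < 1 := by
    rw [abs_of_nonneg (by positivity)]
    exact pow_lt_one₀ hr0 hr (by omega)
  have := (Real.hasSum_pow_div_log_of_abs_lt_one h1).mul_left c
  refine this.congr_fun ?_
  intro j
  simp only [lK]
  rw [pow_mul]
  ring

lemma neg_log_bound (y : ℝ) (hy0 : 0 ≤ y) (hy : y < 1) :
    y ≤ -Real.log (1-y) ∧ -Real.log (1-y) ≤ y / (1-y) := by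
  have h1 : 0 < 1 - y := by linarith
  constructor
  · have := Real.log_le_sub_one_of_pos h1
    linarith
  · have := Real.one_sub_inv_le_log_of_pos h1
    have e : y / (1-y) = (1-y)⁻¹ - 1 := by field_simp; ring
    rw [e]; linarith

lemma pair_hasSum (b : ℕ → ℝ) (hb : ∀ k, 0 ≤ b k)
    (r : ℝ) (hr0 : 0 ≤ r) (hr : r < 1) (hs : Summable (fun k : ℕ => b (k+1) * r^(k+1))) :
    HasSum (fun i : ℕ × ℕ => b (i.1+1) / ((i.2:ℝ)+1) * r ^ (lK i)) (Fb b r) := by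
  have hnn : 0 ≤ (fun i : ℕ × ℕ => b (i.1+1) / ((i.2:ℝ)+1) * r ^ (lK i)) := by
    intro i
    have := hb (i.1+1)
    simp only [Pi.zero_apply]
    positivity
  have hin := fun k => hasSum_inner r hr0 hr k (b (k+1))
  have hsk : Summable (fun k : ℕ => b (k+1) * (-Real.log (1 - r^(k+1)))) := by
    refine Summable.of_nonneg_of_le (fun k => ?_) (fun k => ?_) (hs.mul_left (1/(1-r)))
    · have h1 : r^(k+1) < 1 := pow_lt_one₀ hr0 hr (by omega)
      have := (neg_log_bound (r^(k+1)) (by positivity) h1).1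
      have h2 : 0 ≤ r^(k+1) := by positivity
      exact mul_nonneg (hb _) (by linarith)
    · have h1 : r^(k+1) < 1 := pow_lt_one₀ hr0 hr (by omega)
      have h3 : r^(k+1) ≤ r := pow_le_of_le_one hr0 hr.le (by omega)
      have h4 := (neg_log_bound (r^(k+1)) (by positivity) h1).2
      have h5 : r^(k+1) / (1 - r^(k+1)) ≤ r^(k+1) / (1-r) := by
        apply div_le_div_of_nonneg_left (by positivity) (by linarith) (by linarith)
      calc b (k+1) * (-Real.log (1 - r^(k+1))) ≤ b (k+1) * (r^(k+1) / (1-r)) :=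
            mul_le_mul_of_nonneg_left (h4.trans h5) (hb _)
        _ = _ := by ring
  have hsum : Summable (fun i : ℕ × ℕ => b (i.1+1) / ((i.2:ℝ)+1) * r ^ (lK i)) := by
    rw [summable_prod_of_nonneg hnn]
    refine ⟨fun k => (hin k).summable, ?_⟩
    refine hsk.congr fun k => ?_
    exact (hin k).tsum_eq.symm
  have : Fb b r = ∑' i : ℕ × ℕ, b (i.1+1) / ((i.2:ℝ)+1) * r ^ (lK i) := by
    rw [hsum.tsum_prod]
    unfold Fb
    rw [← tsum_neg]
    congr 1; ext k
    rw [(hin k).tsum_eq]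
    ring
  rw [this]
  exact hsum.hasSum

/-- complex log generating function -/
def EC (b : ℕ → ℝ) (z : ℂ) : ℂ := ∑' i : ℕ × ℕ, ((b (i.1+1) / ((i.2:ℝ)+1) : ℝ) : ℂ) * z ^ (lK i)

lemma diffOn_unit_of_balls (f : ℂ → ℂ) (h : ∀ r, 0 < r → r < 1 → DifferentiableOn ℂ f (Metric.ball 0 r)) :
    DifferentiableOn ℂ f (Metric.ball 0 1) := by
  intro z hz
  rw [Metric.mem_ball, dist_zero_right] at hz
  have h1 : ‖z‖ < (1 + ‖z‖)/2 := by linarith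
  have h2 : (1 + ‖z‖)/2 < 1 := by linarith
  have h0 := norm_nonneg z
  have := h _ (by linarith) h2 z (by rw [Metric.mem_ball, dist_zero_right]; exact h1)
  exact (this.differentiableAt (Metric.isOpen_ball.mem_nhds (by rw [Metric.mem_ball, dist_zero_right]; exact h1))).differentiableWithinAt

lemma EC_diff (b : ℕ → ℝ) (hb : ∀ k, 0 ≤ b k)
    (hs : ∀ r : ℝ, 0 ≤ r → r < 1 → Summable (fun k : ℕ => b (k+1) * r^(k+1))) :
    DifferentiableOn ℂ (EC b) (Metric.ball 0 1) := by
  apply diffOn_unit_of_balls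
  intro r hr0 hr
  refine Complex.differentiableOn_tsum_of_summable_norm (pair_hasSum b hb r hr0.le hr (hs r hr0.le hr)).summable
    (fun i => by fun_prop) Metric.isOpen_ball ?_
  intro i w hw
  rw [Metric.mem_ball, dist_zero_right] at hw
  have := hb (i.1+1)
  rw [norm_mul, Complex.norm_real, norm_pow, Real.norm_of_nonneg (by positivity)]
  gcongr

lemma gen_eq (b : ℕ → ℝ) (hb : ∀ k, 0 ≤ b k)
    (hs : ∀ r : ℝ, 0 ≤ r → r < 1 → Summable (fun k : ℕ => b (k+1) * r^(k+1)))
    (p : ℕ → ℝ) (hp : ∀ x : ℝ, |x| < 1 → HasSum (fun n : ℕ => p n * x ^ n) (fb b x))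
    (z : ℂ) (hz : ‖z‖ < 1) :
    ∑' n : ℕ, (p n : ℂ) * z ^ n = Complex.exp (EC b z) := by
  have hP : DifferentiableOn ℂ (fun z : ℂ => ∑' n : ℕ, (p n : ℂ) * z ^ n) (Metric.ball 0 1) := by
    apply diffOn_unit_of_balls
    intro r hr0 hr
    have hsum := (hp r (by rw [abs_of_pos hr0]; exact hr)).summable.abs
    refine Complex.differentiableOn_tsum_of_summable_norm hsum
      (fun i => by fun_prop) Metric.isOpen_ball ?_
    intro i w hw
    rw [Metric.mem_ball, dist_zero_right] at hw
    rw [norm_mul, Complex.norm_real, norm_pow, abs_mul, abs_pow, abs_of_pos hr0, Real.norm_eq_abs]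
    gcongr
  have hE : DifferentiableOn ℂ (fun z => Complex.exp (EC b z)) (Metric.ball 0 1) :=
    (EC_diff b hb hs).cexp
  have a1 := hP.analyticOnNhd Metric.isOpen_ball
  have a2 := hE.analyticOnNhd Metric.isOpen_ball
  have hpre : IsPreconnected (Metric.ball (0:ℂ) 1) := (convex_ball _ _).isPreconnected
  refine a1.eqOn_of_preconnected_of_frequently_eq a2 hpre (z₀ := 0) (by simp) ?_
    (show z ∈ Metric.ball (0:ℂ) 1 by simpa using hz)
  have hreal : ∀ x : ℝ, 0 ≤ x → x < 1 → (∑' n : ℕ, (p n : ℂ) * (x:ℂ) ^ n) = Complex.exp (EC b x) := by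
    intro x hx0 hx1
    have c1 := Complex.hasSum_ofReal.mpr (hp x (by rw [abs_of_nonneg hx0]; exact hx1))
    have c2 := Complex.hasSum_ofReal.mpr (pair_hasSum b hb x hx0 hx1 (hs x hx0 hx1))
    push_cast at c1 c2
    rw [c1.tsum_eq]
    unfold EC
    push_cast
    rw [c2.tsum_eq]
    unfold fb
    push_cast
    rfl
  have hten : Tendsto (fun n : ℕ => ((1 / ((n:ℝ) + 2) : ℝ) : ℂ)) atTop (𝓝[≠] (0:ℂ)) := by
    rw [tendsto_nhdsWithin_iff]
    constructor
    · have h0 : Tendsto (fun n : ℕ => (1 / ((n:ℝ) + 2) : ℝ)) atTop (𝓝 0) := by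
        apply Tendsto.div_atTop tendsto_const_nhds
        exact tendsto_atTop_add_const_right _ _ tendsto_natCast_atTop_atTop
      have := (Complex.continuous_ofReal.tendsto 0).comp h0
      rw [Complex.ofReal_zero] at this
      exact this
    · refine Eventually.of_forall fun n => ?_
      simp only [Set.mem_compl_iff, Set.mem_singleton_iff, Complex.ofReal_eq_zero]
      positivity
  refine hten.frequently (Eventually.frequently (Eventually.of_forall fun n => ?_))
  apply hreal
  · positivity
  · rw [div_lt_one (by positivity)]
    have : (0:ℝ) ≤ n := by positivity
    linarith

lemma integral_char (j n : ℕ) :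
    ∫ θ in (-π)..π, Complex.exp (Complex.I * ((j * θ : ℝ):ℂ)) * Complex.exp (-(Complex.I * ((n * θ : ℝ):ℂ))) =
      if j = n then ((2 * π : ℝ) : ℂ) else 0 := by
  have e : ∀ θ : ℝ, Complex.exp (Complex.I * ((j * θ : ℝ):ℂ)) * Complex.exp (-(Complex.I * ((n * θ : ℝ):ℂ))) =
      Complex.exp ((Complex.I * ((j:ℂ) - n)) * θ) := by
    intro θ; rw [← Complex.exp_add]; congr 1; push_cast; ring
  simp_rw [e]
  split_ifs with h
  · subst h
    simp
    ring
  · have hne : Complex.I * ((j:ℂ) - n) ≠ 0 := by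
      refine mul_ne_zero Complex.I_ne_zero (sub_ne_zero.mpr ?_)
      exact_mod_cast h
    rw [integral_exp_mul_complex hne]
    have : Complex.exp (Complex.I * ((j:ℂ) - n) * (π:ℝ)) = Complex.exp (Complex.I * ((j:ℂ) - n) * ((-π:ℝ):ℂ)) := by
      rw [Complex.exp_eq_exp_iff_exists_int]
      refine ⟨(j:ℤ) - n, ?_⟩
      push_cast; ring
    rw [this, sub_self, zero_div]

theorem coeff_eq (b : ℕ → ℝ) (hb : ∀ k, 0 ≤ b k)
    (hs : ∀ r : ℝ, 0 ≤ r → r < 1 → Summable (fun k : ℕ => b (k+1) * r^(k+1)))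
    (p : ℕ → ℝ) (hp : ∀ x : ℝ, |x| < 1 → HasSum (fun n : ℕ => p n * x ^ n) (fb b x))
    (α : ℝ) (hα : 0 < α) (n : ℕ) :
    ((p n * Real.exp (-(α * n)) : ℝ) : ℂ) =
      ((Real.exp (Fb b (Real.exp (-α))) : ℝ) : ℂ) * qC (WK b α) lK n := by
  set r := Real.exp (-α) with hr
  have hr0 : 0 < r := Real.exp_pos _
  have hr1 : r < 1 := by rw [hr]; exact (Real.exp_lt_exp.mpr (by linarith : -α < 0)).trans_eq Real.exp_zero
  have hrpow : ∀ k : ℕ, r ^ k = Real.exp (-(α * k)) := by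
    intro k; rw [hr, ← Real.exp_nat_mul]; congr 1; ring
  have hWs : HasSum (WK b α) (Fb b r) := by
    have := pair_hasSum b hb r hr0.le hr1 (hs r hr0.le hr1)
    simp_rw [hrpow] at this
    exact this
  have hH : ∀ θ : ℝ, ((Real.exp (Fb b r) : ℝ) : ℂ) * HC (WK b α) lK n θ =
      ∑' k : ℕ, ((p k * r^k : ℝ) : ℂ) * (Complex.exp (Complex.I * ((k * θ : ℝ):ℂ)) * Complex.exp (-(Complex.I * ((n * θ : ℝ):ℂ)))) := by
    intro θ
    set z : ℂ := r * Complex.exp (Complex.I * θ) with hz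
    have hpow : ∀ k : ℕ, z ^ k = ((r^k : ℝ):ℂ) * Complex.exp (Complex.I * ((k * θ : ℝ):ℂ)) := by
      intro k
      rw [hz, mul_pow, ← Complex.exp_nat_mul]
      push_cast
      congr 2; ring
    have hzn : ‖z‖ < 1 := by
      rw [hz, norm_mul, Complex.norm_real, mul_comm Complex.I, Complex.norm_exp_ofReal_mul_I, mul_one,
        Real.norm_of_nonneg hr0.le]
      exact hr1
    have hg := gen_eq b hb hs p hp z hzn
    have hE : EC b z = (Fb b r : ℂ) + PhiC (WK b α) lK θ := by
      have c1 := Complex.hasSum_ofReal.mpr hWs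
      have c2 := (PhiC_summable (WK b α) (WK_nonneg b hb α) hWs.summable lK θ).hasSum
      have c3 := c1.add c2
      have c4 : PhiC (WK b α) lK θ = ∑' i, (WK b α i : ℂ) * (Complex.exp (Complex.I * ((lK i * θ : ℝ) : ℂ)) - 1) := rfl
      rw [c4, ← c3.tsum_eq]
      unfold EC
      congr 1; ext i
      rw [hpow, hrpow]
      unfold WK
      push_cast
      ring
    unfold HC
    rw [← mul_assoc, Complex.ofReal_exp, ← Complex.exp_add, ← hE, ← hg, ← tsum_mul_right]
    congr 1; ext k
    rw [hpow]; push_cast; ring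
  have hsum := (hp r (by rw [abs_of_pos hr0]; exact hr1)).summable.abs
  have hIntg : HasSum (fun k : ℕ => ∫ θ in (-π)..π, ((p k * r^k : ℝ) : ℂ) * (Complex.exp (Complex.I * ((k * θ : ℝ):ℂ)) * Complex.exp (-(Complex.I * ((n * θ : ℝ):ℂ)))))
      (∫ θ in (-π)..π, ∑' k : ℕ, ((p k * r^k : ℝ) : ℂ) * (Complex.exp (Complex.I * ((k * θ : ℝ):ℂ)) * Complex.exp (-(Complex.I * ((n * θ : ℝ):ℂ))))) := by
    have hbd : ∀ (k:ℕ) (θ:ℝ), ‖((p k * r^k : ℝ) : ℂ) * (Complex.exp (Complex.I * ((k * θ : ℝ):ℂ)) * Complex.exp (-(Complex.I * ((n * θ : ℝ):ℂ))))‖ ≤ |p k * r^k| := by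
      intro k θ
      rw [norm_mul, norm_mul, Complex.norm_real, mul_comm Complex.I, Complex.norm_exp_ofReal_mul_I,
        show -(Complex.I * ((n * θ : ℝ) : ℂ)) = ((-(n*θ) : ℝ) : ℂ) * Complex.I by push_cast; ring,
        Complex.norm_exp_ofReal_mul_I]
      simp
    apply intervalIntegral.hasSum_integral_of_dominated_convergence (fun k _ => |p k * r^k|)
    · intro k
      apply Continuous.aestronglyMeasurable
      fun_prop
    · intro k
      exact Eventually.of_forall fun θ _ => hbd k θ
    · exact Eventually.of_forall fun θ _ => hsum
    · exact intervalIntegrable_const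
    · refine Eventually.of_forall fun θ _ => ?_
      exact (Summable.of_norm_bounded hsum (fun k => hbd k θ)).hasSum
  simp_rw [intervalIntegral.integral_const_mul, integral_char] at hIntg
  have hone : HasSum (fun k : ℕ => ((p k * r^k : ℝ) : ℂ) * (if k = n then ((2 * π : ℝ) : ℂ) else 0))
      (((p n * r^n : ℝ) : ℂ) * ((2 * π : ℝ) : ℂ)) := by
    convert hasSum_ite_eq n (((p n * r^n : ℝ) : ℂ) * ((2 * π : ℝ) : ℂ)) using 2 with k
    split_ifs with h
    · rw [h]
    · rw [mul_zero]
  have heq := hone.unique hIntg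
  rw [← hrpow]
  unfold qC
  rw [mul_left_comm, ← intervalIntegral.integral_const_mul]
  simp_rw [hH]
  rw [← heq]
  push_cast
  have : (π:ℂ) ≠ 0 := by exact_mod_cast Real.pi_ne_zero
  field_simp

/-- truncated weights -/
def bT (b : ℕ → ℝ) (m : ℕ) (k : ℕ) : ℝ := if k ≤ m then b k else 0

lemma bT_nonneg (b : ℕ → ℝ) (hb : ∀ k, 0 ≤ b k) (m k : ℕ) : 0 ≤ bT b m k := by
  unfold bT; split_ifs
  · exact hb k
  · exact le_refl _

lemma bT_le (b : ℕ → ℝ) (hb : ∀ k, 0 ≤ b k) (m k : ℕ) : bT b m k ≤ b k := by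
  unfold bT; split_ifs
  · exact le_refl _
  · exact hb k

lemma Fb_bT (b : ℕ → ℝ) (m : ℕ) (x : ℝ) : Fb (bT b m) x = Fmb b m x := by
  unfold Fb Fmb
  rw [tsum_eq_sum (s := Finset.range m)]
  · rw [Finset.range_eq_Ico, Finset.sum_Ico_add' (fun k => bT b m k * Real.log (1 - x^k)) 0 m 1]
    congr 1
    refine Finset.sum_congr ?_ ?_
    · ext k; simp [Nat.lt_iff_add_one_le]
    · intro k hk
      rw [Finset.mem_Icc] at hk
      unfold bT
      rw [if_pos hk.2]
  · intro k hk
    rw [Finset.mem_range] at hk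
    unfold bT
    rw [if_neg (by omega), zero_mul]

end PartG

section PartH


lemma pow_exp_bound (p : ℕ) (y : ℝ) (hy : 0 ≤ y) : y ^ p * Real.exp (-y) ≤ p.factorial := by
  have := Real.pow_div_factorial_le_exp y hy p
  rw [div_le_iff₀ (by positivity)] at this
  rw [Real.exp_neg]
  have h := Real.exp_pos y
  rw [← div_eq_mul_inv, div_le_iff₀ h]
  linarith

lemma rpow_exp_bound (r : ℝ) : ∃ C : ℝ, 0 < C ∧ ∀ β : ℝ, 0 < β → ∀ x : ℝ, 1 ≤ x →
    Real.exp (-(β * x)) ≤ C * max 1 (β⁻¹ ^ ⌈r⌉₊) * x ^ (-r) := by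
  refine ⟨(⌈r⌉₊.factorial : ℝ), by positivity, ?_⟩
  intro β hβ x hx
  have h1 := pow_exp_bound ⌈r⌉₊ (β * x) (by positivity)
  have h2 : x ^ r ≤ x ^ ⌈r⌉₊ := by
    rw [← Real.rpow_natCast]
    exact Real.rpow_le_rpow_of_exponent_le hx (Nat.le_ceil r)
  have hx0 : 0 < x := by linarith
  rw [Real.rpow_neg hx0.le, ← div_eq_mul_inv, le_div_iff₀ (by positivity)]
  calc Real.exp (-(β * x)) * x ^ r ≤ Real.exp (-(β * x)) * x ^ ⌈r⌉₊ := by gcongr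
    _ = β⁻¹ ^ ⌈r⌉₊ * ((β * x) ^ ⌈r⌉₊ * Real.exp (-(β * x))) := by
        rw [mul_pow, inv_pow]; field_simp
    _ ≤ β⁻¹ ^ ⌈r⌉₊ * ⌈r⌉₊.factorial := by gcongr
    _ ≤ _ := by
        rw [mul_comm]; gcongr; exact le_max_right _ _

lemma summ_exp (b : ℕ → ℝ) (hb : ∀ k, 0 ≤ b k) (r : ℝ)
    (h : Summable (fun k : ℕ => b (k+1) * ((k:ℝ)+1)^(-r))) (β : ℝ) (hβ : 0 < β) :
    Summable (fun k : ℕ => b (k+1) * Real.exp (-(β * ((k:ℝ)+1)))) := by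
  obtain ⟨C, hC, hCb⟩ := rpow_exp_bound r
  refine Summable.of_nonneg_of_le (fun k => mul_nonneg (hb _) (Real.exp_pos _).le) (fun k => ?_)
    (h.mul_left (C * max 1 (β⁻¹ ^ ⌈r⌉₊)))
  have := mul_le_mul_of_nonneg_left (hCb β hβ ((k:ℝ)+1) (by linarith [Nat.cast_nonneg (α := ℝ) k])) (hb (k+1))
  linarith

/-- exponential summability -/
def SE (b : ℕ → ℝ) : Prop :=
  ∀ β : ℝ, 0 < β → Summable (fun k : ℕ => b (k+1) * Real.exp (-(β * ((k:ℝ)+1))))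

lemma SE.pow {b : ℕ → ℝ} (h : SE b) (r : ℝ) (hr0 : 0 ≤ r) (hr : r < 1) :
    Summable (fun k : ℕ => b (k+1) * r^(k+1)) := by
  rcases hr0.eq_or_lt with h0 | h0
  · subst h0; simp [summable_zero]
  · have hl : 0 < -Real.log r := by have := Real.log_neg h0 hr; linarith
    refine (h _ hl).congr fun k => ?_
    congr 1
    rw [← Real.exp_log (show 0 < r^(k+1) by positivity), Real.log_pow]
    congr 1; push_cast; ring

lemma SE.mono {b b' : ℕ → ℝ} (h : SE b) (h0 : ∀ k, 0 ≤ b' k) (hle : ∀ k, b' k ≤ b k) : SE b' := by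
  intro β hβ
  refine Summable.of_nonneg_of_le (fun k => mul_nonneg (h0 _) (Real.exp_pos _).le) (fun k => ?_) (h β hβ)
  exact mul_le_mul_of_nonneg_right (hle _) (Real.exp_pos _).le

lemma exp_neg_pow (α : ℝ) (k : ℕ) : Real.exp (-α) ^ k = Real.exp (-(α * k)) := by
  rw [← Real.exp_nat_mul]; congr 1; ring

lemma WK_hasSum {b : ℕ → ℝ} (hb : ∀ k, 0 ≤ b k) (h : SE b) (α : ℝ) (hα : 0 < α) :
    HasSum (WK b α) (Fb b (Real.exp (-α))) := by
  have hr1 : Real.exp (-α) < 1 := (Real.exp_lt_exp.mpr (by linarith : -α < 0)).trans_eq Real.exp_zero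
  have := pair_hasSum b hb _ (Real.exp_pos (-α)).le hr1 (h.pow _ (Real.exp_pos (-α)).le hr1)
  simp_rw [exp_neg_pow] at this
  exact this

lemma WK_moment_le {b : ℕ → ℝ} (hb : ∀ k, 0 ≤ b k) (α : ℝ) (hα : 0 < α) (p : ℕ) (i : ℕ × ℕ) :
    WK b α i * (lK i : ℝ)^p ≤ 2^p * p.factorial / α^p * WK b (α/2) i := by
  have h1 := pow_exp_bound p (α/2 * lK i) (by positivity)
  have h2 : Real.exp (-(α * lK i)) = Real.exp (-(α/2 * lK i)) * Real.exp (-(α/2 * lK i)) := by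
    rw [← Real.exp_add]; congr 1; ring
  have h3 : WK b α i * (lK i : ℝ)^p = (2^p/α^p) * ((α/2 * lK i)^p * Real.exp (-(α/2 * lK i))) * WK b (α/2) i := by
    unfold WK
    rw [h2, mul_pow, div_pow]; field_simp
  rw [h3]
  have h4 := WK_nonneg b hb (α/2) i
  calc _ ≤ (2^p/α^p) * p.factorial * WK b (α/2) i := by gcongr
    _ = _ := by ring

lemma WK_moment_summable {b : ℕ → ℝ} (hb : ∀ k, 0 ≤ b k) (h : SE b) (α : ℝ) (hα : 0 < α) (p : ℕ) :
    Summable (fun i => WK b α i * (lK i : ℝ)^p) := by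
  refine Summable.of_nonneg_of_le (fun i => mul_nonneg (WK_nonneg b hb _ _) (by positivity))
    (WK_moment_le hb α hα p) ((WK_hasSum hb h (α/2) (by linarith)).summable.mul_left _)

lemma WK_moment_tsum {b : ℕ → ℝ} (hb : ∀ k, 0 ≤ b k) (h : SE b) (α : ℝ) (hα : 0 < α) (p : ℕ) :
    ∑' i, WK b α i * (lK i : ℝ)^p ≤ 2^p * p.factorial / α^p * Fb b (Real.exp (-(α/2))) := by
  rw [← (WK_hasSum hb h (α/2) (by linarith)).tsum_eq, ← tsum_mul_left]
  exact (WK_moment_summable hb h α hα p).tsum_le_tsum (WK_moment_le hb α hα p)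
    ((WK_hasSum hb h (α/2) (by linarith)).summable.mul_left _)

/-- Swap of summation order. -/
lemma swap_sum (f : ℕ × ℕ → ℝ) (hf : Summable f) :
    Summable (fun j => ∑' k, f (k,j)) ∧ ∑' i, f i = ∑' j, ∑' k, f (k,j) := by
  have hf2 : Summable (fun i : ℕ × ℕ => f i.swap) := (Equiv.prodComm ℕ ℕ).summable_iff.mpr hf
  constructor
  · exact hf2.prod
  · have := hf2.tsum_prod
    simp only [Prod.swap_prod_mk] at this
    rw [← this]
    exact ((Equiv.prodComm ℕ ℕ).tsum_eq f).symm

lemma summable_jpow (q : ℝ) (hq : 1 < q) : Summable (fun j : ℕ => ((j:ℝ)+1)^(-q)) := by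
  have := (summable_nat_add_iff 1).mpr (Real.summable_nat_rpow.mpr (show -q < -1 by linarith))
  refine this.congr fun j => ?_
  push_cast; rfl

lemma zeta_re (q : ℝ) (hq : 1 < q) : (riemannZeta (q:ℂ)).re = ∑' j : ℕ, ((j:ℝ)+1)^(-q) := by
  rw [zeta_eq_tsum_one_div_nat_add_one_cpow (by simpa using hq)]
  have : ∀ j : ℕ, 1 / ((j:ℂ)+1)^(q:ℂ) = ((((j:ℝ)+1)^(-q) : ℝ) : ℂ) := by
    intro j
    rw [Complex.ofReal_cpow (by positivity)]
    push_cast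
    rw [Complex.cpow_neg, one_div]
  simp_rw [this]
  rw [← Complex.ofReal_tsum, Complex.ofReal_re]

/-- F upper bound -/
lemma F_bound {b : ℕ → ℝ} (hb : ∀ k, 0 ≤ b k) (h : SE b) (ρ δ A K : ℝ) (hδ : 0 < δ) (hδρ : δ < ρ) (hA : 0 < A)
    (hK : 0 ≤ K) (hN : ∀ x, 0 < x → |NS (fun k => b (k+1)) x - A/ρ * x^ρ| ≤ K * x^(ρ-δ)) :
    ∃ C, 0 < C ∧ ∀ α, 0 < α → α ≤ 1 → Fb b (Real.exp (-α)) ≤ C * α^(-ρ) := by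
  have hρ : 0 < ρ := hδ.trans hδρ
  set c1 := A/ρ * Real.Gamma (ρ+1) with hc1
  set c2 := K * Real.Gamma (ρ-δ+1) with hc2
  have hc1p : 0 < c1 := mul_pos (by positivity) (Real.Gamma_pos_of_pos (by linarith))
  have hc2p : 0 ≤ c2 := mul_nonneg hK (Real.Gamma_pos_of_pos (by linarith)).le
  have z1 := summable_jpow (ρ+1) (by linarith)
  have z2 := summable_jpow (ρ-δ+1) (by linarith)
  have z1p : 0 < ∑' j : ℕ, ((j:ℝ)+1)^(-(ρ+1)) := z1.tsum_pos (fun j => by positivity) 0 (by positivity)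
  have z2p : 0 ≤ ∑' j : ℕ, ((j:ℝ)+1)^(-(ρ-δ+1)) := tsum_nonneg (fun j => by positivity)
  refine ⟨c1 * ∑' j : ℕ, ((j:ℝ)+1)^(-(ρ+1)) + c2 * ∑' j : ℕ, ((j:ℝ)+1)^(-(ρ-δ+1)), by positivity, ?_⟩
  intro α hα hα1
  have hs := (WK_hasSum hb h α hα)
  obtain ⟨q1, q2⟩ := swap_sum _ hs.summable
  rw [← hs.tsum_eq, q2]
  have hle : ∀ j : ℕ, ∑' k, WK b α (k,j) ≤ c1 * α^(-ρ) * ((j:ℝ)+1)^(-(ρ+1)) + c2 * α^(-(ρ-δ)) * ((j:ℝ)+1)^(-(ρ-δ+1)) := by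
    intro j
    have hj : (0:ℝ) < (j:ℝ)+1 := by positivity
    have e : ∑' k, WK b α (k,j) = ((j:ℝ)+1)⁻¹ * ∑' k : ℕ, b (k+1) * Real.exp (-((α * ((j:ℝ)+1)) * ((k:ℝ)+1))) := by
      rw [← tsum_mul_left]
      congr 1; ext k
      unfold WK lK
      push_cast
      rw [show -(α * (((k:ℝ)+1) * ((j:ℝ)+1))) = -((α * ((j:ℝ)+1)) * ((k:ℝ)+1)) by ring]
      field_simp
    have := abel_asymp (fun k => b (k+1)) (fun k => hb _) (A/ρ) ρ δ K (by linarith) hδ hN (α * ((j:ℝ)+1)) (by positivity)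
      (h _ (by positivity))
    rw [abs_le] at this
    rw [e]
    have h2 : ∑' k : ℕ, b (k+1) * Real.exp (-((α * ((j:ℝ)+1)) * ((k:ℝ)+1))) ≤
        c1 * (α * ((j:ℝ)+1))^(-ρ) + c2 * (α * ((j:ℝ)+1))^(-(ρ-δ)) := by linarith [this.2]
    refine (mul_le_mul_of_nonneg_left h2 (by positivity)).trans (le_of_eq ?_)
    rw [Real.mul_rpow hα.le hj.le, Real.mul_rpow hα.le hj.le, neg_add, neg_add, Real.rpow_add hj, Real.rpow_add hj,
      Real.rpow_neg_one]
    ring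
  refine (q1.tsum_le_tsum hle ((z1.mul_left _).add (z2.mul_left _))).trans ?_
  rw [(z1.mul_left _).tsum_add (z2.mul_left _), tsum_mul_left, tsum_mul_left]
  have : α^(-(ρ-δ)) ≤ α^(-ρ) := Real.rpow_le_rpow_of_exponent_ge hα hα1 (by linarith)
  have := mul_le_mul_of_nonneg_left this (mul_nonneg hc2p z2p)
  nlinarith

/-- mean asymptotics -/
lemma M_asymp {b : ℕ → ℝ} (hb : ∀ k, 0 ≤ b k) (h : SE b) (ρ δ A K : ℝ) (hδ : 0 < δ) (hδρ : δ < ρ)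
    (hK : 0 ≤ K) (hN : ∀ x, 0 < x → |NS (fun k => b (k+1) * ((k:ℝ)+1)) x - A/(ρ+1) * x^(ρ+1)| ≤ K * x^(ρ+1-δ)) :
    ∃ C, 0 ≤ C ∧ ∀ α, 0 < α → |(∑' i, WK b α i * (lK i : ℝ)) - hMein ρ A * α^(-(ρ+1))| ≤ C * α^(-(ρ+1-δ)) := by
  have hρ : 0 < ρ := hδ.trans hδρ
  set c2 := K * Real.Gamma (ρ+1-δ+1) with hc2
  have hc2p : 0 ≤ c2 := mul_nonneg hK (Real.Gamma_pos_of_pos (by linarith)).le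
  have z1 := summable_jpow (ρ+1) (by linarith)
  have z2 := summable_jpow (ρ+1-δ) (by linarith)
  have z2p : 0 ≤ ∑' j : ℕ, ((j:ℝ)+1)^(-(ρ+1-δ)) := tsum_nonneg (fun j => by positivity)
  refine ⟨c2 * ∑' j : ℕ, ((j:ℝ)+1)^(-(ρ+1-δ)), by positivity, ?_⟩
  intro α hα
  have hs := WK_moment_summable hb h α hα 1
  simp_rw [pow_one] at hs
  obtain ⟨q1, q2⟩ := swap_sum _ hs
  have hH : hMein ρ A * α^(-(ρ+1)) = ∑' j : ℕ, (A/(ρ+1) * Real.Gamma (ρ+1+1) * α^(-(ρ+1))) * ((j:ℝ)+1)^(-(ρ+1)) := by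
    rw [tsum_mul_left, ← zeta_re _ (by linarith), Real.Gamma_add_one (s := ρ+1) (by positivity)]
    unfold hMein
    push_cast
    field_simp
  rw [q2, hH, ← q1.tsum_sub (z1.mul_left _)]
  have hle : ∀ j : ℕ, ‖∑' k, WK b α (k,j) * (lK (k,j) : ℝ) - (A/(ρ+1) * Real.Gamma (ρ+1+1) * α^(-(ρ+1))) * ((j:ℝ)+1)^(-(ρ+1))‖
      ≤ c2 * α^(-(ρ+1-δ)) * ((j:ℝ)+1)^(-(ρ+1-δ)) := by
    intro j
    have hj : (0:ℝ) < (j:ℝ)+1 := by positivity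
    have e : ∑' k, WK b α (k,j) * (lK (k,j) : ℝ) = ∑' k : ℕ, b (k+1) * ((k:ℝ)+1) * Real.exp (-((α * ((j:ℝ)+1)) * ((k:ℝ)+1))) := by
      congr 1; ext k
      unfold WK lK
      push_cast
      rw [show -(α * (((k:ℝ)+1) * ((j:ℝ)+1))) = -((α * ((j:ℝ)+1)) * ((k:ℝ)+1)) by ring]
      field_simp
    have hsj : Summable (fun k : ℕ => b (k+1) * ((k:ℝ)+1) * Real.exp (-((α * ((j:ℝ)+1)) * ((k:ℝ)+1)))) := by
      have := hs.comp_injective (i := fun k : ℕ => (k,j)) (fun a b hab => by simpa using hab)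
      refine this.congr fun k => ?_
      simp only [Function.comp]
      unfold WK lK
      push_cast
      rw [show -(α * (((k:ℝ)+1) * ((j:ℝ)+1))) = -((α * ((j:ℝ)+1)) * ((k:ℝ)+1)) by ring]
      field_simp
    have := abel_asymp (fun k => b (k+1) * ((k:ℝ)+1)) (fun k => mul_nonneg (hb _) (by positivity)) (A/(ρ+1)) (ρ+1) δ K (by linarith) hδ hN
      (α * ((j:ℝ)+1)) (by positivity) hsj
    rw [Real.mul_rpow hα.le hj.le, Real.mul_rpow hα.le hj.le, ← mul_assoc, ← mul_assoc] at this
    rw [e, Real.norm_eq_abs]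
    exact this
  have hsum := z2.mul_left (c2 * α^(-(ρ+1-δ)))
  have := tsum_of_norm_bounded hsum.hasSum hle
  rw [Real.norm_eq_abs, tsum_mul_left] at this
  linarith

end PartH

section PartI


lemma hMein_pos (ρ A : ℝ) (hρ : 0 < ρ) (hA : 0 < A) : 0 < hMein ρ A := by
  unfold hMein
  have h1 := Real.Gamma_pos_of_pos (show 0 < ρ+1 by linarith)
  have h2 := zeta_re (ρ+1) (by linarith)
  push_cast at h2
  rw [h2]
  have z1p : 0 < ∑' j : ℕ, ((j:ℝ)+1)^(-(ρ+1)) :=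
    (summable_jpow (ρ+1) (by linarith)).tsum_pos (fun j => by positivity) 0 (by positivity)
  positivity

lemma M_continuous {b : ℕ → ℝ} (hb : ∀ k, 0 ≤ b k) (h : SE b) :
    ContinuousOn (fun α => ∑' i, WK b α i * (lK i : ℝ)) (Set.Ioi 0) := by
  intro x hx
  have hx0 : (0:ℝ) < x := hx
  have hs := WK_moment_summable hb h (x/2) (by linarith) 1
  simp_rw [pow_one] at hs
  have hc : ContinuousOn (fun α => ∑' i, WK b α i * (lK i : ℝ)) (Set.Ioi (x/2)) := by
    apply continuousOn_tsum _ hs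
    · intro i α hα
      have hα' : x/2 < α := hα
      have := WK_nonneg b hb α i
      rw [Real.norm_of_nonneg (by positivity)]
      unfold WK
      have := hb (i.1+1)
      gcongr
    · intro i
      unfold WK
      fun_prop
  exact (hc.continuousAt (Ioi_mem_nhds (by linarith))).continuousWithinAt

lemma saddle {b : ℕ → ℝ} (hb : ∀ k, 0 ≤ b k) (h : SE b) (ρ δ A C : ℝ) (hδ : 0 < δ) (hδρ : δ < ρ)
    (hA : 0 < A) (hC : 0 ≤ C)
    (hM : ∀ α, 0 < α → |(∑' i, WK b α i * (lK i : ℝ)) - hMein ρ A * α^(-(ρ+1))| ≤ C * α^(-(ρ+1-δ))) :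
    ∃ α : ℕ → ℝ, (∀ n, 0 < α n) ∧ (∀ᶠ n : ℕ in atTop, ∑' i, WK b (α n) i * (lK i : ℝ) = n) ∧
      Tendsto α atTop (𝓝 0) ∧ (∀ᶠ n : ℕ in atTop, |n * α n ^ (ρ+1) - hMein ρ A| ≤ C * α n ^ δ) := by
  have hh := hMein_pos ρ A (hδ.trans hδρ) hA
  set H := hMein ρ A with hH
  set M : ℝ → ℝ := fun α => ∑' i, WK b α i * (lK i : ℝ) with hMdef
  have key : ∀ α, 0 < α → |M α * α^(ρ+1) - H| ≤ C * α^δ := by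
    intro α hα
    have h1 := hM α hα
    have h2 := mul_le_mul_of_nonneg_right h1 (show 0 ≤ α^(ρ+1) by positivity)
    rw [← abs_of_pos (show 0 < α^(ρ+1) by positivity), ← abs_mul, abs_of_pos (show 0 < α^(ρ+1) by positivity)] at h2
    have e1 : (M α - H * α^(-(ρ+1))) * α^(ρ+1) = M α * α^(ρ+1) - H := by
      rw [sub_mul, mul_assoc, ← Real.rpow_add hα]; simp
    have e2 : C * α^(-(ρ+1-δ)) * α^(ρ+1) = C * α^δ := by
      rw [mul_assoc, ← Real.rpow_add hα]; congr 2; ring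
    rw [e1, e2] at h2
    exact h2
  have hinf : Tendsto M atTop (𝓝 0) := by
    have t1 : Tendsto (fun α : ℝ => H * α^(-(ρ+1)) + C * α^(-(ρ+1-δ))) atTop (𝓝 (H * 0 + C * 0)) :=
      ((tendsto_rpow_neg_atTop (by linarith)).const_mul H).add ((tendsto_rpow_neg_atTop (by linarith)).const_mul C)
    simp only [mul_zero, add_zero] at t1
    refine squeeze_zero' (Eventually.of_forall fun α => ?_) ?_ t1
    · exact tsum_nonneg fun i => mul_nonneg (WK_nonneg b hb _ _) (by positivity)
    · filter_upwards [eventually_gt_atTop 0] with α hα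
      have := (abs_le.mp (hM α hα)).2
      linarith
  have hzero : Tendsto M (𝓝[>] 0) atTop := by
    have t1 : Tendsto (fun α : ℝ => (H/2) * α^(-(ρ+1))) (𝓝[>] 0) atTop := by
      apply Tendsto.const_mul_atTop (by positivity)
      have := (tendsto_rpow_atTop (show 0 < ρ+1 by linarith)).comp (tendsto_inv_nhdsGT_zero (𝕜 := ℝ))
      refine this.congr' ?_
      filter_upwards [self_mem_nhdsWithin] with α hα
      have hα' : (0:ℝ) < α := hα
      simp only [Function.comp]
      rw [Real.inv_rpow hα'.le, Real.rpow_neg hα'.le]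
    refine tendsto_atTop_mono' _ ?_ t1
    have t2 : Tendsto (fun α : ℝ => C * α^δ) (𝓝[>] 0) (𝓝 0) := by
      have : Tendsto (fun α : ℝ => C * α^δ) (𝓝 0) (𝓝 (C * 0^δ)) :=
        ((Real.continuousAt_rpow_const 0 δ (Or.inr hδ.le)).tendsto).const_mul C
      rw [Real.zero_rpow hδ.ne', mul_zero] at this
      exact this.mono_left nhdsWithin_le_nhds
    filter_upwards [self_mem_nhdsWithin, t2.eventually_lt_const (show 0 < H/2 by positivity)] with α hα h2
    have hα' : (0:ℝ) < α := hα
    have := (abs_le.mp (key α hα')).1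
    have h3 : H/2 ≤ M α * α^(ρ+1) := by linarith
    rw [Real.rpow_neg hα'.le, ← div_eq_mul_inv, div_le_iff₀ (by positivity)]
    exact h3
  have hex : ∀ n : ℕ, ∃ α : ℝ, 0 < α ∧ (1 ≤ n → M α = n) := by
    intro n
    rcases Nat.lt_or_ge n 1 with hn | hn
    · exact ⟨1, one_pos, fun h => by omega⟩
    · have := isPreconnected_Ioi.intermediate_value_Ioi (l₁ := atTop) (l₂ := 𝓝[>] (0:ℝ)) (le_principal_iff.mpr (Ioi_mem_atTop 0))
        (le_principal_iff.mpr self_mem_nhdsWithin) (M_continuous hb h) hinf hzero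
      obtain ⟨α, hα, hv⟩ := this (show (n:ℝ) ∈ Set.Ioi 0 by simp; omega)
      exact ⟨α, hα, fun _ => hv⟩
  choose α hα0 hαn using hex
  have hMn : ∀ᶠ n : ℕ in atTop, M (α n) = n := by
    filter_upwards [eventually_ge_atTop 1] with n hn using hαn n hn
  refine ⟨α, hα0, hMn, ?_, ?_⟩
  · rw [Metric.tendsto_atTop']
    intro ε hε
    have hB : ∀ᶠ n : ℕ in atTop, H * ε^(-(ρ+1)) + C * ε^(-(ρ+1-δ)) < n :=
      tendsto_natCast_atTop_atTop.eventually_gt_atTop _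
    obtain ⟨N, hN⟩ := eventually_atTop.mp (hB.and hMn)
    refine ⟨N, fun n hn => ?_⟩
    obtain ⟨h1, h2⟩ := hN n hn.le
    rw [Real.dist_eq, sub_zero, abs_of_pos (hα0 n)]
    by_contra hcon
    push Not at hcon
    have h3 := (abs_le.mp (hM (α n) (hα0 n))).2
    have h4 : α n ^(-(ρ+1)) ≤ ε^(-(ρ+1)) := Real.rpow_le_rpow_of_nonpos hε hcon (by linarith)
    have h5 : α n ^(-(ρ+1-δ)) ≤ ε^(-(ρ+1-δ)) := Real.rpow_le_rpow_of_nonpos hε hcon (by linarith)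
    have h6 := mul_le_mul_of_nonneg_left h4 hh.le
    have h7 := mul_le_mul_of_nonneg_left h5 hC
    have h8 : ∑' i, WK b (α n) i * (lK i : ℝ) = n := h2
    linarith
  · filter_upwards [hMn] with n hn
    have := key (α n) (hα0 n)
    rw [hn] at this
    exact this

end PartI

section PartJ


lemma rpow_sub_one_le (ρ y : ℝ) (hρ : 0 < ρ) (hy : 0 ≤ y) : (1+y)^ρ - 1 ≤ ρ * y * (1+y)^ρ := by
  have h1 : 0 < 1 + y := by linarith
  have h2 : (1+y)^(-ρ) ≥ 1 - ρ * y := by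
    rw [Real.rpow_def_of_pos h1]
    have := Real.add_one_le_exp (Real.log (1+y) * -ρ)
    have h3 : Real.log (1+y) ≤ y := by have := Real.log_le_sub_one_of_pos h1; linarith
    nlinarith
  have h4 : 0 < (1+y)^ρ := by positivity
  have h5 : (1+y)^(-ρ) * (1+y)^ρ = 1 := by rw [← Real.rpow_add h1]; simp
  nlinarith

lemma integrable_poly_exp (C ρ : ℝ) :
    IntegrableOn (fun v : ℝ => (v + C) * (1+v)^ρ * Real.exp (-v)) (Set.Ioi 0) := by
  apply integrable_of_isBigO_exp_neg (b := 1/2) (by norm_num)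
  · apply ContinuousOn.mul
    · apply ContinuousOn.mul (by fun_prop)
      apply ContinuousOn.rpow_const (by fun_prop)
      intro x hx
      left
      have : (0:ℝ) ≤ x := hx
      linarith
    · fun_prop
  · have h1 : (fun v : ℝ => v + C) =O[atTop] (fun v : ℝ => Real.exp ((1/4) * v)) := by
      have a1 : (fun v : ℝ => v) =O[atTop] (fun v : ℝ => Real.exp ((1/4) * v)) := by
        have := (isLittleO_rpow_exp_pos_mul_atTop 1 (show (0:ℝ) < 1/4 by norm_num)).isBigO
        simpa using this
      have a2 : (fun _ : ℝ => C) =O[atTop] (fun v : ℝ => Real.exp ((1/4) * v)) := by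
        have := (isLittleO_rpow_exp_pos_mul_atTop 0 (show (0:ℝ) < 1/4 by norm_num)).isBigO
        simp only [Real.rpow_zero] at this
        exact (isBigO_const_const C (one_ne_zero (α := ℝ)) _).trans this
      exact a1.add a2
    have h2 : (fun v : ℝ => (1+v)^ρ) =O[atTop] (fun v : ℝ => Real.exp ((1/4) * v)) := by
      have := (isLittleO_rpow_exp_pos_mul_atTop ρ (show (0:ℝ) < 1/4 by norm_num)).isBigO
      have t : Tendsto (fun v : ℝ => 1 + v) atTop atTop := tendsto_atTop_add_const_left _ _ tendsto_id
      have h3 := this.comp_tendsto t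
      refine h3.trans ?_
      have : ((fun x : ℝ => Real.exp (1/4 * x)) ∘ fun v : ℝ => 1 + v) = fun v => Real.exp (1/4) * Real.exp (1/4 * v) := by
        ext v; simp only [Function.comp]; rw [← Real.exp_add]; congr 1; ring
      rw [this]
      exact isBigO_const_mul_self _ _ _
    have h3 := (h1.mul h2).mul (isBigO_refl (fun v : ℝ => Real.exp (-v)) atTop)
    refine h3.congr_right fun v => ?_
    rw [← Real.exp_add, ← Real.exp_add]; congr 1; ring

lemma int_v_exp : ∫ v in Set.Ioi (0:ℝ), v * Real.exp (-v) = 1 := by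
  have := Real.integral_rpow_mul_exp_neg_mul_Ioi (a := 2) (r := 1) (by norm_num) one_pos
  norm_num [Real.rpow_one] at this
  exact this

lemma slope_lim (ρ v : ℝ) (L : ℕ → ℝ) (hL : Tendsto L atTop atTop) :
    Tendsto (fun n => L n * ((1 + v / L n)^ρ - 1)) atTop (𝓝 (ρ * v)) := by
  have hd : HasDerivAt (fun y : ℝ => (1 + y * v)^ρ) (ρ * v) 0 := by
    have h1 : HasDerivAt (fun y : ℝ => 1 + y * v) v 0 := by
      simpa using ((hasDerivAt_id (0:ℝ)).mul_const v).const_add 1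
    have := h1.rpow_const (p := ρ) (Or.inl (by simp))
    simp only [zero_mul, add_zero, Real.one_rpow, mul_one] at this
    rwa [mul_comm] at this
  rw [hasDerivAt_iff_tendsto_slope_zero] at hd
  have ht : Tendsto (fun n => (L n)⁻¹) atTop (𝓝[≠] 0) := by
    rw [tendsto_nhdsWithin_iff]
    refine ⟨tendsto_inv_atTop_zero.comp hL, ?_⟩
    filter_upwards [hL.eventually_gt_atTop 0] with n hn
    simp; exact hn.ne'
  refine (hd.comp ht).congr fun n => ?_
  simp only [Function.comp, inv_inv, zero_add, smul_eq_mul, zero_mul, add_zero, Real.one_rpow]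
  congr 3
  field_simp

lemma NS_shift (w : ℕ → ℝ) (m : ℕ) (x : ℝ) (hx : 0 ≤ x) :
    NS (fun k => w (m + k)) x = NS w (m + x) - NS w m := by
  unfold NS
  rw [Nat.floor_natCast, show (m:ℝ) + x = x + m by ring, Nat.floor_add_natCast hx, add_comm _ m, Finset.sum_range_add]
  ring

theorem tail_limit {b : ℕ → ℝ} (hb : ∀ k, 0 ≤ b k) (h : SE b) (ρ δ A K : ℝ) (hδ : 0 < δ) (hδρ : δ < ρ) (hA : 0 < A)
    (hK : 0 ≤ K) (hN : ∀ x, 0 < x → |NS (fun k => b (k+1)) x - A/ρ * x^ρ| ≤ K * x^(ρ-δ))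
    (α : ℕ → ℝ) (m : ℕ → ℕ) (τ : ℝ) (hα0 : ∀ n, 0 < α n)
    (hL : Tendsto (fun n => α n * m n) atTop atTop)
    (hαL : Tendsto (fun n => α n ^ δ * (α n * m n)) atTop (𝓝 0))
    (hQ : Tendsto (fun n => A * (α n * m n)^(ρ-1) * α n^(-ρ) * Real.exp (-(α n * m n))) atTop (𝓝 τ)) :
    Tendsto (fun n => ∑' k : ℕ, b (m n + k + 1) * Real.exp (-(α n * ((m n : ℝ) + k + 1)))) atTop (𝓝 τ) := by
  have hρ : 0 < ρ := hδ.trans hδρ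
  set L : ℕ → ℝ := fun n => α n * m n with hLdef
  let w : ℕ → ℕ → ℝ := fun n k => b (m n + k + 1)
  let φ : ℕ → ℝ → ℝ := fun n v => NS (w n) (v / α n) * Real.exp (-v) / (A * L n ^(ρ-1) * α n ^(-ρ))
  have hL1 : ∀ᶠ n in atTop, 1 ≤ L n := hL.eventually_ge_atTop 1
  have hrep : ∀ᶠ n in atTop, (A * L n ^(ρ-1) * α n^(-ρ) * Real.exp (-L n)) * ∫ v in Set.Ioi (0:ℝ), φ n v =
      ∑' k : ℕ, b (m n + k + 1) * Real.exp (-(α n * ((m n : ℝ) + k + 1))) := by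
    filter_upwards [hL1] with n hn
    have ha := hα0 n
    have hLp : 0 < L n := by linarith
    have hs : Summable (fun k : ℕ => w n k * Real.exp (-(α n * ((k:ℝ)+1)))) := by
      have h1 := (summable_nat_add_iff (m n)).mpr (h (α n) ha)
      refine (h1.mul_left (Real.exp (α n * m n))).congr fun k => ?_
      simp only [w]
      rw [mul_left_comm, ← Real.exp_add, show k + m n + 1 = m n + k + 1 by ring]
      congr 2; push_cast; ring
    have e1 := abel_exp (w n) (fun k => hb _) (α n) ha hs
    have e2 : ∑' k : ℕ, b (m n + k + 1) * Real.exp (-(α n * ((m n : ℝ) + k + 1))) =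
        Real.exp (-L n) * ∑' k : ℕ, w n k * Real.exp (-(α n * ((k:ℝ)+1))) := by
      rw [← tsum_mul_left]; congr 1; ext k
      simp only [w, hLdef]
      rw [mul_left_comm, ← Real.exp_add]; congr 2; ring
    have e3 := integral_comp_mul_left_Ioi (fun v => NS (w n) (v / α n) * Real.exp (-v)) 0 ha
    rw [mul_zero] at e3
    have e4 : ∫ x in Set.Ioi (0:ℝ), NS (w n) x * (α n * Real.exp (-(α n * x))) =
        ∫ v in Set.Ioi (0:ℝ), NS (w n) (v / α n) * Real.exp (-v) := by
      have : ∀ x : ℝ, NS (w n) x * (α n * Real.exp (-(α n * x))) = α n * (NS (w n) ((α n * x) / α n) * Real.exp (-(α n * x))) := by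
        intro x; rw [mul_div_cancel_left₀ _ ha.ne']; ring
      simp_rw [this]
      rw [integral_const_mul, e3, smul_eq_mul, mul_inv_cancel_left₀ ha.ne']
    rw [e2, e1, e4]
    simp only [φ]
    rw [integral_div]
    have : A * L n ^(ρ-1) * α n^(-ρ) ≠ 0 := by positivity
    field_simp
  have hest : ∀ᶠ n in atTop, ∀ v, 0 < v → |φ n v - (1/ρ) * (L n * ((1 + v / L n)^ρ - 1)) * Real.exp (-v)| ≤
      (2 * K / A) * (α n ^ δ * L n) * ((1+v)^ρ * Real.exp (-v)) := by
    filter_upwards [hL1] with n hn v hv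
    have ha := hα0 n
    have hLp : 0 < L n := by linarith
    have hmp : (0:ℝ) < m n := by
      by_contra hc
      have : (m n : ℝ) ≤ 0 := not_lt.mp hc
      have : L n ≤ 0 := mul_nonpos_of_nonneg_of_nonpos ha.le this
      linarith
    have hmL : (m n : ℝ) = L n / α n := by simp only [hLdef]; field_simp
    set s := 1 + v / L n with hs
    have hs1 : 1 ≤ s := by rw [hs]; have : 0 ≤ v / L n := by positivity
                           linarith
    have hsv : s ≤ 1 + v := by
      rw [hs]; gcongr; exact div_le_self hv.le hn
    have hsp : 0 < s := by linarith
    have hms : (m n : ℝ) + v / α n = L n / α n * s := by rw [hmL, hs]; field_simp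
    have hD : NS (w n) (v / α n) = NS (fun k => b (k+1)) (L n / α n * s) - NS (fun k => b (k+1)) (L n / α n) := by
      have := NS_shift (fun k => b (k+1)) (m n) (v / α n) (by positivity)
      rw [hms, hmL] at this
      exact this
    have hy : 0 < L n / α n := by positivity
    set y := L n / α n with hydef
    have b1 := hN (y * s) (by positivity)
    have b2 := hN y hy
    have b3 : y^(ρ-δ) ≤ (y*s)^(ρ-δ) := by
      apply Real.rpow_le_rpow hy.le _ (by linarith)
      nlinarith
    have b4 : |NS (w n) (v / α n) - A/ρ * ((y*s)^ρ - y^ρ)| ≤ 2 * K * (y*s)^(ρ-δ) := by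
      rw [hD]
      have : NS (fun k => b (k+1)) (y * s) - NS (fun k => b (k+1)) y - A/ρ * ((y*s)^ρ - y^ρ) =
        (NS (fun k => b (k+1)) (y * s) - A/ρ * (y*s)^ρ) - (NS (fun k => b (k+1)) y - A/ρ * y^ρ) := by ring
      rw [this]
      refine (abs_sub _ _).trans ?_
      have := mul_le_mul_of_nonneg_left b3 hK
      linarith
    have ey : A * L n ^(ρ-1) * α n ^(-ρ) = A * y^ρ / L n := by
      rw [hydef, Real.div_rpow hLp.le ha.le, Real.rpow_neg ha.le, Real.rpow_sub hLp, Real.rpow_one]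
      field_simp
    have hyρ : 0 < y^ρ := by positivity
    have e5 : φ n v - (1/ρ) * (L n * (s^ρ - 1)) * Real.exp (-v) =
        (NS (w n) (v / α n) - A/ρ * ((y*s)^ρ - y^ρ)) * (L n / (A * y^ρ) * Real.exp (-v)) := by
      simp only [φ]
      rw [ey, Real.mul_rpow hy.le hsp.le]
      field_simp
    rw [e5, abs_mul, abs_of_pos (show 0 < L n / (A * y^ρ) * Real.exp (-v) by positivity)]
    refine (mul_le_mul_of_nonneg_right b4 (by positivity)).trans ?_
    have e6 : 2 * K * (y*s)^(ρ-δ) * (L n / (A * y^ρ) * Real.exp (-v)) =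
        (2 * K / A) * (y^(-δ) * L n) * (s^(ρ-δ) * Real.exp (-v)) := by
      rw [Real.mul_rpow hy.le hsp.le, sub_eq_add_neg, Real.rpow_add hy]
      field_simp
    rw [e6]
    have c1 : s^(ρ-δ) ≤ (1+v)^ρ := by
      calc s^(ρ-δ) ≤ s^ρ := Real.rpow_le_rpow_of_exponent_le hs1 (by linarith)
        _ ≤ _ := Real.rpow_le_rpow hsp.le hsv hρ.le
    have c2 : y^(-δ) ≤ α n ^ δ := by
      rw [hydef, Real.div_rpow hLp.le ha.le, Real.rpow_neg ha.le, Real.rpow_neg hLp.le]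
      have : 1 ≤ L n ^ δ := Real.one_le_rpow hn hδ.le
      rw [div_inv_eq_mul]
      have h2 : (L n ^ δ)⁻¹ ≤ 1 := inv_le_one_of_one_le₀ this
      have h3 : 0 < α n ^ δ := by positivity
      nlinarith
    gcongr
  have hIntg : Tendsto (fun n => ∫ v in Set.Ioi (0:ℝ), φ n v) atTop (𝓝 (∫ v in Set.Ioi (0:ℝ), v * Real.exp (-v))) := by
    apply tendsto_integral_filter_of_dominated_convergence (fun v => (v + 2 * K / A) * (1+v)^ρ * Real.exp (-v))
    · refine Eventually.of_forall fun n => ?_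
      apply Measurable.aestronglyMeasurable
      simp only [φ]
      have := NS_measurable (w n)
      have h2 : Measurable (fun v : ℝ => NS (w n) (v / α n)) := this.comp (measurable_id.div_const _)
      fun_prop
    · filter_upwards [hL1, hest, hαL.eventually_le_const (show (0:ℝ) < 1 by norm_num)] with n hn he hle
      refine (ae_restrict_iff' measurableSet_Ioi).mpr (Eventually.of_forall fun v hv => ?_)
      have hv0 : (0:ℝ) < v := hv
      have h1 := he v hv0
      have hLp : 0 < L n := by linarith
      have h2 := rpow_sub_one_le ρ (v / L n) hρ (by positivity)
      have h3 : (1 + v / L n)^ρ ≤ (1+v)^ρ := by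
        apply Real.rpow_le_rpow (by positivity) _ hρ.le
        gcongr; exact div_le_self hv0.le hn
      have h4 : 0 ≤ (1 + v / L n)^ρ - 1 := by
        have := Real.one_le_rpow (show 1 ≤ 1 + v / L n by have : 0 ≤ v / L n := by positivity
                                                          linarith) hρ.le
        linarith
      have h5 : (1/ρ) * (L n * ((1 + v / L n)^ρ - 1)) ≤ v * (1+v)^ρ := by
        calc (1/ρ) * (L n * ((1 + v / L n)^ρ - 1)) ≤ (1/ρ) * (L n * (ρ * (v / L n) * (1 + v / L n)^ρ)) := by gcongr
          _ = v * (1 + v / L n)^ρ := by field_simp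
          _ ≤ _ := by gcongr
      have h6 : |(1/ρ) * (L n * ((1 + v / L n)^ρ - 1)) * Real.exp (-v)| ≤ v * (1+v)^ρ * Real.exp (-v) := by
        rw [abs_of_nonneg (by positivity)]; gcongr
      have h7 : (2 * K / A) * (α n ^ δ * L n) * ((1+v)^ρ * Real.exp (-v)) ≤ (2 * K / A) * 1 * ((1+v)^ρ * Real.exp (-v)) := by
        gcongr
      rw [Real.norm_eq_abs]
      have h8 := abs_sub_abs_le_abs_sub (φ n v) ((1/ρ) * (L n * ((1 + v / L n)^ρ - 1)) * Real.exp (-v))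
      nlinarith
    · exact integrable_poly_exp _ _
    · refine (ae_restrict_iff' measurableSet_Ioi).mpr (Eventually.of_forall fun v hv => ?_)
      have hv0 : (0:ℝ) < v := hv
      have t1 : Tendsto (fun n => φ n v - (1/ρ) * (L n * ((1 + v / L n)^ρ - 1)) * Real.exp (-v)) atTop (𝓝 0) := by
        have t2 := (hαL.const_mul (2 * K / A)).mul_const ((1+v)^ρ * Real.exp (-v))
        rw [mul_zero, zero_mul] at t2
        refine squeeze_zero_norm' ?_ t2
        filter_upwards [hest] with n hn
        exact hn v hv0
      have t3 := ((slope_lim ρ v L hL).const_mul (1/ρ)).mul_const (Real.exp (-v))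
      have t4 := t1.add t3
      rw [zero_add, ← mul_assoc, one_div_mul_cancel hρ.ne', one_mul] at t4
      exact t4.congr fun n => by ring
  rw [int_v_exp] at hIntg
  have := hQ.mul hIntg
  rw [mul_one] at this
  exact this.congr' hrep

end PartJ

section PartK


theorem scale_asymp (ρ δ A C t : ℝ) (hρ : 0 < ρ) (hδ : 0 < δ) (hA : 0 < A)
    (α : ℕ → ℝ) (m : ℕ → ℕ) (hα0 : ∀ n, 0 < α n) (hα : Tendsto α atTop (𝓝 0))
    (hsad : ∀ᶠ n : ℕ in atTop, |n * α n ^ (ρ+1) - hMein ρ A| ≤ C * α n ^ δ)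
    (hm : ∀ᶠ n : ℕ in atTop,
      (aM ρ A n * (m n : ℝ) + ρ * Real.log (aM ρ A n)
          - (ρ - 1) * Real.log |Real.log (aM ρ A n)|
          - (ρ - 1) * Real.log ρ - Real.log A ≤ t) ∧
      (t < aM ρ A n * ((m n : ℝ) + 1) + ρ * Real.log (aM ρ A n)
          - (ρ - 1) * Real.log |Real.log (aM ρ A n)|
          - (ρ - 1) * Real.log ρ - Real.log A)) :
    Tendsto (fun n => α n * m n) atTop atTop ∧
    Tendsto (fun n => α n ^ δ * (α n * m n)) atTop (𝓝 0) ∧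
    Tendsto (fun n => A * (α n * m n)^(ρ-1) * α n^(-ρ) * Real.exp (-(α n * m n))) atTop (𝓝 (Real.exp (-t))) ∧
    Tendsto (fun n => α n ^ (-(ρ/2)) * Real.exp (-(3/4 * (α n * m n)))) atTop (𝓝 0) := by
  have hh := hMein_pos ρ A hρ hA
  set H := hMein ρ A with hH
  set a : ℕ → ℝ := fun n => aM ρ A n with hadef
  have haeq : ∀ n : ℕ, a n = (H / n) ^ ((1:ℝ)/(ρ+1)) := fun n => rfl
  have hap : ∀ᶠ n in atTop, 0 < a n := by
    filter_upwards [eventually_gt_atTop 0] with n hn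
    rw [haeq]
    have : (0:ℝ) < n := by exact_mod_cast hn
    positivity
  have ha0 : Tendsto a atTop (𝓝 0) := by
    have h1 : Tendsto (fun n : ℕ => H / (n:ℝ)) atTop (𝓝 0) := tendsto_const_nhds.div_atTop tendsto_natCast_atTop_atTop
    have h2 := h1.rpow_const (p := (1:ℝ)/(ρ+1)) (Or.inr (by positivity))
    rw [Real.zero_rpow (by positivity)] at h2
    exact h2
  have ha0' : Tendsto a atTop (𝓝[>] 0) := tendsto_nhdsWithin_iff.mpr ⟨ha0, hap⟩
  have hα0' : Tendsto α atTop (𝓝[>] 0) := tendsto_nhdsWithin_iff.mpr ⟨hα, Eventually.of_forall hα0⟩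
  have hαδ : Tendsto (fun n => α n ^ δ) atTop (𝓝 0) := by
    have h2 := hα.rpow_const (p := δ) (Or.inr hδ.le)
    rwa [Real.zero_rpow hδ.ne'] at h2
  let e : ℕ → ℝ := fun n => n * α n ^ (ρ+1) / H
  have he : ∀ᶠ n in atTop, |e n - 1| ≤ C / H * α n ^ δ := by
    filter_upwards [hsad] with n hn
    have : e n - 1 = (n * α n ^ (ρ+1) - H) / H := by simp only [e]; field_simp
    rw [this, abs_div, abs_of_pos hh, div_mul_eq_mul_div]
    gcongr
  have he1 : Tendsto e atTop (𝓝 1) := by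
    have t1 := hαδ.const_mul (C/H)
    rw [mul_zero] at t1
    have : Tendsto (fun n => e n - 1) atTop (𝓝 0) := squeeze_zero_norm' he t1
    have := this.add_const 1
    simpa using this
  have hratio : ∀ᶠ n in atTop, α n / a n = (e n) ^ ((1:ℝ)/(ρ+1)) := by
    filter_upwards [eventually_gt_atTop 0] with n hn
    have hn' : (0:ℝ) < n := by exact_mod_cast hn
    have hp := hα0 n
    have : e n = α n ^ (ρ+1) / (H / n) := by simp only [e]; field_simp
    rw [this, haeq, Real.div_rpow (x := α n ^ (ρ+1)) (by positivity) (by positivity), ← Real.rpow_mul hp.le, mul_one_div_cancel (by positivity), Real.rpow_one]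
  have hr1 : Tendsto (fun n => α n / a n) atTop (𝓝 1) := by
    have h2 := he1.rpow_const (p := (1:ℝ)/(ρ+1)) (Or.inl one_ne_zero)
    rw [Real.one_rpow] at h2
    exact h2.congr' (hratio.mono fun n hn => hn.symm)
  have hrO : (fun n => α n / a n - 1) =O[atTop] (fun n => α n ^ δ) := by
    have hd : DifferentiableAt ℝ (fun x : ℝ => x ^ ((1:ℝ)/(ρ+1))) 1 :=
      Real.differentiableAt_rpow_const_of_ne _ one_ne_zero
    have h1 := hd.isBigO_sub.comp_tendsto he1
    have h2 : (fun n => e n - 1) =O[atTop] (fun n => α n ^ δ) := by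
      refine IsBigO.of_bound (C/H) ?_
      filter_upwards [he] with n hn
      have := hα0 n
      rw [Real.norm_eq_abs, Real.norm_of_nonneg (by positivity)]
      exact hn
    have h3 := h1.trans h2
    refine h3.congr' ?_ EventuallyEq.rfl
    filter_upwards [hratio] with n hn
    simp only [Function.comp, Real.one_rpow]
    rw [hn]
  let y : ℕ → ℝ := fun n => - Real.log (a n)
  have hy : Tendsto y atTop atTop := tendsto_neg_atBot_atTop.comp (Real.tendsto_log_nhdsGT_zero.comp ha0')
  let s : ℕ → ℝ := fun n => a n * (m n : ℝ) + ρ * Real.log (a n)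
          - (ρ - 1) * Real.log |Real.log (a n)| - (ρ - 1) * Real.log ρ - Real.log A
  have hs : Tendsto (fun n => s n - t) atTop (𝓝 0) := by
    have h1 : Tendsto (fun n => - a n) atTop (𝓝 0) := by simpa using ha0.neg
    refine tendsto_of_tendsto_of_tendsto_of_le_of_le' h1 tendsto_const_nhds ?_ ?_
    · filter_upwards [hm] with n hn
      have := hn.2
      simp only [s, hadef]
      linarith
    · filter_upwards [hm] with n hn
      have := hn.1
      simp only [s, hadef]
      linarith
  set c0 := (ρ-1) * Real.log ρ + Real.log A + t with hc0
  have hL' : ∀ᶠ n in atTop, a n * m n = ρ * y n + (ρ-1) * Real.log (y n) + c0 + (s n - t) := by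
    filter_upwards [hy.eventually_gt_atTop 0] with n hn
    have hyn : 0 < - Real.log (a n) := hn
    have : |Real.log (a n)| = y n := abs_of_neg (by linarith)
    simp only [s]
    rw [this]
    simp only [y, hc0]
    ring
  have hlogy : Tendsto (fun n => Real.log (y n) / y n) atTop (𝓝 0) := by
    have := Real.isLittleO_log_id_atTop.tendsto_div_nhds_zero
    exact this.comp hy
  have hinvy : Tendsto (fun n => (y n)⁻¹) atTop (𝓝 0) := tendsto_inv_atTop_zero.comp hy
  have hLy' : Tendsto (fun n => a n * m n / y n) atTop (𝓝 ρ) := by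
    have t1 := ((hlogy.const_mul (ρ-1)).add (((hs.const_add c0).mul hinvy))).const_add ρ
    simp only [mul_zero, add_zero] at t1
    refine t1.congr' ?_
    filter_upwards [hL', hy.eventually_gt_atTop 0] with n hn hn0
    rw [hn]
    field_simp
    ring
  have hyα : Tendsto (fun n => α n ^ δ * y n) atTop (𝓝 0) := by
    have t1 := (tendsto_log_mul_rpow_nhdsGT_zero hδ).comp ha0'
    have t2 := hr1.rpow_const (p := δ) (Or.inl one_ne_zero)
    have t3 := (t1.mul t2).neg
    rw [zero_mul, neg_zero] at t3
    refine t3.congr' ?_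
    filter_upwards [hap] with n hn
    simp only [Function.comp, y]
    rw [Real.div_rpow (hα0 n).le hn.le]
    have : a n ^ δ ≠ 0 := by positivity
    field_simp
  have hL'α : Tendsto (fun n => α n ^ δ * (a n * m n)) atTop (𝓝 0) := by
    have t1 := hyα.mul hLy'
    rw [zero_mul] at t1
    refine t1.congr' ?_
    filter_upwards [hy.eventually_gt_atTop 0] with n hn
    field_simp
  have hdiff : Tendsto (fun n => α n * m n - a n * m n) atTop (𝓝 0) := by
    have h1 : (fun n => (α n / a n - 1) * (a n * m n)) =O[atTop] (fun n => α n ^ δ * (a n * m n)) :=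
      hrO.mul (isBigO_refl _ _)
    have h2 := h1.trans_tendsto hL'α
    refine h2.congr' ?_
    filter_upwards [hap] with n hn
    field_simp
  have hLy : Tendsto (fun n => α n * m n / y n) atTop (𝓝 ρ) := by
    have := (hdiff.mul hinvy).add hLy'
    rw [zero_mul, zero_add] at this
    refine this.congr fun n => ?_
    ring
  have g1 : Tendsto (fun n => α n * m n) atTop atTop := by
    have := hLy.pos_mul_atTop hρ hy
    refine this.congr' ?_
    filter_upwards [hy.eventually_gt_atTop 0] with n hn
    field_simp
  have g2 : Tendsto (fun n => α n ^ δ * (α n * m n)) atTop (𝓝 0) := by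
    have t1 := hyα.mul hLy
    rw [zero_mul] at t1
    refine t1.congr' ?_
    filter_upwards [hy.eventually_gt_atTop 0] with n hn
    field_simp
  have hlr : Tendsto (fun n => Real.log (α n / a n)) atTop (𝓝 0) := by
    have := hr1.log one_ne_zero
    rwa [Real.log_one] at this
  have hlogα : ∀ᶠ n in atTop, Real.log (α n) = Real.log (α n / a n) - y n := by
    filter_upwards [hap] with n hn
    rw [Real.log_div (hα0 n).ne' hn.ne']
    simp only [y]; ring
  refine ⟨g1, g2, ?_, ?_⟩
  · have hlog : Tendsto (fun n => Real.log A + (ρ-1) * Real.log (α n * m n / y n) - ρ * Real.log (α n / a n)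
        - (α n * m n - a n * m n) - c0 - (s n - t)) atTop (𝓝 (-t)) := by
      have t1 := (((((hLy.log hρ.ne').const_mul (ρ-1)).const_add (Real.log A)).sub (hlr.const_mul ρ)).sub hdiff).sub_const c0 |>.sub hs
      convert t1 using 2
      rw [hc0]; ring
    have := (Real.continuous_exp.tendsto _).comp hlog
    refine this.congr' ?_
    filter_upwards [hL', hlogα, g1.eventually_gt_atTop 0, hy.eventually_gt_atTop 0] with n h1 h2 h3 h4
    have hp := hα0 n
    simp only [Function.comp]
    rw [Real.rpow_def_of_pos h3, Real.rpow_def_of_pos hp, h2]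
    nth_rewrite 2 [← Real.exp_log hA]
    rw [← Real.exp_add, ← Real.exp_add, ← Real.exp_add]
    congr 1
    rw [Real.log_div h3.ne' h4.ne']
    have : α n * m n = α n * m n - a n * m n + (ρ * y n + (ρ-1) * Real.log (y n) + c0 + (s n - t)) := by
      rw [← h1]; ring
    linear_combination this
  · have t1 : Tendsto (fun n => (3/4 * (α n * m n / y n) - ρ/2)) atTop (𝓝 (3/4*ρ - ρ/2)) :=
      (hLy.const_mul (3/4)).sub_const _
    have t2 := t1.pos_mul_atTop (by linarith) hy
    have t3 : Tendsto (fun n => (3/4 * (α n * m n / y n) - ρ/2) * y n + ρ/2 * Real.log (α n / a n)) atTop atTop :=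
      t2.atTop_add (hlr.const_mul (ρ/2))
    have := Real.tendsto_exp_neg_atTop_nhds_zero.comp t3
    refine this.congr' ?_
    filter_upwards [hlogα, hy.eventually_gt_atTop 0] with n h2 h4
    have hp := hα0 n
    simp only [Function.comp]
    rw [Real.rpow_def_of_pos hp, h2, ← Real.exp_add]
    congr 1
    field_simp
    ring

end PartK

section PartL


lemma B_lower {b : ℕ → ℝ} (hb : ∀ k, 0 ≤ b k) (ρ δ A K : ℝ) (hδ : 0 < δ) (hδρ : δ < ρ) (hA : 0 < A)
    (hK : 0 ≤ K) (hN : ∀ x, 0 < x → |NS (fun k => b (k+1)) x - A/ρ * x^ρ| ≤ K * x^(ρ-δ)) :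
    ∃ c, 0 < c ∧ ∀ᶠ α in 𝓝[>] (0:ℝ), c * α^(-ρ) / α^2 ≤ ∑ k ∈ Finset.range ⌊1/α⌋₊, b (k+1) * ((k:ℝ)+1)^2 := by
  have hρ : 0 < ρ := hδ.trans hδρ
  set d := A/ρ * (1 - 2^(-ρ)) with hd
  have h2 : (2:ℝ)^(-ρ) < 1 := Real.rpow_lt_one_of_one_lt_of_neg (by norm_num) (by linarith)
  have hdp : 0 < d := mul_pos (by positivity) (by linarith)
  refine ⟨d/8, by positivity, ?_⟩
  have t2 : Tendsto (fun α : ℝ => 2 * K * α^δ) (𝓝[>] 0) (𝓝 0) := by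
    have : Tendsto (fun α : ℝ => 2 * K * α^δ) (𝓝 0) (𝓝 (2 * K * 0^δ)) :=
      ((Real.continuousAt_rpow_const 0 δ (Or.inr hδ.le)).tendsto).const_mul (2*K)
    rw [Real.zero_rpow hδ.ne', mul_zero] at this
    exact this.mono_left nhdsWithin_le_nhds
  filter_upwards [self_mem_nhdsWithin, t2.eventually_le_const (show 0 < d/2 by positivity)] with α hα hsmall
  have hα0 : (0:ℝ) < α := hα
  have b1 := (abs_le.mp (hN (1/α) (by positivity))).1
  have b2 := (abs_le.mp (hN (1/α * 2⁻¹) (by positivity))).2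
  have e1 : (1/α)^ρ = α^(-ρ) := by rw [one_div, Real.inv_rpow hα0.le, Real.rpow_neg hα0.le]
  have e2 : (1/α*2⁻¹)^ρ = α^(-ρ) * 2^(-ρ) := by
    rw [Real.mul_rpow (by positivity) (by positivity), e1, Real.inv_rpow (by positivity), Real.rpow_neg (x := 2) (by norm_num)]
  have e3 : (1/α)^(ρ-δ) = α^(-ρ) * α^δ := by
    rw [one_div, Real.inv_rpow hα0.le, ← Real.rpow_neg hα0.le, ← Real.rpow_add hα0]; congr 1; ring
  have e4 : (1/α*2⁻¹)^(ρ-δ) ≤ α^(-ρ) * α^δ := by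
    rw [← e3]
    apply Real.rpow_le_rpow (by positivity) _ (by linarith)
    have : 0 < 1/α := by positivity
    linarith
  rw [e1, e3] at b1
  rw [e2] at b2
  have hp : 0 < α^(-ρ) := by positivity
  have b3 := mul_le_mul_of_nonneg_left e4 hK
  have b4 : d/2 * α^(-ρ) ≤ NS (fun k => b (k+1)) (1/α) - NS (fun k => b (k+1)) (1/α*2⁻¹) := by
    have : 2 * K * α^δ * α^(-ρ) ≤ d/2 * α^(-ρ) := by gcongr
    have e5 : d * α^(-ρ) = A/ρ * α^(-ρ) - A/ρ * (α^(-ρ) * 2^(-ρ)) := by rw [hd]; ring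
    nlinarith
  have hsub : Finset.range ⌊1/α*2⁻¹⌋₊ ⊆ Finset.range ⌊1/α⌋₊ := by
    apply Finset.range_subset_range.mpr
    apply Nat.floor_le_floor
    have : 0 < 1/α := by positivity
    linarith
  unfold NS at b4
  rw [← Finset.sum_sdiff hsub, add_sub_cancel_right] at b4
  calc d/8 * α^(-ρ)/α^2 = (1/(4*α^2)) * (d/2 * α^(-ρ)) := by field_simp; norm_num
    _ ≤ (1/(4*α^2)) * ∑ k ∈ Finset.range ⌊1/α⌋₊ \ Finset.range ⌊1/α*2⁻¹⌋₊, b (k+1) := by gcongr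
    _ = ∑ k ∈ Finset.range ⌊1/α⌋₊ \ Finset.range ⌊1/α*2⁻¹⌋₊, b (k+1) * (1/(4*α^2)) := by
        rw [Finset.mul_sum]; exact Finset.sum_congr rfl fun k _ => mul_comm _ _
    _ ≤ ∑ k ∈ Finset.range ⌊1/α⌋₊ \ Finset.range ⌊1/α*2⁻¹⌋₊, b (k+1) * ((k:ℝ)+1)^2 := by
        apply Finset.sum_le_sum
        intro k hk
        rw [Finset.mem_sdiff, Finset.mem_range, Finset.mem_range, mem_fl (by positivity), mem_fl (by positivity)] at hk
        have h5 := hk.2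
        push Not at h5
        have h6 : (1/α*2⁻¹)^2 ≤ ((k:ℝ)+1)^2 := by gcongr
        have h7 : (1/α*2⁻¹)^2 = 1/(4*α^2) := by field_simp; norm_num
        rw [h7] at h6
        exact mul_le_mul_of_nonneg_left h6 (hb _)
    _ ≤ _ := Finset.sum_le_sum_of_subset_of_nonneg Finset.sdiff_subset
        fun k _ _ => mul_nonneg (hb _) (by positivity)

lemma j0_le (f : ℕ × ℕ → ℝ) (hf : Summable f) (h0 : ∀ i, 0 ≤ f i) :
    Summable (fun k => f (k,0)) ∧ ∑' k, f (k,0) ≤ ∑' i, f i := by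
  have hinj : Function.Injective (fun k : ℕ => ((k,0) : ℕ × ℕ)) := fun a b hab => by simpa using hab
  exact ⟨hf.comp_injective hinj, tsum_comp_le_tsum_of_inj hf h0 hinj⟩

lemma WK_j0 (b : ℕ → ℝ) (α : ℝ) (k : ℕ) : WK b α (k,0) = b (k+1) * Real.exp (-(α * ((k:ℝ)+1))) := by
  unfold WK lK; simp

lemma cos_summable {b : ℕ → ℝ} (hb : ∀ k, 0 ≤ b k) (h : SE b) (α : ℝ) (hα : 0 < α) (θ : ℝ) :
    Summable (fun i => WK b α i * (1 - Real.cos (lK i * θ))) ∧ ∀ i, 0 ≤ WK b α i * (1 - Real.cos (lK i * θ)) := by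
  have h0 : ∀ i, 0 ≤ WK b α i * (1 - Real.cos (lK i * θ)) := fun i =>
    mul_nonneg (WK_nonneg b hb _ _) (by linarith [Real.cos_le_one (lK i * θ)])
  refine ⟨Summable.of_nonneg_of_le h0 (fun i => ?_) ((WK_hasSum hb h α hα).summable.mul_left 2), h0⟩
  have := WK_nonneg b hb α i
  have := Real.neg_one_le_cos (lK i * θ)
  nlinarith

lemma quad_lower {b b' : ℕ → ℝ} (hb' : ∀ k, 0 ≤ b' k) (h : SE b') (α : ℝ) (hα : 0 < α)
    (hag : ∀ k : ℕ, (k:ℝ) + 1 ≤ 1/α → b' (k+1) = b (k+1)) (g : ℕ → ℝ) (c : ℝ) (hc : 0 ≤ c)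
    (hg : ∀ l, 0 ≤ g l)
    (hgs : Summable (fun i => WK b' α i * g (lK i)))
    (hgl : ∀ l : ℕ, (l:ℝ) ≤ 1/α → c * (l:ℝ)^2 ≤ g l) :
    Real.exp (-1) * c * ∑ k ∈ Finset.range ⌊1/α⌋₊, b (k+1) * ((k:ℝ)+1)^2 ≤ ∑' i, WK b' α i * g (lK i) := by
  obtain ⟨s1, s2⟩ := j0_le _ hgs (fun i => mul_nonneg (WK_nonneg b' hb' _ _) (hg _))
  refine le_trans ?_ s2
  refine le_trans ?_ (s1.sum_le_tsum (Finset.range ⌊1/α⌋₊) (fun k _ => mul_nonneg (WK_nonneg b' hb' _ _) (hg _)))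
  rw [Finset.mul_sum]
  apply Finset.sum_le_sum
  intro k hk
  rw [Finset.mem_range, mem_fl (by positivity)] at hk
  rw [WK_j0, hag k hk]
  have e : lK (k,0) = k+1 := by simp [lK]
  have h1 := hgl (k+1) (by push_cast; exact hk)
  push_cast at h1
  rw [e]
  have h2 : Real.exp (-1) ≤ Real.exp (-(α * ((k:ℝ)+1))) := by
    apply Real.exp_le_exp.mpr
    have := mul_le_mul_of_nonneg_left hk hα.le
    rw [mul_one_div_cancel hα.ne'] at this
    linarith
  have hbk : 0 ≤ b (k+1) := by rw [← hag k hk]; exact hb' _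
  calc Real.exp (-1) * c * (b (k+1) * ((k:ℝ)+1)^2) = b (k+1) * Real.exp (-1) * (c * ((k:ℝ)+1)^2) := by ring
    _ ≤ b (k+1) * Real.exp (-(α * ((k:ℝ)+1))) * g (k+1) := by gcongr

lemma moment_bound {b : ℕ → ℝ} (hb : ∀ k, 0 ≤ b k) (h : SE b) (ρ C : ℝ) (hC : 0 < C)
    (hF : ∀ α, 0 < α → α ≤ 1 → Fb b (Real.exp (-α)) ≤ C * α^(-ρ)) (p : ℕ) :
    ∃ C', 0 < C' ∧ ∀ α, 0 < α → α ≤ 1 → ∑' i, WK b α i * (lK i : ℝ)^p ≤ C' * α^(-ρ) / α^p := by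
  refine ⟨2^p * p.factorial * (C * 2^ρ), by positivity, fun α hα hα1 => ?_⟩
  refine (WK_moment_tsum hb h α hα p).trans ?_
  have h1 := hF (α/2) (by linarith) (by linarith)
  have e : (α/2)^(-ρ) = α^(-ρ) * 2^ρ := by
    rw [Real.div_rpow hα.le (by norm_num), Real.rpow_neg (x := 2) (by norm_num)]; field_simp
  rw [e] at h1
  calc _ ≤ 2^p * p.factorial / α^p * (C * (α^(-ρ) * 2^ρ)) := by gcongr
    _ = _ := by ring

/-- complementary weights -/
def bU (b : ℕ → ℝ) (m : ℕ) (k : ℕ) : ℝ := if k ≤ m then 0 else b k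

lemma bU_nonneg (b : ℕ → ℝ) (hb : ∀ k, 0 ≤ b k) (m k : ℕ) : 0 ≤ bU b m k := by
  unfold bU; split_ifs
  · exact le_refl _
  · exact hb k

lemma bU_le (b : ℕ → ℝ) (hb : ∀ k, 0 ≤ b k) (m k : ℕ) : bU b m k ≤ b k := by
  unfold bU; split_ifs
  · exact hb k
  · exact le_refl _

lemma bT_add_bU (b : ℕ → ℝ) (m k : ℕ) : bT b m k + bU b m k = b k := by
  unfold bT bU; split_ifs <;> simp

lemma WK_add (b : ℕ → ℝ) (m : ℕ) (α : ℝ) (i : ℕ × ℕ) : WK (bT b m) α i + WK (bU b m) α i = WK b α i := by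
  unfold WK
  rw [← bT_add_bU b m (i.1+1)]
  ring

lemma tail_moment_le {b : ℕ → ℝ} (hb : ∀ k, 0 ≤ b k) (m : ℕ) (α : ℝ) (hα : 0 < α) (p : ℕ) (i : ℕ × ℕ) :
    WK (bU b m) α i * (lK i : ℝ)^p ≤ 8^p * p.factorial / α^p * Real.exp (-(3/4 * (α * m))) * WK b (α/8) i := by
  have hW := WK_nonneg b hb (α/8) i
  by_cases hm : i.1 + 1 ≤ m
  · have : WK (bU b m) α i = 0 := by unfold WK bU; rw [if_pos hm]; simp
    rw [this, zero_mul]; positivity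
  · have hl : (m:ℝ) ≤ lK i := by
      have : m ≤ lK i := by
        unfold lK
        have : i.1 + 1 ≤ (i.1+1) * (i.2+1) := Nat.le_mul_of_pos_right _ (by omega)
        omega
      exact_mod_cast this
    have h1 := pow_exp_bound p (α/8 * lK i) (by positivity)
    have h2 : Real.exp (-(α * lK i)) = Real.exp (-(α/8 * lK i)) * Real.exp (-(3/4 * (α * lK i))) * Real.exp (-(α/8 * lK i)) := by
      rw [← Real.exp_add, ← Real.exp_add]; congr 1; ring
    have h3 : WK (bU b m) α i * (lK i : ℝ)^p = (8^p/α^p) * ((α/8 * lK i)^p * Real.exp (-(α/8 * lK i))) * Real.exp (-(3/4 * (α * lK i))) * WK b (α/8) i := by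
      unfold WK bU
      rw [if_neg hm, h2, mul_pow, div_pow]; field_simp
    rw [h3]
    have h4 : Real.exp (-(3/4 * (α * lK i))) ≤ Real.exp (-(3/4 * (α * m))) := by
      apply Real.exp_le_exp.mpr
      have := mul_le_mul_of_nonneg_left hl hα.le
      linarith
    calc _ ≤ (8^p/α^p) * p.factorial * Real.exp (-(3/4 * (α * m))) * WK b (α/8) i := by gcongr
      _ = _ := by ring

lemma tail_moment_bound {b : ℕ → ℝ} (hb : ∀ k, 0 ≤ b k) (h : SE b) (ρ C : ℝ) (hC : 0 < C)
    (hF : ∀ α, 0 < α → α ≤ 1 → Fb b (Real.exp (-α)) ≤ C * α^(-ρ)) (p : ℕ) :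
    ∃ C', 0 < C' ∧ ∀ α, 0 < α → α ≤ 1 → ∀ m : ℕ, ∑' i, WK (bU b m) α i * (lK i : ℝ)^p ≤
      C' * α^(-ρ) / α^p * Real.exp (-(3/4 * (α * m))) := by
  refine ⟨8^p * p.factorial * (C * 8^ρ), by positivity, fun α hα hα1 m => ?_⟩
  have hs := WK_hasSum hb h (α/8) (by linarith)
  have hU := WK_moment_summable (bU_nonneg b hb m) (h.mono (bU_nonneg b hb m) (bU_le b hb m)) α hα p
  refine (hU.tsum_le_tsum (tail_moment_le hb m α hα p) (hs.summable.mul_left _)).trans ?_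
  rw [tsum_mul_left, hs.tsum_eq]
  have h1 := hF (α/8) (by linarith) (by linarith)
  have e : (α/8)^(-ρ) = α^(-ρ) * 8^ρ := by
    rw [Real.div_rpow hα.le (by norm_num), Real.rpow_neg (x := 8) (by norm_num)]; field_simp
  rw [e] at h1
  calc _ ≤ 8^p * p.factorial / α^p * Real.exp (-(3/4 * (α * m))) * (C * (α^(-ρ) * 8^ρ)) := by gcongr
    _ = _ := by ring

lemma m3_lower {b b' : ℕ → ℝ} (hb' : ∀ k, 0 ≤ b' k) (hle : ∀ k, b' k ≤ b k) (h : SE b) (α θ g : ℝ) (hα : 0 < α)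
    (hg : g ≤ ∑' k : ℕ, b (k + 1) * Real.exp (-((k : ℝ) + 1) * α) * Real.sin (π * ((k : ℝ) + 1) * (θ/(2*π))) ^ 2) :
    2 * g - 2 * (∑' k : ℕ, (b (k+1) - b' (k+1)) * Real.exp (-(α * ((k:ℝ)+1)))) ≤
      ∑' i, WK b' α i * (1 - Real.cos (lK i * θ)) := by
  have hSE := h.mono hb' hle
  obtain ⟨q1, q2⟩ := cos_summable hb' hSE α hα θ
  obtain ⟨s1, s2⟩ := j0_le _ q1 q2
  refine le_trans ?_ s2
  have d1 : Summable (fun k : ℕ => (b (k+1) - b' (k+1)) * Real.exp (-(α * ((k:ℝ)+1)))) := by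
    refine ((h α hα).sub (hSE α hα)).congr fun k => ?_
    ring
  have e : ∀ k : ℕ, Real.sin (π * ((k : ℝ) + 1) * (θ/(2*π))) ^ 2 = (1 - Real.cos (((k:ℝ)+1) * θ))/2 := by
    intro k
    have h1 : π * ((k : ℝ) + 1) * (θ/(2*π)) = ((k:ℝ)+1)*θ/2 := by field_simp
    rw [h1, Real.sin_sq_eq_half_sub]
    rw [show 2 * (((k:ℝ)+1)*θ/2) = ((k:ℝ)+1)*θ by ring]
    ring
  simp_rw [e] at hg
  have e0 : ∀ k : ℕ, lK (k,0) = k+1 := by intro k; simp [lK]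
  have hcos : ∀ k : ℕ, 0 ≤ 1 - Real.cos (((k:ℝ)+1)*θ) ∧ 1 - Real.cos (((k:ℝ)+1)*θ) ≤ 2 := fun k =>
    ⟨by linarith [Real.cos_le_one (((k:ℝ)+1)*θ)], by linarith [Real.neg_one_le_cos (((k:ℝ)+1)*θ)]⟩
  have d2 : Summable (fun k : ℕ => b (k + 1) * Real.exp (-((k : ℝ) + 1) * α) * ((1 - Real.cos (((k:ℝ)+1) * θ))/2)) := by
    refine Summable.of_nonneg_of_le (fun k => ?_) (fun k => ?_) (h α hα)
    · have := (hcos k).1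
      have := (hb' (k+1)).trans (hle (k+1))
      positivity
    · rw [show -((k:ℝ)+1)*α = -(α*((k:ℝ)+1)) by ring]
      have h1 := (hcos k).2
      have h2 := (hb' (k+1)).trans (hle (k+1))
      have h3 : 0 ≤ b (k+1) * Real.exp (-(α*((k:ℝ)+1))) := by positivity
      nlinarith
  have : 2 * (∑' k : ℕ, b (k + 1) * Real.exp (-((k : ℝ) + 1) * α) * ((1 - Real.cos (((k:ℝ)+1) * θ))/2)) -
     2 * (∑' k : ℕ, (b (k+1) - b' (k+1)) * Real.exp (-(α * ((k:ℝ)+1)))) ≤ ∑' k, WK b' α (k,0) * (1 - Real.cos (lK (k,0) * θ)) := by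
    rw [← tsum_mul_left, ← tsum_mul_left, ← (d2.mul_left 2).tsum_sub (d1.mul_left 2)]
    refine ((d2.mul_left 2).sub (d1.mul_left 2)).tsum_le_tsum (fun k => ?_) s1
    rw [WK_j0, e0]
    push_cast
    rw [show -((k:ℝ)+1)*α = -(α*((k:ℝ)+1)) by ring]
    have h1 := (hcos k).2
    have h2 : 0 ≤ b (k+1) - b' (k+1) := by linarith [hle (k+1)]
    have h3 : 0 ≤ (b (k+1) - b' (k+1)) * Real.exp (-(α*((k:ℝ)+1))) := by positivity
    have h4 := mul_le_mul_of_nonneg_left h1 h3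
    have e5 : 2 * (b (k+1) * Real.exp (-(α*((k:ℝ)+1))) * ((1 - Real.cos (((k:ℝ)+1) * θ))/2)) -
      b' (k+1) * Real.exp (-(α*((k:ℝ)+1))) * (1 - Real.cos (((k:ℝ)+1) * θ)) =
      (b (k+1) - b' (k+1)) * Real.exp (-(α*((k:ℝ)+1))) * (1 - Real.cos (((k:ℝ)+1) * θ)) := by ring
    linarith
  linarith

end PartL

section PartM

/-- the standard deviation -/
def sg (b : ℕ → ℝ) (α : ℝ) : ℝ := Real.sqrt (∑' i, WK b α i * (lK i : ℝ)^2)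

lemma P_sq (ρ α : ℝ) (hα : 0 < α) : (α^(-(ρ/2))/α)^2 = α^(-ρ)/α^2 := by
  rw [div_pow, ← Real.rpow_natCast (α^(-(ρ/2))) 2, ← Real.rpow_mul hα.le]
  congr 2; push_cast; ring

lemma sg_bounds {b : ℕ → ℝ} (hb : ∀ k, 0 ≤ b k) (h : SE b) (ρ δ A K : ℝ) (hδ : 0 < δ) (hδρ : δ < ρ) (hA : 0 < A)
    (hK : 0 ≤ K) (hN : ∀ x, 0 < x → |NS (fun k => b (k+1)) x - A/ρ * x^ρ| ≤ K * x^(ρ-δ)) :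
    ∃ c C, 0 < c ∧ 0 < C ∧ ∀ᶠ α in 𝓝[>] (0:ℝ),
      c * (α^(-(ρ/2))/α) ≤ sg b α ∧ sg b α ≤ C * (α^(-(ρ/2))/α) := by
  obtain ⟨c, hc, hB⟩ := B_lower hb ρ δ A K hδ hδρ hA hK hN
  obtain ⟨C, hC, hF⟩ := F_bound hb h ρ δ A K hδ hδρ hA hK hN
  obtain ⟨C', hC', hm⟩ := moment_bound hb h ρ C hC hF 2
  refine ⟨Real.sqrt (Real.exp (-1) * c), Real.sqrt C', by positivity, by positivity, ?_⟩
  have e1 : ∀ᶠ α in 𝓝[>] (0:ℝ), α ≤ 1 := by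
    filter_upwards [Ioo_mem_nhdsGT (show (0:ℝ) < 1 by norm_num)] with α hα using hα.2.le
  filter_upwards [self_mem_nhdsWithin, hB, e1] with α hα hB hα1
  have hα : (0:ℝ) < α := hα
  have hP : 0 ≤ α^(-(ρ/2))/α := by positivity
  have hq := quad_lower (b := b) (b' := b) hb h α hα (fun _ _ => rfl) (fun l => (l:ℝ)^2) 1 (by norm_num)
    (fun l => by positivity) (WK_moment_summable hb h α hα 2) (fun l _ => by simp)
  have hm := hm α hα hα1
  constructor
  · apply Real.le_sqrt_of_sq_le
    rw [mul_pow, Real.sq_sqrt (by positivity), P_sq ρ α hα]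
    refine le_trans ?_ hq
    have : Real.exp (-1) * (c * α^(-ρ)/α^2) ≤ Real.exp (-1) * ∑ k ∈ Finset.range ⌊1/α⌋₊, b (k+1) * ((k:ℝ)+1)^2 := by gcongr
    calc _ = Real.exp (-1) * (c * α^(-ρ)/α^2) := by ring
      _ ≤ _ := this
      _ = _ := by ring
  · apply Real.sqrt_le_iff.mpr ⟨by positivity, ?_⟩
    rw [mul_pow, Real.sq_sqrt (by positivity), P_sq ρ α hα]
    calc _ ≤ _ := hm
      _ = _ := by ring

lemma rpow_neg_tendsto (r : ℝ) (hr : 0 < r) : Tendsto (fun α : ℝ => α^(-r)) (𝓝[>] 0) atTop := by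
  have := (tendsto_rpow_atTop hr).comp (tendsto_inv_nhdsGT_zero (𝕜 := ℝ))
  refine this.congr' ?_
  filter_upwards [self_mem_nhdsWithin] with α hα
  have hα : (0:ℝ) < α := hα
  simp only [Function.comp]
  rw [Real.inv_rpow hα.le, Real.rpow_neg hα.le]

lemma rpow_pos_tendsto (r : ℝ) (hr : 0 < r) : Tendsto (fun α : ℝ => α^r) (𝓝[>] 0) (𝓝 0) := by
  have : Tendsto (fun α : ℝ => α^r) (𝓝 0) (𝓝 (0^r)) :=
    ((Real.continuousAt_rpow_const 0 r (Or.inr hr.le)).tendsto)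
  rw [Real.zero_rpow hr.ne'] at this
  exact this.mono_left nhdsWithin_le_nhds

lemma exp_beats (ρ ε c : ℝ) (hε : 0 < ε) (hc : 0 < c) :
    Tendsto (fun α : ℝ => (α^(-(ρ/2))/α) * Real.exp (-(c * α^(-ε)))) (𝓝[>] 0) (𝓝 0) := by
  have := (tendsto_rpow_mul_exp_neg_mul_atTop_nhds_zero ((ρ/2+1)/ε) c hc).comp (rpow_neg_tendsto ε hε)
  refine this.congr' ?_
  filter_upwards [self_mem_nhdsWithin] with α hα
  have hα : (0:ℝ) < α := hα
  simp only [Function.comp]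
  rw [← Real.rpow_mul hα.le]
  congr 1
  · rw [show -ε * ((ρ/2+1)/ε) = -(ρ/2) - 1 by field_simp; ring, Real.rpow_sub_one hα.ne']
  · congr 1; ring

theorem llt_apply {b : ℕ → ℝ} (hb : ∀ k, 0 ≤ b k) (h : SE b) (ρ δ A K : ℝ) (hδ : 0 < δ) (hδρ : δ < ρ) (hA : 0 < A)
    (hK : 0 ≤ K) (hN : ∀ x, 0 < x → |NS (fun k => b (k+1)) x - A/ρ * x^ρ| ≤ K * x^(ρ-δ)) (h3 : M3 b)
    (α : ℕ → ℝ) (hα0 : ∀ n, 0 < α n) (hα : Tendsto α atTop (𝓝 0))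
    (b' : ℕ → ℕ → ℝ) (hb' : ∀ n k, 0 ≤ b' n k) (hle : ∀ n k, b' n k ≤ b k)
    (hag : ∀ᶠ n in atTop, ∀ k : ℕ, (k:ℝ) + 1 ≤ 1/α n → b' n (k+1) = b (k+1))
    (ha : Tendsto (fun n : ℕ => ((∑' i, WK (b' n) (α n) i * (lK i : ℝ)) - n) / sg b (α n)) atTop (𝓝 0))
    (hv : Tendsto (fun n : ℕ => (∑' i, WK (b' n) (α n) i * (lK i : ℝ)^2) / sg b (α n)^2) atTop (𝓝 1))
    (B : ℝ) (hB : ∀ᶠ n in atTop, ∑' k : ℕ, (b (k+1) - b' n (k+1)) * Real.exp (-(α n * ((k:ℝ)+1))) ≤ B) :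
    Tendsto (fun n : ℕ => (sg b (α n) : ℂ) * qC (WK (b' n) (α n)) lK n) atTop (𝓝 ((1/√(2*π) : ℝ) : ℂ)) := by
  have hρ : 0 < ρ := hδ.trans hδρ
  have hα' : Tendsto α atTop (𝓝[>] 0) :=
    tendsto_nhdsWithin_iff.mpr ⟨hα, Eventually.of_forall hα0⟩
  obtain ⟨c, C, hc, hC, hs⟩ := sg_bounds hb h ρ δ A K hδ hδρ hA hK hN
  have hs := hα'.eventually hs
  obtain ⟨cB, hcB, hBl⟩ := B_lower hb ρ δ A K hδ hδρ hA hK hN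
  have hBl := hα'.eventually hBl
  obtain ⟨CF, hCF, hF⟩ := F_bound hb h ρ δ A K hδ hδρ hA hK hN
  obtain ⟨C3, hC3, hm3⟩ := moment_bound hb h ρ CF hCF hF 3
  obtain ⟨ε, C₂, hε, hC₂, α₀, hα₀, h3⟩ := h3
  have hSE : ∀ n, SE (b' n) := fun n => h.mono (hb' n) (hle n)
  have hsm : ∀ᶠ n in atTop, α n ≤ 1 := hα.eventually_le_const (by norm_num)
  have hsm0 : ∀ᶠ n in atTop, α n ≤ α₀ := hα.eventually_le_const hα₀
  have hneg := (rpow_neg_tendsto (ρ/2) (by positivity)).comp hα'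
  have hασ : Tendsto (fun n => α n * sg b (α n)) atTop atTop := by
    refine tendsto_atTop_mono' atTop ?_ (hneg.const_mul_atTop hc)
    filter_upwards [hs] with n hn
    have h0 := hα0 n
    calc c * (α n)^(-(ρ/2)) = α n * (c * ((α n)^(-(ρ/2))/α n)) := by field_simp
      _ ≤ _ := by gcongr; exact hn.1
  have hσ : Tendsto (fun n => sg b (α n)) atTop atTop := by
    refine tendsto_atTop_mono' atTop ?_ hασ
    filter_upwards [hsm] with n hn
    have : 0 ≤ sg b (α n) := Real.sqrt_nonneg _
    nlinarith [hα0 n]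
  have hmono : ∀ n i, WK (b' n) (α n) i ≤ WK b (α n) i := by
    intro n i
    unfold WK
    have := hle n (i.1+1)
    gcongr
  refine llt (ι := ℕ × ℕ) (fun n => WK (b' n) (α n)) lK (fun n => sg b (α n)) α
    (fun n => 2 * (C₂ * (α n)^(-ε)) - 2 * B)
    (Real.exp (-1) * (2/π^2) * cB / C^2) (by positivity) hσ hασ
    (Eventually.of_forall fun n i => WK_nonneg _ (hb' n) _ _)
    (Eventually.of_forall fun n => (WK_hasSum (hb' n) (hSE n) _ (hα0 n)).summable)
    (Eventually.of_forall fun n => by simpa using WK_moment_summable (hb' n) (hSE n) _ (hα0 n) 1)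
    (Eventually.of_forall fun n => WK_moment_summable (hb' n) (hSE n) _ (hα0 n) 2)
    (Eventually.of_forall fun n => WK_moment_summable (hb' n) (hSE n) _ (hα0 n) 3)
    ha hv ?_ ?_ ?_ ?_ ?_
  · -- third moment
    have ht := ((rpow_pos_tendsto (ρ/2) (by positivity)).comp hα').const_mul (C3 / c^3)
    rw [mul_zero] at ht
    refine squeeze_zero' ?_ ?_ ht
    · filter_upwards with n
      have : 0 ≤ sg b (α n) := Real.sqrt_nonneg _
      have : 0 ≤ ∑' i, WK (b' n) (α n) i * (lK i : ℝ)^3 :=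
        tsum_nonneg fun i => mul_nonneg (WK_nonneg _ (hb' n) _ _) (by positivity)
      positivity
    · filter_upwards [hs, hsm] with n hn h1
      have h0 := hα0 n
      have hP : 0 < (α n)^(-(ρ/2))/α n := by positivity
      have hT : ∑' i, WK (b' n) (α n) i * (lK i : ℝ)^3 ≤ C3 * (α n)^(-ρ)/(α n)^3 := by
        refine le_trans ?_ (hm3 (α n) h0 h1)
        refine (WK_moment_summable (hb' n) (hSE n) _ h0 3).tsum_le_tsum (fun i => ?_) (WK_moment_summable hb h _ h0 3)
        exact mul_le_mul_of_nonneg_right (hmono n i) (by positivity)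
      have hx : (α n)^(-ρ) = (α n)^(-(ρ/2)) * (α n)^(-(ρ/2)) := by
        rw [← Real.rpow_add h0]; congr 1; ring
      have hy : (α n)^(ρ/2) = ((α n)^(-(ρ/2)))⁻¹ := by rw [Real.rpow_neg h0.le, inv_inv]
      have hz : 0 < (α n)^(-(ρ/2)) := by positivity
      calc _ ≤ (C3 * (α n)^(-ρ)/(α n)^3) / (c * ((α n)^(-(ρ/2))/α n))^3 := by
            gcongr; exact hn.1
        _ = _ := by
          simp only [Function.comp]
          rw [hx, hy]; field_simp
  · filter_upwards [hsm] with n hn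
    exact ⟨hα0 n, by linarith [Real.pi_gt_three]⟩
  · filter_upwards [hs, hBl, hag] with n hn hB hag θ hθ
    have h0 := hα0 n
    have hq := quad_lower (b := b) (b' := b' n) (hb' n) (hSE n) (α n) h0 hag (fun l => 1 - Real.cos (l * θ))
      (2/π^2 * θ^2) (by positivity) (fun l => by linarith [Real.cos_le_one (l * θ)])
      (cos_summable (hb' n) (hSE n) (α n) h0 θ).1 (fun l hl => by
        have : |(l:ℝ) * θ| ≤ π := by
          rw [abs_mul, abs_of_nonneg (by positivity : (0:ℝ) ≤ l)]
          calc (l:ℝ) * |θ| ≤ 1/α n * α n := by gcongr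
            _ = 1 := by field_simp
            _ ≤ π := by linarith [Real.pi_gt_three]
        have := Real.cos_le_one_sub_mul_cos_sq this
        rw [mul_pow] at this
        linarith)
    refine le_trans ?_ hq
    have hσ0 : 0 ≤ sg b (α n) := Real.sqrt_nonneg _
    have hσ2 : sg b (α n)^2 ≤ C^2 * ((α n)^(-ρ)/(α n)^2) := by
      rw [← P_sq ρ _ h0, ← mul_pow]; gcongr; exact hn.2
    calc _ ≤ Real.exp (-1) * (2/π^2) * cB / C^2 * (C^2 * ((α n)^(-ρ)/(α n)^2)) * θ^2 := by gcongr
      _ = Real.exp (-1) * (2/π^2 * θ^2) * (cB * (α n)^(-ρ)/(α n)^2) := by field_simp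
      _ ≤ _ := by gcongr
  · filter_upwards [hsm0, hB] with n hn hB θ h1 h2
    have h0 := hα0 n
    have hu := h3 (α n) h0 hn (θ/(2*π)) (by
      rw [abs_div, abs_of_pos (by positivity : 0 < 2*π)]
      gcongr) (by
      rw [abs_div, abs_of_pos (by positivity : 0 < 2*π), div_le_iff₀ (by positivity)]; linarith)
    have := m3_lower (hb' n) (hle n) h (α n) θ _ h0 hu
    linarith
  · have ht := ((exp_beats ρ ε (2*C₂) hε (by positivity)).comp hα').const_mul (C * Real.exp (2*B))
    rw [mul_zero] at ht
    refine squeeze_zero' ?_ ?_ ht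
    · filter_upwards with n
      have : 0 ≤ sg b (α n) := Real.sqrt_nonneg _
      positivity
    · filter_upwards [hs] with n hn
      simp only [Function.comp]
      calc _ ≤ C * ((α n)^(-(ρ/2))/α n) * Real.exp (-(2 * (C₂ * (α n)^(-ε)) - 2 * B)) := by
            gcongr; exact hn.2
        _ = _ := by
          rw [show -(2 * (C₂ * (α n)^(-ε)) - 2 * B) = 2*B + -(2 * C₂ * (α n)^(-ε)) by ring, Real.exp_add]; ring

end PartM

section PartN

lemma bT_le' (b : ℕ → ℝ) (hb : ∀ k, 0 ≤ b k) (m k : ℕ) : bT b m k ≤ b k := by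
  have := bT_add_bU b m k
  have := bU_nonneg b hb m k
  linarith

lemma tail_shift {b : ℕ → ℝ} (hb : ∀ k, 0 ≤ b k) (h : SE b) (α : ℝ) (hα : 0 < α) (m : ℕ) :
    ∑' k : ℕ, bU b m (k+1) * Real.exp (-(α * ((k:ℝ)+1))) =
      ∑' k : ℕ, b (m + k + 1) * Real.exp (-(α * ((m : ℝ) + k + 1))) := by
  have hs := (h.mono (bU_nonneg b hb m) (bU_le b hb m)) α hα
  rw [← hs.sum_add_tsum_nat_add m, Finset.sum_eq_zero, zero_add]
  · refine tsum_congr fun k => ?_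
    unfold bU
    rw [if_neg (by omega)]
    push_cast
    congr 2
    · ring
    · ring
  · intro k hk
    rw [Finset.mem_range] at hk
    unfold bU
    rw [if_pos (by omega), zero_mul]

lemma Fb_split {b : ℕ → ℝ} (hb : ∀ k, 0 ≤ b k) (h : SE b) (α : ℝ) (hα : 0 < α) (m : ℕ) :
    Fb b (Real.exp (-α)) = Fb (bT b m) (Real.exp (-α)) + Fb (bU b m) (Real.exp (-α)) := by
  have h1 := WK_hasSum (bT_nonneg b hb m) (h.mono (bT_nonneg b hb m) (bT_le' b hb m)) α hα
  have h2 := WK_hasSum (bU_nonneg b hb m) (h.mono (bU_nonneg b hb m) (bU_le b hb m)) α hα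
  have h3 := h1.add h2
  simp_rw [WK_add] at h3
  exact (WK_hasSum hb h α hα).unique h3

lemma Fb_bU_bounds {b : ℕ → ℝ} (hb : ∀ k, 0 ≤ b k) (h : SE b) (α : ℝ) (hα : 0 < α) (m : ℕ) (hm : 0 < m) :
    ∑' k : ℕ, bU b m (k+1) * Real.exp (-(α * ((k:ℝ)+1))) ≤ Fb (bU b m) (Real.exp (-α)) ∧
    Fb (bU b m) (Real.exp (-α)) ≤
      (∑' k : ℕ, bU b m (k+1) * Real.exp (-(α * ((k:ℝ)+1)))) / (1 - Real.exp (-(α * m))) := by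
  have hs := (h.mono (bU_nonneg b hb m) (bU_le b hb m)) α hα
  have hE : Real.exp (-(α * m)) < 1 := by
    rw [Real.exp_lt_one_iff]
    have : (0:ℝ) < m := by exact_mod_cast hm
    have := mul_pos hα this
    linarith
  have hF : Fb (bU b m) (Real.exp (-α)) = ∑' k : ℕ, bU b m (k+1) * (-Real.log (1 - Real.exp (-(α * ((k:ℝ)+1))))) := by
    unfold Fb
    rw [← tsum_neg]
    refine tsum_congr fun k => ?_
    rw [exp_neg_pow]; push_cast; ring
  have low : ∀ k : ℕ, bU b m (k+1) * Real.exp (-(α * ((k:ℝ)+1))) ≤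
      bU b m (k+1) * (-Real.log (1 - Real.exp (-(α * ((k:ℝ)+1))))) := by
    intro k
    refine mul_le_mul_of_nonneg_left ?_ (bU_nonneg b hb m _)
    refine (neg_log_bound _ (Real.exp_pos _).le ?_).1
    rw [Real.exp_lt_one_iff]
    have : 0 < α * ((k:ℝ)+1) := by positivity
    linarith
  have up : ∀ k : ℕ, bU b m (k+1) * (-Real.log (1 - Real.exp (-(α * ((k:ℝ)+1))))) ≤
      bU b m (k+1) * Real.exp (-(α * ((k:ℝ)+1))) / (1 - Real.exp (-(α * m))) := by
    intro k
    by_cases hk : k + 1 ≤ m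
    · unfold bU; rw [if_pos hk]; simp
    · rw [mul_div_assoc]
      refine mul_le_mul_of_nonneg_left ?_ (bU_nonneg b hb m _)
      have hle : Real.exp (-(α * ((k:ℝ)+1))) ≤ Real.exp (-(α * m)) := by
        apply Real.exp_le_exp.mpr
        have : (m:ℝ) ≤ (k:ℝ)+1 := by exact_mod_cast (by omega : m ≤ k+1)
        have := mul_le_mul_of_nonneg_left this hα.le
        linarith
      refine (neg_log_bound _ (Real.exp_pos _).le (by linarith)).2.trans ?_
      have : 0 < 1 - Real.exp (-(α * m)) := by linarith
      gcongr
  have s2 : Summable (fun k : ℕ => bU b m (k+1) * (-Real.log (1 - Real.exp (-(α * ((k:ℝ)+1)))))) :=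
    Summable.of_nonneg_of_le (fun k => (mul_nonneg (bU_nonneg b hb m _) (Real.exp_pos _).le).trans (low k)) up
      (hs.div_const _)
  rw [hF]
  exact ⟨hs.tsum_le_tsum low s2, (s2.tsum_le_tsum up (hs.div_const _)).trans_eq tsum_div_const⟩

theorem main_thm    (b : ℕ → ℝ) (hb : ∀ k, 0 ≤ b k) (ρ C₀ A C₁ : ℝ) (Dc : ℂ → ℂ)
    (h1 : M1 b ρ C₀ A Dc) (h2 : M2 C₀ C₁ Dc) (h3 : M3 b)
    (p : ℕ → ℝ) (hp : ∀ x : ℝ, |x| < 1 → HasSum (fun n : ℕ => p n * x ^ n) (fb b x))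
    (pm : ℕ → ℕ → ℝ)
    (hpm : ∀ m' : ℕ, ∀ x : ℝ, |x| < 1 → HasSum (fun n : ℕ => pm m' n * x ^ n) (fmb b m' x))
    (t : ℝ) (m : ℕ → ℕ)
    (hm : ∀ᶠ n : ℕ in atTop,
      (aM ρ A n * (m n : ℝ) + ρ * Real.log (aM ρ A n)
          - (ρ - 1) * Real.log |Real.log (aM ρ A n)|
          - (ρ - 1) * Real.log ρ - Real.log A ≤ t) ∧
      (t < aM ρ A n * ((m n : ℝ) + 1) + ρ * Real.log (aM ρ A n)
          - (ρ - 1) * Real.log |Real.log (aM ρ A n)|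
          - (ρ - 1) * Real.log ρ - Real.log A)) :
    Tendsto (fun n : ℕ => pm (m n) n / p n) atTop (𝓝 (Real.exp (-Real.exp (-t)))) := by
  have hA : 0 < A := h1.2.2.2.1
  have hSE : SE b := fun β hβ => summ_exp b hb (ρ+1)
    (summable_dirichlet b ρ C₀ A Dc h1 (ρ+1) (by linarith)) β hβ
  obtain ⟨δ, K, hδ, hδρ, hK, hN, hN1⟩ := NS_asymp b hb ρ C₀ A C₁ Dc h1 h2
  have hρ : 0 < ρ := hδ.trans hδρ
  obtain ⟨CM, hCM, hM⟩ := M_asymp hb hSE ρ δ A K hδ hδρ hK hN1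
  obtain ⟨α, hα0, hmean, hα, hsad⟩ := saddle hb hSE ρ δ A CM hδ hδρ hA hCM hM
  obtain ⟨q1, q2, q3, q4⟩ := scale_asymp ρ δ A CM t hρ hδ hA α m hα0 hα hsad hm
  have hS := tail_limit hb hSE ρ δ A K hδ hδρ hA hK hN α m _ hα0 q1 q2 q3
  have hα' : Tendsto α atTop (𝓝[>] 0) :=
    tendsto_nhdsWithin_iff.mpr ⟨hα, Eventually.of_forall hα0⟩
  obtain ⟨c, C, hc, hC, hs⟩ := sg_bounds hb hSE ρ δ A K hδ hδρ hA hK hN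
  have hs := hα'.eventually hs
  obtain ⟨CF, hCF, hF⟩ := F_bound hb hSE ρ δ A K hδ hδρ hA hK hN
  obtain ⟨U1, hU1, ht1⟩ := tail_moment_bound hb hSE ρ CF hCF hF 1
  obtain ⟨U2, hU2, ht2⟩ := tail_moment_bound hb hSE ρ CF hCF hF 2
  have hsm : ∀ᶠ n in atTop, α n ≤ 1 := hα.eventually_le_const (by norm_num)
  have hbT := fun n => bT_nonneg b hb (m n)
  have hbU := fun n => bU_nonneg b hb (m n)
  have sT : ∀ n, SE (bT b (m n)) := fun n => hSE.mono (hbT n) (bT_le' b hb (m n))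
  have sU : ∀ n, SE (bU b (m n)) := fun n => hSE.mono (hbU n) (bU_le b hb (m n))
  have hσpos : ∀ᶠ n in atTop, 0 < sg b (α n) := by
    filter_upwards [hs] with n hn
    have := hα0 n
    exact lt_of_lt_of_le (by positivity) hn.1
  have hsq : ∀ n, sg b (α n)^2 = ∑' i, WK b (α n) i * (lK i : ℝ)^2 := fun n =>
    Real.sq_sqrt (tsum_nonneg fun i => mul_nonneg (WK_nonneg _ hb _ _) (by positivity))
  have msplit : ∀ n (q : ℕ), ∑' i, WK (bT b (m n)) (α n) i * (lK i : ℝ)^q =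
      (∑' i, WK b (α n) i * (lK i : ℝ)^q) - ∑' i, WK (bU b (m n)) (α n) i * (lK i : ℝ)^q := by
    intro n q
    rw [← (WK_moment_summable hb hSE _ (hα0 n) q).tsum_sub (WK_moment_summable (hbU n) (sU n) _ (hα0 n) q)]
    refine tsum_congr fun i => ?_
    rw [← WK_add b (m n) (α n) i]; ring
  have hUnn : ∀ n (q : ℕ), 0 ≤ ∑' i, WK (bU b (m n)) (α n) i * (lK i : ℝ)^q := fun n q =>
    tsum_nonneg fun i => mul_nonneg (WK_nonneg _ (hbU n) _ _) (by positivity)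
  have hone : Tendsto (fun n : ℕ => (∑' i, WK b (α n) i * (lK i : ℝ)^2) / sg b (α n)^2) atTop (𝓝 1) := by
    refine tendsto_const_nhds.congr' ?_
    filter_upwards [hσpos] with n hn
    rw [← hsq, div_self (by positivity)]
  have full := llt_apply hb hSE ρ δ A K hδ hδρ hA hK hN h3 α hα0 hα (fun _ => b) (fun _ => hb)
    (fun _ _ => le_refl _) (Eventually.of_forall fun _ _ _ => rfl)
    (by
      refine tendsto_const_nhds.congr' ?_
      filter_upwards [hmean] with n hn
      rw [hn]; simp)
    hone 0 (Eventually.of_forall fun n => by simp)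
  have hDeq : ∀ n, ∑' k : ℕ, (b (k+1) - bT b (m n) (k+1)) * Real.exp (-(α n * ((k:ℝ)+1))) =
      ∑' k : ℕ, bU b (m n) (k+1) * Real.exp (-(α n * ((k:ℝ)+1))) := fun n =>
    tsum_congr fun k => by rw [← bT_add_bU b (m n) (k+1)]; ring
  have hS' : Tendsto (fun n => ∑' k : ℕ, bU b (m n) (k+1) * Real.exp (-(α n * ((k:ℝ)+1)))) atTop
      (𝓝 (Real.exp (-t))) := hS.congr fun n => (tail_shift hb hSE (α n) (hα0 n) (m n)).symm
  have trunc := llt_apply hb hSE ρ δ A K hδ hδρ hA hK hN h3 α hα0 hα (fun n => bT b (m n)) hbT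
    (fun n => bT_le' b hb (m n))
    (by
      filter_upwards [q1.eventually_ge_atTop 1] with n hn k hk
      have h0 := hα0 n
      unfold bT
      rw [if_pos]
      have : (k:ℝ) + 1 ≤ m n := by
        refine hk.trans ?_
        rw [div_le_iff₀ h0]; linarith
      exact_mod_cast this)
    (by
      have ht := (q4.const_mul (U1/c)).neg
      rw [mul_zero, neg_zero] at ht
      refine tendsto_of_tendsto_of_tendsto_of_le_of_le' ht tendsto_const_nhds ?_ ?_
      · filter_upwards [hmean, hs, hσpos, hsm] with n h1 h2 h4 h5
        have h0 := hα0 n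
        have := msplit n 1
        simp only [pow_one] at this
        rw [this, h1]
        have hu := ht1 (α n) h0 h5 (m n)
        have hu0 := hUnn n 1
        simp only [pow_one] at hu hu0
        have hx : (α n)^(-ρ) = (α n)^(-(ρ/2)) * (α n)^(-(ρ/2)) := by
          rw [← Real.rpow_add h0]; congr 1; ring
        have hz : 0 < (α n)^(-(ρ/2)) := by positivity
        have : (∑' i, WK (bU b (m n)) (α n) i * (lK i : ℝ)) / sg b (α n) ≤
            U1 / c * ((α n)^(-(ρ/2)) * Real.exp (-(3/4 * (α n * m n)))) := by
          calc _ ≤ (U1 * (α n)^(-ρ) / α n * Real.exp (-(3/4 * (α n * m n)))) / (c * ((α n)^(-(ρ/2))/α n)) := by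
                gcongr; exact h2.1
            _ = _ := by rw [hx]; field_simp
        rw [show ((n:ℝ) - (∑' i, WK (bU b (m n)) (α n) i * (lK i : ℝ)) - n) / sg b (α n) =
          -((∑' i, WK (bU b (m n)) (α n) i * (lK i : ℝ)) / sg b (α n)) by ring]
        linarith
      · filter_upwards [hmean, hσpos] with n h1 h4
        have := msplit n 1
        simp only [pow_one] at this
        rw [this, h1]
        have hu0 := hUnn n 1
        simp only [pow_one] at hu0
        apply div_nonpos_of_nonpos_of_nonneg _ h4.le
        linarith)
    (by
      have hE : Tendsto (fun n => U2/c^2 * Real.exp (-(3/4 * (α n * m n)))) atTop (𝓝 0) := by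
        have := (Real.tendsto_exp_neg_atTop_nhds_zero.comp (q1.const_mul_atTop (show (0:ℝ) < 3/4 by norm_num))).const_mul (U2/c^2)
        rw [mul_zero] at this
        exact this
      have hz : Tendsto (fun n : ℕ => (∑' i, WK (bU b (m n)) (α n) i * (lK i : ℝ)^2) / sg b (α n)^2) atTop (𝓝 0) := by
        refine squeeze_zero' ?_ ?_ hE
        · filter_upwards with n
          have := hUnn n 2
          positivity
        · filter_upwards [hs, hσpos, hsm] with n h2 h4 h5
          have h0 := hα0 n
          have hu := ht2 (α n) h0 h5 (m n)
          have hu0 := hUnn n 2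
          have hz : 0 < (α n)^(-ρ) := by positivity
          have hl : c^2 * ((α n)^(-ρ)/(α n)^2) ≤ sg b (α n)^2 := by
            rw [← P_sq ρ _ h0, ← mul_pow]
            gcongr; exact h2.1
          calc _ ≤ (U2 * (α n)^(-ρ) / (α n)^2 * Real.exp (-(3/4 * (α n * m n)))) / (c^2 * ((α n)^(-ρ)/(α n)^2)) := by
                gcongr
            _ = _ := by field_simp
      have := hone.sub hz
      rw [sub_zero] at this
      refine this.congr fun n => ?_
      rw [msplit n 2, sub_div])
    (Real.exp (-t) + 1)
    (by
      filter_upwards [hS'.eventually_le_const (show Real.exp (-t) < Real.exp (-t) + 1 by linarith)] with n hn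
      rw [hDeq]; exact hn)
  have hFU : Tendsto (fun n => Fb (bU b (m n)) (Real.exp (-α n))) atTop (𝓝 (Real.exp (-t))) := by
    have hE : Tendsto (fun n => 1 - Real.exp (-(α n * m n))) atTop (𝓝 1) := by
      have := (Real.tendsto_exp_neg_atTop_nhds_zero.comp q1).const_sub 1
      rw [sub_zero] at this
      exact this
    have hup := hS'.div hE one_ne_zero
    rw [div_one] at hup
    have hmpos : ∀ᶠ n in atTop, 0 < m n := by
      filter_upwards [q1.eventually_ge_atTop 1] with n hn
      rcases Nat.eq_zero_or_pos (m n) with h | h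
      · rw [h] at hn; norm_num at hn
      · exact h
    refine tendsto_of_tendsto_of_tendsto_of_le_of_le' hS' hup ?_ ?_
    · filter_upwards [hmpos] with n hn using (Fb_bU_bounds hb hSE (α n) (hα0 n) (m n) hn).1
    · filter_upwards [hmpos] with n hn using (Fb_bU_bounds hb hSE (α n) (hα0 n) (m n) hn).2
  have hne : ((1/√(2*π) : ℝ) : ℂ) ≠ 0 := by
    rw [Complex.ofReal_ne_zero]; positivity
  have hratio := trunc.div full hne
  rw [div_self hne] at hratio
  have hexp : Tendsto (fun n => ((Real.exp (-Fb (bU b (m n)) (Real.exp (-α n))) : ℝ) : ℂ)) atTop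
      (𝓝 ((Real.exp (-Real.exp (-t)) : ℝ) : ℂ)) :=
    (Complex.continuous_ofReal.tendsto _).comp ((Real.continuous_exp.tendsto _).comp hFU.neg)
  have hfin := hexp.mul hratio
  rw [mul_one] at hfin
  have hcx : Tendsto (fun n : ℕ => ((pm (m n) n / p n : ℝ) : ℂ)) atTop (𝓝 ((Real.exp (-Real.exp (-t)) : ℝ) : ℂ)) := by
    refine hfin.congr' ?_
    filter_upwards [hσpos] with n hn
    have h0 := hα0 n
    have c1 := coeff_eq b hb hSE.pow p hp (α n) h0 n
    have c2 := coeff_eq (bT b (m n)) (hbT n) (sT n).pow (pm (m n)) (fun x hx => by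
      have := hpm (m n) x hx
      unfold fmb at this
      unfold fb
      rw [Fb_bT]; exact this) (α n) h0 n
    have hsp := Fb_split hb hSE (α n) h0 (m n)
    have hσne : (sg b (α n) : ℂ) ≠ 0 := Complex.ofReal_ne_zero.mpr hn.ne'
    have hen : ((Real.exp (-(α n * n)) : ℝ) : ℂ) ≠ 0 := Complex.ofReal_ne_zero.mpr (Real.exp_pos _).ne'
    have hF1 : ((Real.exp (Fb b (Real.exp (-α n))) : ℝ) : ℂ) ≠ 0 := Complex.ofReal_ne_zero.mpr (Real.exp_pos _).ne'
    have hF2 : ((Real.exp (-Fb (bU b (m n)) (Real.exp (-α n))) : ℝ) : ℂ) =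
        ((Real.exp (Fb (bT b (m n)) (Real.exp (-α n))) : ℝ) : ℂ) / ((Real.exp (Fb b (Real.exp (-α n))) : ℝ) : ℂ) := by
      rw [← Complex.ofReal_div, ← Real.exp_sub]
      congr 2; rw [hsp]; ring
    rw [hF2, Pi.div_apply, mul_div_mul_left _ _ hσne, div_mul_div_comm, ← c1, ← c2]
    push_cast
    push_cast at hen
    rw [mul_div_mul_right _ _ hen]
  have := (Complex.continuous_re.tendsto _).comp hcx
  simpa [Function.comp_def, -Complex.ofReal_exp, -Complex.ofReal_div] using this

end PartN

theorem statement0    (b : ℕ → ℝ) (hb : ∀ k, 0 ≤ b k) (ρ C₀ A C₁ : ℝ) (Dc : ℂ → ℂ)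
    (h1 : M1 b ρ C₀ A Dc) (h2 : M2 C₀ C₁ Dc) (h3 : M3 b)
    (p : ℕ → ℝ) (hp : ∀ x : ℝ, |x| < 1 → HasSum (fun n : ℕ => p n * x ^ n) (fb b x))
    (pm : ℕ → ℕ → ℝ)
    (hpm : ∀ m' : ℕ, ∀ x : ℝ, |x| < 1 → HasSum (fun n : ℕ => pm m' n * x ^ n) (fmb b m' x))
    (t : ℝ) (m : ℕ → ℕ)
    (hm : ∀ᶠ n : ℕ in atTop,
      (aM ρ A n * (m n : ℝ) + ρ * Real.log (aM ρ A n)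
          - (ρ - 1) * Real.log |Real.log (aM ρ A n)|
          - (ρ - 1) * Real.log ρ - Real.log A ≤ t) ∧
      (t < aM ρ A n * ((m n : ℝ) + 1) + ρ * Real.log (aM ρ A n)
          - (ρ - 1) * Real.log |Real.log (aM ρ A n)|
          - (ρ - 1) * Real.log ρ - Real.log A)) :
    Tendsto (fun n : ℕ => pm (m n) n / p n) atTop (𝓝 (Real.exp (-Real.exp (-t)))) := by
  exact main_thm b hb ρ C₀ A C₁ Dc h1 h2 h3 p hp pm hpm t m hm
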